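/- For every ε > 0: with y = T^{1/4}, ∫_T^{2T} |R₂(x)|^7 dx ≤ C(ε)·T^{11/4 − 1/336 + ε} for all T ≥ 10. -/

import Mathlib

open MeasureTheory

/-- The divisor function `d(n)`. -/
def divfun (n : ℕ) : ℕ := n.divisors.card

/-- The error term in the Dirichlet divisor problem. -/
noncomputable def DirichletDelta (x : ℝ) : ℝ :=
  (∑ n ∈ Finset.Icc 1 ⌊x⌋₊, (divfun n : ℝ)) - x * Real.log x -
    (2 * Real.eulerMascheroniConstant - 1) * x

/-- The truncated Voronoï sum `R₁(x)` with truncation parameter `y`. -/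
noncomputable def R1 (y x : ℝ) : ℝ :=
  (1 / (Real.sqrt 2 * Real.pi)) * ∑ n ∈ Finset.Icc 1 ⌊y⌋₊,
    (divfun n : ℝ) / (n : ℝ) ^ ((3 : ℝ) / 4) * x ^ ((1 : ℝ) / 4) *
      Real.cos (4 * Real.pi * Real.sqrt (n * x) - Real.pi / 4)

/-- The tail `R₂(x) = Δ(x) - R₁(x)`. -/
noncomputable def R2 (y x : ℝ) : ℝ := DirichletDelta x - R1 y x


namespace DivM

lemma divfun_mul_le (m n : ℕ) : divfun (m * n) ≤ divfun m * divfun n := by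
  unfold divfun
  rw [Nat.divisors_mul]
  exact Finset.card_mul_le

lemma divfun_pos {n : ℕ} (hn : 0 < n) : 1 ≤ divfun n := by
  unfold divfun
  exact Finset.card_pos.mpr ⟨1, by simp; omega⟩

lemma card_divAnti (n : ℕ) : n.divisorsAntidiagonal.card = n.divisors.card := by
  rw [← Nat.map_div_right_divisors, Finset.card_map]

/-- Passing from nonnegative summable functions on pairs to the divisor-weighted sum. -/
lemma summable_div_of_pairs (f : ℕ → ℝ) (hf : ∀ n, 0 ≤ f n)
    (h : Summable (fun p : ℕ+ × ℕ+ => f ((p.1 : ℕ) * (p.2 : ℕ)))) :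
    Summable (fun n : ℕ+ => (divfun n : ℝ) * f n) := by
  rw [← sigmaAntidiagonalEquivProd.summable_iff] at h
  have h2 : Summable (fun x : (Σ n : ℕ+, Nat.divisorsAntidiagonal n) => f x.1) := by
    refine h.congr ?_
    rintro ⟨n, ⟨⟨a, b⟩, hx⟩⟩
    have := (Nat.mem_divisorsAntidiagonal.mp hx).1
    exact congrArg f this
  have h3 := ((summable_sigma_of_nonneg (fun x => hf _)).mp h2).2
  refine h3.congr ?_
  intro n
  simp [tsum_fintype, divfun, card_divAnti]

lemma tsum_div_of_pairs (f : ℕ → ℝ)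
    (h : Summable (fun p : ℕ+ × ℕ+ => f ((p.1 : ℕ) * (p.2 : ℕ)))) :
    ∑' p : ℕ+ × ℕ+, f ((p.1 : ℕ) * (p.2 : ℕ)) = ∑' n : ℕ+, (divfun n : ℝ) * f n := by
  have h0 := h
  rw [← sigmaAntidiagonalEquivProd.summable_iff] at h
  have e : (fun x : (Σ n : ℕ+, Nat.divisorsAntidiagonal n) =>
      f (((sigmaAntidiagonalEquivProd x).1 : ℕ) * ((sigmaAntidiagonalEquivProd x).2 : ℕ)))
      = fun x => f x.1 := by
    funext ⟨n, ⟨⟨a, b⟩, hx⟩⟩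
    have := (Nat.mem_divisorsAntidiagonal.mp hx).1
    exact congrArg f this
  have h2 : Summable (fun x : (Σ n : ℕ+, Nat.divisorsAntidiagonal n) => f x.1) := by
    rw [← e]; exact h
  rw [← sigmaAntidiagonalEquivProd.tsum_eq, e, h2.tsum_sigma]
  refine tsum_congr ?_
  intro n
  simp [tsum_fintype, divfun, card_divAnti]

lemma summable_divfun_pow (k : ℕ) :
    Summable (fun n : ℕ+ => (divfun n : ℝ) ^ k * ((n : ℝ) ^ 2)⁻¹) := by
  induction k with
  | zero =>
    simp only [pow_zero, one_mul]
    have := (Real.summable_nat_pow_inv (p := 2)).mpr (by norm_num)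
    exact this.comp_injective PNat.coe_injective
  | succ k ih =>
    have h := ih.mul_of_nonneg ih (fun n => by positivity) (fun n => by positivity)
    have h2 : Summable (fun p : ℕ+ × ℕ+ => (fun n : ℕ => (divfun n : ℝ) ^ k * ((n : ℝ) ^ 2)⁻¹)
        ((p.1 : ℕ) * (p.2 : ℕ))) := by
      refine Summable.of_nonneg_of_le (fun p => by positivity) ?_ h
      rintro ⟨a, b⟩
      have := divfun_mul_le a b
      have h3 : (divfun (a * b) : ℝ) ≤ divfun a * divfun b := by exact_mod_cast this
      simp only
      calc (divfun (a * b) : ℝ) ^ k * ((((a : ℕ) * (b : ℕ) : ℕ) : ℝ) ^ 2)⁻¹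
          ≤ (divfun a * divfun b : ℝ) ^ k * ((((a : ℕ) * (b : ℕ) : ℕ) : ℝ) ^ 2)⁻¹ := by gcongr
        _ = _ := by push_cast; rw [mul_pow, mul_pow, mul_inv]; ring
    have hnn : ∀ n : ℕ, 0 ≤ (divfun n : ℝ) ^ k * ((n : ℝ) ^ 2)⁻¹ := fun n => by positivity
    have h4 := summable_div_of_pairs _ hnn h2
    refine h4.congr ?_
    intro n
    ring

/-- The divisor bound. -/
lemma divfun_le (δ : ℝ) (hδ : 0 < δ) :
    ∃ C : ℝ, 1 ≤ C ∧ ∀ n : ℕ, (divfun n : ℝ) ≤ C * (n : ℝ) ^ δ := by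
  obtain ⟨k, hk⟩ := exists_nat_gt (2 / δ)
  have hk0 : (0 : ℝ) < k := lt_trans (by positivity) hk
  have hk0' : k ≠ 0 := by rintro rfl; simp at hk0
  set S := ∑' n : ℕ+, (divfun n : ℝ) ^ k * ((n : ℝ) ^ 2)⁻¹
  refine ⟨max 1 S, le_max_left _ _, ?_⟩
  intro n
  rcases Nat.eq_zero_or_pos n with rfl | hn
  · simp [divfun]; positivity
  have h1 : (divfun n : ℝ) ^ k * ((n : ℝ) ^ 2)⁻¹ ≤ S :=
    (summable_divfun_pow k).le_tsum (⟨n, hn⟩ : ℕ+) (fun j _ => by positivity)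
  have hn' : (1 : ℝ) ≤ n := by exact_mod_cast hn
  have hM : (1 : ℝ) ≤ max 1 S := le_max_left _ _
  have h2 : (divfun n : ℝ) ^ k ≤ (max 1 S * (n : ℝ) ^ δ) ^ k := by
    have : (divfun n : ℝ) ^ k ≤ S * (n : ℝ) ^ 2 := by
      rwa [← div_eq_mul_inv, div_le_iff₀ (by positivity)] at h1
    refine this.trans ?_
    rw [mul_pow]
    have a1 : S ≤ (max 1 S) ^ k := (le_max_right 1 S).trans (le_self_pow₀ hM hk0')
    have a2 : (n : ℝ) ^ 2 ≤ ((n : ℝ) ^ δ) ^ k := by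
      rw [← Real.rpow_natCast, ← Real.rpow_natCast, ← Real.rpow_mul (by positivity)]
      apply Real.rpow_le_rpow_of_exponent_le hn'
      rw [div_lt_iff₀ hδ] at hk
      push_cast
      linarith
    exact mul_le_mul a1 a2 (by positivity) (by positivity)
  exact le_of_pow_le_pow_left₀ hk0' (by positivity) h2

end DivM


namespace DivM

/-- `e(x) = exp(2πix)`. -/
noncomputable def e (x : ℝ) : ℂ := Complex.exp (((2 * Real.pi * x : ℝ) : ℂ) * Complex.I)

lemma norm_e (x : ℝ) : ‖e x‖ = 1 := Complex.norm_exp_ofReal_mul_I _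

lemma e_add (x y : ℝ) : e (x + y) = e x * e y := by
  unfold e; rw [← Complex.exp_add]; congr 1; push_cast; ring

lemma e_zero : e 0 = 1 := by simp [e]

lemma e_re (x : ℝ) : (e x).re = Real.cos (2 * Real.pi * x) := by
  unfold e; rw [Complex.exp_ofReal_mul_I_re]

lemma e_neg (x : ℝ) : e (-x) = (starRingEnd ℂ) (e x) := by
  unfold e; rw [← Complex.exp_conj]; congr 1; rw [map_mul, Complex.conj_ofReal, Complex.conj_I]; push_cast; ring

lemma continuous_e : Continuous e := by unfold e; fun_prop

lemma contDiff_e : ContDiff ℝ ⊤ e := by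
  unfold e
  apply ContDiff.cexp
  apply ContDiff.mul _ contDiff_const
  exact Complex.ofRealCLM.contDiff.comp (contDiff_const.mul contDiff_id)

lemma hasDerivAt_e_comp {p : ℝ → ℝ} {p' t : ℝ} (h : HasDerivAt p p' t) :
    HasDerivAt (fun t => e (p t)) (2 * Real.pi * Complex.I * (p' : ℂ) * e (p t)) t := by
  unfold e
  have h1 : HasDerivAt (fun t => (((2 * Real.pi * p t : ℝ) : ℂ) * Complex.I))
      (((2 * Real.pi * p' : ℝ) : ℂ) * Complex.I) t :=
    ((h.const_mul (2 * Real.pi)).ofReal_comp).mul_const _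
  convert h1.cexp using 1
  push_cast; ring

lemma ibp_step {a b : ℝ} (hab : a ≤ b) {u u' p p1 : ℝ → ℝ}
    (hu : ∀ t ∈ Set.Icc a b, HasDerivAt u (u' t) t)
    (hp : ∀ t ∈ Set.Icc a b, HasDerivAt p (p1 t) t)
    (hu'c : ContinuousOn u' (Set.Icc a b)) (hp1c : ContinuousOn p1 (Set.Icc a b))
    (ha : u a = 0) (hb : u b = 0) :
    ‖∫ t in a..b, ((u t * p1 t : ℝ) : ℂ) * e (p t)‖ ≤ ‖∫ t in a..b, ((u' t : ℝ) : ℂ) * e (p t)‖ := by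
  have hI : Set.uIcc a b = Set.Icc a b := Set.uIcc_of_le hab
  have hpc : ContinuousOn p (Set.Icc a b) := fun t ht => (hp t ht).continuousAt.continuousWithinAt
  have hec : ContinuousOn (fun t => e (p t)) (Set.Icc a b) := continuous_e.comp_continuousOn hpc
  have key := intervalIntegral.integral_mul_deriv_eq_deriv_mul (a := a) (b := b)
    (u := fun t => ((u t : ℝ) : ℂ)) (u' := fun t => ((u' t : ℝ) : ℂ))
    (v := fun t => e (p t)) (v' := fun t => 2 * Real.pi * Complex.I * (p1 t : ℂ) * e (p t))
    (by rw [hI]; exact fun t ht => (hu t ht).ofReal_comp)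
    (by rw [hI]; exact fun t ht => hasDerivAt_e_comp (hp t ht))
    (by
      apply ContinuousOn.intervalIntegrable; rw [hI]
      exact Complex.continuous_ofReal.comp_continuousOn hu'c)
    (by
      apply ContinuousOn.intervalIntegrable; rw [hI]
      exact (continuousOn_const.mul (Complex.continuous_ofReal.comp_continuousOn hp1c)).mul hec)
  simp only [ha, hb, Complex.ofReal_zero, zero_mul, sub_zero, zero_sub] at key
  have h2 : (∫ t in a..b, ((u t : ℝ) : ℂ) * (2 * Real.pi * Complex.I * (p1 t : ℂ) * e (p t)))
      = (2 * Real.pi * Complex.I) * ∫ t in a..b, ((u t * p1 t : ℝ) : ℂ) * e (p t) := by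
    rw [← intervalIntegral.integral_const_mul]
    congr 1; funext t; push_cast; ring
  rw [h2] at key
  have h3 := congrArg norm key
  rw [norm_mul, norm_neg] at h3
  have h4 : ‖(2 * Real.pi * Complex.I : ℂ)‖ = 2 * Real.pi := by
    simp [abs_of_pos Real.pi_pos]
  rw [h4] at h3
  rw [← h3]
  have : (1 : ℝ) ≤ 2 * Real.pi := by linarith [Real.pi_gt_three]
  nlinarith [norm_nonneg (∫ t in a..b, ((u t * p1 t : ℝ) : ℂ) * e (p t))]

lemma ibp2 {a b : ℝ} (hab : a ≤ b) {F F1 F2 p p1 p2 p3 : ℝ → ℝ} {m A Q : ℝ}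
    (hm : 0 < m) (hQ : 0 ≤ Q) (hA0 : 0 ≤ A)
    (hF : ∀ t ∈ Set.Icc a b, HasDerivAt F (F1 t) t)
    (hF1 : ∀ t ∈ Set.Icc a b, HasDerivAt F1 (F2 t) t)
    (hp : ∀ t ∈ Set.Icc a b, HasDerivAt p (p1 t) t)
    (hp1 : ∀ t ∈ Set.Icc a b, HasDerivAt p1 (p2 t) t)
    (hp2 : ∀ t ∈ Set.Icc a b, HasDerivAt p2 (p3 t) t)
    (hF2c : ContinuousOn F2 (Set.Icc a b)) (hp3c : ContinuousOn p3 (Set.Icc a b))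
    (ha : F a = 0) (hb : F b = 0) (ha1 : F1 a = 0) (hb1 : F1 b = 0)
    (hA : ∀ t ∈ Set.Icc a b, |F t| ≤ A ∧ |F1 t| ≤ A ∧ |F2 t| ≤ A)
    (hpm : ∀ t ∈ Set.Icc a b, m ≤ |p1 t|)
    (hpB : ∀ t ∈ Set.Icc a b, |p2 t| ≤ Q * m ∧ |p3 t| ≤ Q * m) :
    ‖∫ t in a..b, ((F t : ℝ) : ℂ) * e (p t)‖ ≤ (b - a) * (A * (1 + 4 * Q + 3 * Q ^ 2)) / m ^ 2 := by
  have hne : ∀ t ∈ Set.Icc a b, p1 t ≠ 0 := by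
    intro t ht h0
    have := hpm t ht
    rw [h0, abs_zero] at this; linarith
  have cF : ContinuousOn F (Set.Icc a b) := fun t ht => (hF t ht).continuousAt.continuousWithinAt
  have cF1 : ContinuousOn F1 (Set.Icc a b) := fun t ht => (hF1 t ht).continuousAt.continuousWithinAt
  have cp1 : ContinuousOn p1 (Set.Icc a b) := fun t ht => (hp1 t ht).continuousAt.continuousWithinAt
  have cp2 : ContinuousOn p2 (Set.Icc a b) := fun t ht => (hp2 t ht).continuousAt.continuousWithinAt
  have cq : ContinuousOn (fun t => (p1 t)⁻¹) (Set.Icc a b) := cp1.inv₀ hne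
  have hq : ∀ t ∈ Set.Icc a b, HasDerivAt (fun t => (p1 t)⁻¹) (-p2 t * (p1 t)⁻¹ ^ 2) t := by
    intro t ht
    refine ((hp1 t ht).fun_inv (hne t ht)).congr_deriv ?_
    rw [inv_pow]; field_simp
  set q : ℝ → ℝ := fun t => (p1 t)⁻¹ with hqdef
  have hqp : ∀ t ∈ Set.Icc a b, q t * p1 t = 1 := fun t ht => inv_mul_cancel₀ (hne t ht)
  -- first step
  have s1 := ibp_step hab (u := fun t => F t * q t)
    (u' := fun t => F1 t * q t + F t * (-p2 t * q t ^ 2)) (p := p) (p1 := p1)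
    (fun t ht => (hF t ht).mul (hq t ht)) hp
    ((cF1.mul cq).add (cF.mul (cp2.neg.mul (cq.pow 2)))) cp1 (by simp [ha]) (by simp [hb])
  have e1 : (∫ t in a..b, (((F t * q t) * p1 t : ℝ) : ℂ) * e (p t))
      = ∫ t in a..b, ((F t : ℝ) : ℂ) * e (p t) := by
    apply intervalIntegral.integral_congr
    intro t ht
    rw [Set.uIcc_of_le hab] at ht
    simp only
    rw [mul_assoc (F t), hqp t ht, mul_one]
  rw [e1] at s1
  -- second step
  have hw : ∀ t ∈ Set.Icc a b, HasDerivAt (fun t => F1 t * q t ^ 2 - F t * p2 t * q t ^ 3)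
      (F2 t * q t ^ 2 - 3 * F1 t * p2 t * q t ^ 3 - F t * p3 t * q t ^ 3
        + 3 * F t * p2 t ^ 2 * q t ^ 4) t := by
    intro t ht
    have h1 := (hF1 t ht).mul ((hq t ht).pow 2)
    have h2 := ((hF t ht).mul (hp2 t ht)).mul ((hq t ht).pow 3)
    refine (h1.sub h2).congr_deriv ?_
    simp only [hqdef, Pi.pow_apply, Pi.mul_apply]
    push_cast
    ring
  have s2 := ibp_step hab (u := fun t => F1 t * q t ^ 2 - F t * p2 t * q t ^ 3)
    (u' := fun t => F2 t * q t ^ 2 - 3 * F1 t * p2 t * q t ^ 3 - F t * p3 t * q t ^ 3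
        + 3 * F t * p2 t ^ 2 * q t ^ 4) (p := p) (p1 := p1) hw hp
    (by fun_prop) cp1 (by simp [ha, ha1]) (by simp [hb, hb1])
  have e2 : (∫ t in a..b, (((F1 t * q t ^ 2 - F t * p2 t * q t ^ 3) * p1 t : ℝ) : ℂ) * e (p t))
      = ∫ t in a..b, ((F1 t * q t + F t * (-p2 t * q t ^ 2) : ℝ) : ℂ) * e (p t) := by
    apply intervalIntegral.integral_congr
    intro t ht
    rw [Set.uIcc_of_le hab] at ht
    simp only
    congr 2
    linear_combination (F1 t * q t - F t * p2 t * q t ^ 2) * hqp t ht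
  rw [e2] at s2
  refine s1.trans (s2.trans ?_)
  have hbound : ∀ t ∈ Set.uIoc a b, ‖((F2 t * q t ^ 2 - 3 * F1 t * p2 t * q t ^ 3
      - F t * p3 t * q t ^ 3 + 3 * F t * p2 t ^ 2 * q t ^ 4 : ℝ) : ℂ) * e (p t)‖
      ≤ A * (1 + 4 * Q + 3 * Q ^ 2) / m ^ 2 := by
    intro t ht
    rw [Set.uIoc_of_le hab] at ht
    have ht' : t ∈ Set.Icc a b := ⟨ht.1.le, ht.2⟩
    rw [norm_mul, norm_e, mul_one, Complex.norm_real, Real.norm_eq_abs]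
    obtain ⟨hA1, hA2, hA3⟩ := hA t ht'
    obtain ⟨hB1, hB2⟩ := hpB t ht'
    have hqb : |q t| ≤ m⁻¹ := by
      simp only [hqdef, abs_inv]
      exact inv_anti₀ hm (hpm t ht')
    have t1 : |F2 t * q t ^ 2| ≤ A * m⁻¹ ^ 2 := by
      rw [abs_mul, abs_pow]; gcongr
    have t2 : |3 * F1 t * p2 t * q t ^ 3| ≤ 3 * A * (Q * m) * m⁻¹ ^ 3 := by
      rw [abs_mul, abs_mul, abs_mul, abs_pow, abs_of_pos (by norm_num : (0:ℝ) < 3)]; gcongr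
    have t3 : |F t * p3 t * q t ^ 3| ≤ A * (Q * m) * m⁻¹ ^ 3 := by
      rw [abs_mul, abs_mul, abs_pow]; gcongr
    have t4 : |3 * F t * p2 t ^ 2 * q t ^ 4| ≤ 3 * A * (Q * m) ^ 2 * m⁻¹ ^ 4 := by
      rw [abs_mul, abs_mul, abs_mul, abs_pow, abs_pow, abs_of_pos (by norm_num : (0:ℝ) < 3)]; gcongr
    have := abs_add_le (F2 t * q t ^ 2 - 3 * F1 t * p2 t * q t ^ 3 - F t * p3 t * q t ^ 3)
      (3 * F t * p2 t ^ 2 * q t ^ 4)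
    have := abs_sub (F2 t * q t ^ 2 - 3 * F1 t * p2 t * q t ^ 3) (F t * p3 t * q t ^ 3)
    have := abs_sub (F2 t * q t ^ 2) (3 * F1 t * p2 t * q t ^ 3)
    have hfin : A * m⁻¹ ^ 2 + 3 * A * (Q * m) * m⁻¹ ^ 3 + A * (Q * m) * m⁻¹ ^ 3
        + 3 * A * (Q * m) ^ 2 * m⁻¹ ^ 4 = A * (1 + 4 * Q + 3 * Q ^ 2) / m ^ 2 := by
      field_simp; ring
    linarith
  have := intervalIntegral.norm_integral_le_of_norm_le_const hbound
  refine this.trans (le_of_eq ?_)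
  rw [abs_of_nonneg (by linarith)]; ring

end DivM


namespace DivM

open FourierTransform in
lemma gauss_parseval {Φ : ℝ → ℂ} (hi : Integrable Φ) {c : ℂ} (hc : 0 < c.re) :
    ∫ ξ, 𝓕 Φ ξ * Complex.exp (-Real.pi * c * ξ ^ 2)
      = 1 / c ^ (1 / 2 : ℂ) * ∫ s, Φ s * Complex.exp (-Real.pi / c * s ^ 2) := by
  have hg : Integrable (fun x : ℝ => Complex.exp (-Real.pi * c * x ^ 2)) := by
    have := integrable_cexp_neg_mul_sq (b := Real.pi * c) (by
      rw [Complex.re_ofReal_mul]; positivity)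
    simpa [neg_mul] using this
  have h := VectorFourier.integral_fourierIntegral_smul_eq_flip (L := innerₗ ℝ)
    (μ := volume) (ν := volume) Real.continuous_fourierChar continuous_inner hi hg
  have h1 : ∀ x : ℝ, VectorFourier.fourierIntegral Real.fourierChar volume (innerₗ ℝ).flip
      (fun x : ℝ => Complex.exp (-Real.pi * c * x ^ 2)) x
      = 1 / c ^ (1 / 2 : ℂ) * Complex.exp (-Real.pi / c * x ^ 2) := by
    intro x
    have := congrFun (fourier_gaussian_pi hc) x
    rw [← this, flip_innerₗ]; rfl
  simp only [h1] at h
  rw [← integral_const_mul]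
  refine Eq.trans h (integral_congr_ae (Filter.Eventually.of_forall fun s => ?_))
  simp only [smul_eq_mul]; ring

/-- the constant `c₀ = i/(2λ)`. -/
noncomputable def c0 (l : ℝ) : ℂ := ((1 / (2 * l) : ℝ) : ℂ) * Complex.I

open FourierTransform in
lemma fresnel_id {Φ : ℝ → ℂ} (hi : Integrable Φ) (hf : Integrable (𝓕 Φ)) {l : ℝ} (hl : l ≠ 0) :
    ∫ s, Φ s * e (l * s ^ 2) = (c0 l) ^ (1 / 2 : ℂ) * ∫ ξ, 𝓕 Φ ξ * e (-(ξ ^ 2 / (4 * l))) := by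
  have hc0 : c0 l ≠ 0 := by
    unfold c0
    refine mul_ne_zero ?_ Complex.I_ne_zero
    norm_cast; positivity
  have hcre : (c0 l).re = 0 := by simp [c0]
  have hcim : (c0 l).im = 1 / (2 * l) := by simp [c0]
  have hslit : c0 l ∈ Complex.slitPlane := by
    right; rw [hcim]; positivity
  let F := nhdsWithin (0 : ℝ) (Set.Ioi 0)
  have htc : Filter.Tendsto (fun δ : ℝ => (δ : ℂ) + c0 l) F (nhds (c0 l)) := by
    have : Filter.Tendsto (fun δ : ℝ => (δ : ℂ) + c0 l) (nhds 0) (nhds (((0:ℝ) : ℂ) + c0 l)) :=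
      (Complex.continuous_ofReal.add continuous_const).tendsto 0
    rw [Complex.ofReal_zero, zero_add] at this
    exact this.mono_left nhdsWithin_le_nhds
  have hpos : ∀ᶠ δ in F, 0 < δ := self_mem_nhdsWithin
  have hre : ∀ δ : ℝ, ((δ : ℂ) + c0 l).re = δ := by intro δ; simp [hcre]
  -- LHS limit
  have L1 : Filter.Tendsto (fun δ : ℝ => ∫ ξ, 𝓕 Φ ξ * Complex.exp (-Real.pi * ((δ : ℂ) + c0 l) * ξ ^ 2)) F
      (nhds (∫ ξ, 𝓕 Φ ξ * Complex.exp (-Real.pi * (c0 l) * ξ ^ 2))) := by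
    apply tendsto_integral_filter_of_dominated_convergence (fun ξ => ‖𝓕 Φ ξ‖)
    · refine Filter.Eventually.of_forall fun δ => ?_
      exact hf.aestronglyMeasurable.mul (by fun_prop : Continuous _).aestronglyMeasurable
    · filter_upwards [hpos] with δ hδ
      refine Filter.Eventually.of_forall fun ξ => ?_
      rw [norm_mul, Complex.norm_exp]
      have : (-(Real.pi : ℂ) * ((δ : ℂ) + c0 l) * (ξ : ℂ) ^ 2).re = - Real.pi * δ * ξ ^ 2 := by
        rw [show (-(Real.pi : ℂ) * ((δ : ℂ) + c0 l) * (ξ : ℂ) ^ 2) = ((-Real.pi * ξ ^ 2 : ℝ) : ℂ) * ((δ : ℂ) + c0 l) by push_cast; ring, Complex.re_ofReal_mul, hre]; ring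
      rw [this]
      apply mul_le_of_le_one_right (norm_nonneg _)
      rw [Real.exp_le_one_iff]
      have : 0 ≤ Real.pi * δ * ξ ^ 2 := by positivity
      linarith
    · exact hf.norm
    · refine Filter.Eventually.of_forall fun ξ => ?_
      apply Filter.Tendsto.mul tendsto_const_nhds
      apply (Complex.continuous_exp.tendsto _).comp
      exact (htc.const_mul _).mul_const _
  have L2 : Filter.Tendsto (fun δ : ℝ => ∫ s, Φ s * Complex.exp (-Real.pi / ((δ : ℂ) + c0 l) * s ^ 2)) F
      (nhds (∫ s, Φ s * Complex.exp (-Real.pi / (c0 l) * s ^ 2))) := by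
    apply tendsto_integral_filter_of_dominated_convergence (fun ξ => ‖Φ ξ‖)
    · refine Filter.Eventually.of_forall fun δ => ?_
      exact hi.aestronglyMeasurable.mul (by fun_prop : Continuous _).aestronglyMeasurable
    · filter_upwards [hpos] with δ hδ
      refine Filter.Eventually.of_forall fun ξ => ?_
      rw [norm_mul, Complex.norm_exp]
      have : (-(Real.pi : ℂ) / ((δ : ℂ) + c0 l) * (ξ : ℂ) ^ 2).re = - Real.pi * ξ ^ 2 * (δ / Complex.normSq ((δ : ℂ) + c0 l)) := by
        rw [show (-(Real.pi : ℂ) / ((δ : ℂ) + c0 l) * (ξ : ℂ) ^ 2) = ((-Real.pi * ξ ^ 2 : ℝ) : ℂ) * ((δ : ℂ) + c0 l)⁻¹ by push_cast; ring, Complex.re_ofReal_mul, Complex.inv_re, hre]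
      rw [this]
      apply mul_le_of_le_one_right (norm_nonneg _)
      rw [Real.exp_le_one_iff]
      have : 0 ≤ Real.pi * ξ ^ 2 * (δ / Complex.normSq ((δ : ℂ) + c0 l)) := by
        have := Complex.normSq_nonneg ((δ : ℂ) + c0 l)
        positivity
      linarith
    · exact hi.norm
    · refine Filter.Eventually.of_forall fun ξ => ?_
      apply Filter.Tendsto.mul tendsto_const_nhds
      apply (Complex.continuous_exp.tendsto _).comp
      exact (tendsto_const_nhds.div htc hc0).mul_const _
  have L3 : Filter.Tendsto (fun δ : ℝ => 1 / ((δ : ℂ) + c0 l) ^ (1 / 2 : ℂ)) F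
      (nhds (1 / (c0 l) ^ (1 / 2 : ℂ))) := by
    apply Filter.Tendsto.div tendsto_const_nhds
    · exact (continuousAt_cpow_const hslit).tendsto.comp htc
    · intro h
      rw [Complex.cpow_eq_zero_iff] at h
      exact hc0 h.1
  have key : ∀ᶠ δ : ℝ in F, ∫ ξ, 𝓕 Φ ξ * Complex.exp (-Real.pi * ((δ : ℂ) + c0 l) * ξ ^ 2)
      = 1 / ((δ : ℂ) + c0 l) ^ (1 / 2 : ℂ) * ∫ s, Φ s * Complex.exp (-Real.pi / ((δ : ℂ) + c0 l) * s ^ 2) := by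
    filter_upwards [hpos] with δ hδ
    exact gauss_parseval hi (by rw [hre]; exact hδ)
  have fin := tendsto_nhds_unique (L1.congr' key) (L3.mul L2)
  have e1 : ∀ s : ℝ, Complex.exp (-Real.pi / (c0 l) * s ^ 2) = e (l * s ^ 2) := by
    intro s
    unfold e; congr 1
    have hl' : (l : ℂ) ≠ 0 := by exact_mod_cast hl
    unfold c0
    push_cast
    field_simp
    linear_combination (-(s:ℂ)^2) * Complex.I_sq
  have e2 : ∀ s : ℝ, Complex.exp (-Real.pi * (c0 l) * s ^ 2) = e (-(s ^ 2 / (4 * l))) := by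
    intro s
    unfold e; congr 1
    have hl' : (l : ℂ) ≠ 0 := by exact_mod_cast hl
    unfold c0
    push_cast
    field_simp
    try ring
  simp only [e1, e2] at fin
  rw [fin, ← mul_assoc, mul_one_div_cancel, one_mul]
  intro h
  rw [Complex.cpow_eq_zero_iff] at h
  exact hc0 h.1

lemma norm_c0_cpow (l : ℝ) (hl : l ≠ 0): ‖(c0 l) ^ (1 / 2 : ℂ)‖ = (2 * |l|) ^ (-(1 / 2) : ℝ) := by
  have h := Complex.norm_cpow_real (c0 l) (1 / 2)
  push_cast at h
  rw [h]
  unfold c0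
  rw [norm_mul, Complex.norm_I, mul_one, Complex.norm_real, Real.norm_eq_abs, abs_div, abs_one,
    abs_mul, abs_two, one_div (2 * |l|), Real.inv_rpow (by positivity), Real.rpow_neg (by positivity)]

lemma c0_cpow_pos {l : ℝ} (hl : 0 < l) :
    (c0 l) ^ (1 / 2 : ℂ) = (((2 * l) ^ (-(1 / 2) : ℝ) : ℝ) : ℂ) * e (1 / 8) := by
  have hl2 : (0:ℝ) < 1 / (2 * l) := by positivity
  unfold c0
  rw [Complex.cpow_def_of_ne_zero (mul_ne_zero (by exact_mod_cast hl2.ne') Complex.I_ne_zero),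
    Complex.log_ofReal_mul hl2 Complex.I_ne_zero, Complex.log_I, Real.rpow_def_of_pos (by positivity)]
  unfold e
  rw [Complex.ofReal_exp, ← Complex.exp_add, one_div, Real.log_inv]
  congr 1
  push_cast; ring

open FourierTransform in
lemma fresnel_norm {Φ : ℝ → ℂ} (hi : Integrable Φ) (hf : Integrable (𝓕 Φ)) {l : ℝ} (hl : l ≠ 0) :
    ‖∫ s, Φ s * e (l * s ^ 2)‖ ≤ |l| ^ (-(1 / 2) : ℝ) * ∫ ξ, ‖𝓕 Φ ξ‖ := by
  rw [fresnel_id hi hf hl, norm_mul, norm_c0_cpow l hl]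
  have h1 : ‖∫ ξ, 𝓕 Φ ξ * e (-(ξ ^ 2 / (4 * l)))‖ ≤ ∫ ξ, ‖𝓕 Φ ξ‖ := by
    refine (norm_integral_le_integral_norm _).trans (le_of_eq ?_)
    congr 1; funext ξ; rw [norm_mul, norm_e, mul_one]
  have h2 : (2 * |l|) ^ (-(1 / 2) : ℝ) ≤ |l| ^ (-(1 / 2) : ℝ) :=
    Real.rpow_le_rpow_of_nonpos (by positivity) (by linarith [abs_nonneg l]) (by norm_num)
  gcongr

lemma norm_e_sub_one (x : ℝ) : ‖e x - 1‖ ≤ 2 * Real.pi * |x| := by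
  have := Real.norm_exp_I_mul_ofReal_sub_one_le (x := 2 * Real.pi * x)
  unfold e
  rw [mul_comm _ Complex.I]
  refine this.trans (le_of_eq ?_)
  rw [Real.norm_eq_abs, abs_mul, abs_of_pos (by positivity)]

open FourierTransform in
lemma fresnel_asymp {Φ : ℝ → ℂ} (hi : Integrable Φ) (hc : Continuous Φ) (hf : Integrable (𝓕 Φ))
    (hf2 : Integrable (fun ξ : ℝ => ξ ^ 2 * ‖𝓕 Φ ξ‖)) {l : ℝ} (hl : 0 < l) :
    ‖(∫ s, Φ s * e (l * s ^ 2)) - (((2 * l) ^ (-(1 / 2) : ℝ) : ℝ) : ℂ) * e (1 / 8) * Φ 0‖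
      ≤ 2 * l ^ (-(3 / 2) : ℝ) * ∫ ξ : ℝ, ξ ^ 2 * ‖𝓕 Φ ξ‖ := by
  have hinv : Φ 0 = ∫ ξ, 𝓕 Φ ξ := by
    rw [← hi.fourierInv_fourier_eq hf (v := 0) hc.continuousAt, Real.fourierInv_eq]
    simp
  have hintg : Integrable (fun ξ => 𝓕 Φ ξ * e (-(ξ ^ 2 / (4 * l)))) := by
    refine hf.mul_bdd (c := 1) ?_ ?_
    · exact (continuous_e.comp (by fun_prop)).aestronglyMeasurable
    · exact Filter.Eventually.of_forall fun ξ => (norm_e _).le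
  rw [fresnel_id hi hf hl.ne', ← c0_cpow_pos hl, ← mul_sub, hinv, ← integral_sub hintg hf, norm_mul,
    norm_c0_cpow l hl.ne', abs_of_pos hl]
  have h1 : ‖∫ ξ, (𝓕 Φ ξ * e (-(ξ ^ 2 / (4 * l))) - 𝓕 Φ ξ)‖ ≤ ∫ ξ : ℝ, (2 / l) * (ξ ^ 2 * ‖𝓕 Φ ξ‖) := by
    apply norm_integral_le_of_norm_le (hf2.const_mul _)
    refine Filter.Eventually.of_forall fun ξ => ?_
    rw [← mul_sub_one, norm_mul]
    have := norm_e_sub_one (-(ξ ^ 2 / (4 * l)))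
    rw [abs_neg, abs_of_nonneg (by positivity)] at this
    have h4 : 2 * Real.pi * (ξ ^ 2 / (4 * l)) ≤ 2 * 4 * (ξ ^ 2 / (4 * l)) := by
      have := Real.pi_le_four
      gcongr
    calc ‖𝓕 Φ ξ‖ * ‖e (-(ξ ^ 2 / (4 * l))) - 1‖ ≤ ‖𝓕 Φ ξ‖ * (2 * 4 * (ξ ^ 2 / (4 * l))) := by
          gcongr; linarith
      _ = _ := by field_simp
  rw [integral_const_mul] at h1
  have h2 : (2 * l) ^ (-(1 / 2) : ℝ) ≤ l ^ (-(1 / 2) : ℝ) :=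
    Real.rpow_le_rpow_of_nonpos (by positivity) (by linarith) (by norm_num)
  have h3 : l ^ (-(3 / 2) : ℝ) = l ^ (-(1 / 2) : ℝ) * (1 / l) := by
    rw [one_div l, ← Real.rpow_neg_one, ← Real.rpow_add hl]; norm_num
  rw [h3]
  have h5 : 0 ≤ ∫ ξ : ℝ, ξ ^ 2 * ‖𝓕 Φ ξ‖ := integral_nonneg fun ξ => by positivity
  calc _ ≤ l ^ (-(1 / 2) : ℝ) * (2 / l * ∫ ξ : ℝ, ξ ^ 2 * ‖𝓕 Φ ξ‖) := by gcongr
    _ = _ := by ring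

open FourierTransform in
/-- uniform control of the Fourier transform of a bump function -/
lemma fourier_bump {Φ : ℝ → ℂ} (hΦ : ContDiff ℝ (⊤ : ℕ∞) Φ) {a b A : ℝ} (hab : a ≤ b) 
    (hs : ∀ s, s ∉ Set.Icc a b → Φ s = 0)
    (hA : ∀ s, ‖Φ s‖ ≤ A) (hA4 : ∀ s, ‖iteratedDeriv 4 Φ s‖ ≤ A) :
    Integrable Φ ∧ Integrable (𝓕 Φ) ∧ Integrable (fun ξ : ℝ => ξ ^ 2 * ‖𝓕 Φ ξ‖) ∧
    (∫ ξ, ‖𝓕 Φ ξ‖) ≤ 20 * ((b - a) * A) ∧ (∫ ξ : ℝ, ξ ^ 2 * ‖𝓕 Φ ξ‖) ≤ 20 * ((b - a) * A) := by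
  have hA0 : 0 ≤ A := (norm_nonneg _).trans (hA 0)
  have hts : tsupport Φ ⊆ Set.Icc a b := by
    apply closure_minimal _ isClosed_Icc
    intro s h
    by_contra h'
    exact h (hs s h')
  have hcs : HasCompactSupport Φ := isCompact_Icc.of_isClosed_subset (isClosed_tsupport _) hts
  have hcd : ∀ n, Continuous (iteratedDeriv n Φ) := fun n =>
    hΦ.continuous_iteratedDeriv n (by exact_mod_cast le_top)
  have hsd : ∀ n, ∀ s, s ∉ Set.Icc a b → iteratedDeriv n Φ s = 0 := by
    intro n s h
    have : s ∉ tsupport Φ := fun h' => h (hts h')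
    have h3 := image_eq_zero_of_notMem_tsupport (f := iteratedFDeriv ℝ n Φ) (x := s)
      (fun h' => this (tsupport_iteratedFDeriv_subset (𝕜 := ℝ) n h'))
    rw [iteratedDeriv_eq_iteratedFDeriv, h3]; simp
  have hid : ∀ n, Integrable (iteratedDeriv n Φ) := fun n => by
    apply (hcd n).integrable_of_hasCompactSupport
    exact HasCompactSupport.intro isCompact_Icc (hsd n)
  have hi : Integrable Φ := by simpa using hid 0
  have hL1 : ∀ g : ℝ → ℂ, (∀ s, ‖g s‖ ≤ A) → (∀ s, s ∉ Set.Icc a b → g s = 0) →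
      ∫ s, ‖g s‖ ≤ (b - a) * A := by
    intro g hg hg0
    rw [← setIntegral_eq_integral_of_forall_compl_eq_zero (s := Set.Icc a b) (fun s h => by rw [hg0 s h, norm_zero])]
    have := norm_setIntegral_le_of_norm_le_const (μ := volume) (s := Set.Icc a b) (f := fun s => ‖g s‖) (C := A)
      (by simp) (fun s _ => by rw [norm_norm]; exact hg s)
    rw [Real.volume_real_Icc_of_le hab] at this
    linarith [le_abs_self (∫ s in Set.Icc a b, ‖g s‖), this, Real.norm_eq_abs (∫ s in Set.Icc a b, ‖g s‖), mul_comm A (b-a)]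
  have hF0 : ∀ ξ, ‖𝓕 Φ ξ‖ ≤ (b - a) * A := fun ξ =>
    (VectorFourier.norm_fourierIntegral_le_integral_norm _ _ _ _ _).trans (hL1 Φ hA hs)
  have hF4 : ∀ ξ : ℝ, ξ ^ 4 * ‖𝓕 Φ ξ‖ ≤ (b - a) * A := by
    intro ξ
    have h1 := congrFun (Real.fourier_iteratedDeriv (N := ⊤) (n := 4) hΦ (fun n _ => hid n) le_top) ξ
    have h2 : ‖𝓕 (iteratedDeriv 4 Φ) ξ‖ ≤ (b - a) * A := 
      (VectorFourier.norm_fourierIntegral_le_integral_norm _ _ _ _ _).trans (hL1 _ hA4 (hsd 4))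
    rw [h1, norm_smul, norm_pow] at h2
    have h3 : ‖(2 * Real.pi * Complex.I * ξ : ℂ)‖ = 2 * Real.pi * |ξ| := by
      simp [abs_of_pos Real.pi_pos]
    rw [h3] at h2
    have h4 : |ξ| ≤ 2 * Real.pi * |ξ| := by
      nlinarith [Real.pi_gt_three, abs_nonneg ξ]
    calc ξ ^ 4 * ‖𝓕 Φ ξ‖ = |ξ| ^ 4 * ‖𝓕 Φ ξ‖ := by rw [Even.pow_abs (by decide)]
      _ ≤ (2 * Real.pi * |ξ|) ^ 4 * ‖𝓕 Φ ξ‖ := by gcongr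
      _ ≤ _ := h2
  set B := (b - a) * A with hB
  have hB0 : 0 ≤ B := mul_nonneg (by linarith) hA0
  have hcF : Continuous (𝓕 Φ) := VectorFourier.fourierIntegral_continuous Real.continuous_fourierChar continuous_inner hi
  have hb1 : ∀ ξ : ℝ, ‖𝓕 Φ ξ‖ ≤ (4 * B) * (1 + ξ ^ 2)⁻¹ := by
    intro ξ
    rw [← div_eq_mul_inv, le_div_iff₀ (by positivity)]
    have := hF0 ξ; have := hF4 ξ
    nlinarith [mul_nonneg (sq_nonneg (ξ^2 - 1)) (norm_nonneg (𝓕 Φ ξ))]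
  have hb2 : ∀ ξ : ℝ, ξ ^ 2 * ‖𝓕 Φ ξ‖ ≤ (4 * B) * (1 + ξ ^ 2)⁻¹ := by
    intro ξ
    rw [← div_eq_mul_inv, le_div_iff₀ (by positivity)]
    have := hF0 ξ; have := hF4 ξ
    nlinarith [mul_nonneg (sq_nonneg (ξ^2 - 1)) (norm_nonneg (𝓕 Φ ξ))]
  have hdom : Integrable (fun ξ : ℝ => (4 * B) * (1 + ξ ^ 2)⁻¹) := integrable_inv_one_add_sq.const_mul _
  have hval : ∫ ξ : ℝ, (4 * B) * (1 + ξ ^ 2)⁻¹ ≤ 20 * B := by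
    rw [integral_const_mul, integral_univ_inv_one_add_sq]
    nlinarith [Real.pi_lt_d2]
  have i1 : Integrable (𝓕 Φ) := hdom.mono' hcF.aestronglyMeasurable (Filter.Eventually.of_forall hb1)
  have i2 : Integrable (fun ξ : ℝ => ξ ^ 2 * ‖𝓕 Φ ξ‖) :=
    hdom.mono' (by fun_prop : Continuous _).aestronglyMeasurable (Filter.Eventually.of_forall fun ξ => by
      rw [Real.norm_of_nonneg (by positivity)]; exact hb2 ξ)
  exact ⟨hi, i1, i2, (integral_mono i1.norm hdom hb1).trans hval, (integral_mono i2 hdom hb2).trans hval⟩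

end DivM


namespace DivM
open scoped ContDiff

/-- the cutoff `W₀`. -/
noncomputable def W0 (t : ℝ) : ℝ := Real.smoothTransition (1 / 2 + (1 - t ^ 2) / (1 + t ^ 2))

/-- dyadic bump. -/
noncomputable def chi (t : ℝ) : ℝ := (W0 t - W0 (2 * t)) * Real.smoothTransition (8 * t - 1)

lemma W0_contDiff : ContDiff ℝ ∞ W0 := by
  unfold W0
  refine Real.smoothTransition.contDiff.comp ?_
  refine contDiff_const.add ?_
  exact (by fun_prop : ContDiff ℝ ∞ fun t : ℝ => 1 - t ^ 2).div (by fun_prop) (fun t => by positivity)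

lemma chi_contDiff : ContDiff ℝ ∞ chi := by
  unfold chi
  refine ContDiff.mul ?_ ?_
  · exact W0_contDiff.sub (W0_contDiff.comp (contDiff_const.mul contDiff_id))
  · exact Real.smoothTransition.contDiff.comp (by fun_prop)

lemma W0_nonneg (t : ℝ) : 0 ≤ W0 t := Real.smoothTransition.nonneg _
lemma W0_le_one (t : ℝ) : W0 t ≤ 1 := Real.smoothTransition.le_one _

lemma W0_one {t : ℝ} (h0 : 0 ≤ t) (h : t ≤ 1 / 2) : W0 t = 1 := by
  apply Real.smoothTransition.one_of_one_le
  have : 1 / 2 ≤ (1 - t ^ 2) / (1 + t ^ 2) := by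
    rw [div_le_div_iff₀ (by norm_num) (by positivity)]; nlinarith
  linarith

lemma W0_zero {t : ℝ} (h : 2 ≤ t) : W0 t = 0 := by
  apply Real.smoothTransition.zero_of_nonpos
  have : (1 - t ^ 2) / (1 + t ^ 2) ≤ -1 / 2 := by
    rw [div_le_div_iff₀ (by positivity) (by norm_num)]; nlinarith
  linarith

lemma smoothTransition_symm (x : ℝ) : Real.smoothTransition x + Real.smoothTransition (1 - x) = 1 := by
  unfold Real.smoothTransition
  have := Real.smoothTransition.pos_denom x
  rw [sub_sub_cancel, add_comm (expNegInvGlue (1 - x)), ← add_div, div_self this.ne']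

lemma W0_inv {t : ℝ} (h : 0 < t) : W0 t + W0 t⁻¹ = 1 := by
  unfold W0
  have : 1 / 2 + (1 - t⁻¹ ^ 2) / (1 + t⁻¹ ^ 2) = 1 - (1 / 2 + (1 - t ^ 2) / (1 + t ^ 2)) := by
    field_simp; ring
  rw [this, smoothTransition_symm]

lemma chi_zero_left {t : ℝ} (h : t ≤ 1 / 4) : chi t = 0 := by
  unfold chi
  rcases le_or_gt t 0 with h0 | h0
  · rw [Real.smoothTransition.zero_of_nonpos (by linarith), mul_zero]
  · rw [W0_one h0.le (by linarith), W0_one (by linarith) (by linarith), sub_self, zero_mul]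

lemma chi_zero_right {t : ℝ} (h : 2 ≤ t) : chi t = 0 := by
  unfold chi
  rw [W0_zero h, W0_zero (by linarith), sub_self, zero_mul]

lemma chi_eq {t : ℝ} (h : 0 < t) : chi t = W0 t - W0 (2 * t) := by
  rcases le_or_gt t (1 / 4) with h1 | h1
  · rw [chi_zero_left h1, W0_one h.le (by linarith), W0_one (by linarith) (by linarith), sub_self]
  · unfold chi
    rw [Real.smoothTransition.one_of_one_le (by linarith), mul_one]

lemma abs_chi_le (t : ℝ) : |chi t| ≤ 1 := by
  unfold chi
  rw [abs_mul, abs_of_nonneg (Real.smoothTransition.nonneg _)]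
  have h1 : |W0 t - W0 (2 * t)| ≤ 1 := by
    rw [abs_le]
    constructor <;> linarith [W0_nonneg t, W0_le_one t, W0_nonneg (2*t), W0_le_one (2*t)]
  have := Real.smoothTransition.le_one (8 * t - 1)
  have := Real.smoothTransition.nonneg (8 * t - 1)
  nlinarith [abs_nonneg (W0 t - W0 (2 * t))]

/-- partial derivatives of jointly smooth functions are jointly smooth. -/
lemma partial_smooth {F : ℝ × ℝ → ℂ} (hF : ContDiff ℝ ∞ F) (n : ℕ) :
    ∃ G : ℝ × ℝ → ℂ, ContDiff ℝ ∞ G ∧ ∀ τ s, iteratedDeriv n (fun s => F (τ, s)) s = G (τ, s) := by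
  induction n with
  | zero => exact ⟨F, hF, fun τ s => by simp⟩
  | succ n ih =>
    obtain ⟨G, hG, hGe⟩ := ih
    refine ⟨fun z => fderiv ℝ G z (0, 1), ?_, ?_⟩
    · exact (hG.fderiv_right (m := ∞) (by simp)).clm_apply contDiff_const
    · intro τ s
      rw [iteratedDeriv_succ, show iteratedDeriv n (fun s => F (τ, s)) = fun s => G (τ, s) from funext (hGe τ)]
      have h1 : HasFDerivAt G (fderiv ℝ G (τ, s)) (τ, s) :=
        (hG.differentiable (by simp) (τ, s)).hasFDerivAt
      have h2 : HasDerivAt (fun s : ℝ => (τ, s)) (0, 1) s :=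
        (hasDerivAt_const s τ).prodMk (hasDerivAt_id s)
      exact (h1.comp_hasDerivAt s h2).deriv

lemma uniform_bound {F : ℝ × ℝ → ℂ} (hF : ContDiff ℝ ∞ F) {c d a b : ℝ}
    (hs : ∀ τ ∈ Set.Icc c d, ∀ s, s ∉ Set.Icc a b → F (τ, s) = 0) (n : ℕ) :
    ∃ A : ℝ, 0 ≤ A ∧ ∀ τ ∈ Set.Icc c d, ∀ s, ‖iteratedDeriv n (fun s => F (τ, s)) s‖ ≤ A := by
  obtain ⟨G, hG, hGe⟩ := partial_smooth hF n
  obtain ⟨A, hA⟩ := (isCompact_Icc.prod isCompact_Icc : IsCompact (Set.Icc c d ×ˢ Set.Icc a b)).exists_bound_of_continuousOn hG.continuous.continuousOn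
  refine ⟨max A 0, le_max_right _ _, fun τ hτ s => ?_⟩
  by_cases h : s ∈ Set.Icc a b
  · rw [hGe]; exact (hA (τ, s) ⟨hτ, h⟩).trans (le_max_left _ _)
  · have hts : tsupport (fun s => F (τ, s)) ⊆ Set.Icc a b := by
      apply closure_minimal _ isClosed_Icc
      intro s h
      by_contra h'
      exact h (hs τ hτ s h')
    have h3 := image_eq_zero_of_notMem_tsupport (f := iteratedFDeriv ℝ n (fun s => F (τ, s))) (x := s)
      (fun h' => h (hts (tsupport_iteratedFDeriv_subset (𝕜 := ℝ) n h')))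
    rw [iteratedDeriv_eq_iteratedFDeriv, h3]; simp

lemma integral_eq_interval {f : ℝ → ℂ} {a b : ℝ} (hab : a ≤ b) (h : ∀ t, t ∉ Set.Ioc a b → f t = 0) :
    ∫ t, f t = ∫ t in a..b, f t := by
  rw [intervalIntegral.integral_of_le hab]
  exact (setIntegral_eq_integral_of_forall_compl_eq_zero h).symm

/-- `w(s) = (s+√(s²+4))/2`. -/
noncomputable def ww (s : ℝ) : ℝ := (s + Real.sqrt (s ^ 2 + 4)) / 2

lemma ww_contDiff : ContDiff ℝ ∞ ww := by
  unfold ww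
  refine ContDiff.div_const (contDiff_id.add ?_) _
  exact ContDiff.sqrt (by fun_prop) (fun s => by positivity)

lemma ww_rel (s : ℝ) : ww s ^ 2 - s * ww s = 1 := by
  unfold ww
  have := Real.sq_sqrt (show 0 ≤ s ^ 2 + 4 by positivity)
  nlinarith

lemma ww_pos (s : ℝ) : 0 < ww s := by
  unfold ww
  have h : |s| < Real.sqrt (s ^ 2 + 4) := by
    rw [← Real.sqrt_sq_eq_abs]; exact Real.sqrt_lt_sqrt (by positivity) (by linarith)
  linarith [neg_abs_le s]

lemma ww_deriv (s : ℝ) : HasDerivAt ww (ww s / Real.sqrt (s ^ 2 + 4)) s := by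
  have hpos : 0 < Real.sqrt (s ^ 2 + 4) := Real.sqrt_pos.2 (by positivity)
  have h1 : HasDerivAt (fun s : ℝ => s ^ 2 + 4) (2 * s) s := by
    simpa using (hasDerivAt_pow 2 s).add_const (4:ℝ)
  have h2 := h1.sqrt (by positivity)
  have h3 := ((hasDerivAt_id s).add h2).div_const 2
  refine h3.congr_deriv ?_
  unfold ww
  field_simp
  ring

lemma ww_zero : ww 0 = 1 := by
  unfold ww
  rw [show (0:ℝ)^2 + 4 = 2 ^ 2 by norm_num, Real.sqrt_sq (by norm_num)]; norm_num

lemma ww_large {s : ℝ} (h : 4 ≤ s) : 16 ≤ ww s ^ 2 := by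
  nlinarith [ww_rel s, ww_pos s]

lemma ww_small {s : ℝ} (h : s ≤ -4) : ww s ^ 2 ≤ 1 / 16 := by
  have h1 := ww_rel s
  have h2 := ww_pos s
  have : ww s ≤ 1 / 4 := by nlinarith
  nlinarith

/-- amplitude after substitution -/
noncomputable def Famp (z : ℝ × ℝ) : ℂ :=
  ((chi (z.1 * ww z.2 ^ 2) * (z.1 ^ 2 * ww z.2 ^ 2 * (2 * ww z.2 ^ 2 / Real.sqrt (z.2 ^ 2 + 4))) : ℝ) : ℂ)

lemma Famp_contDiff : ContDiff ℝ ∞ Famp := by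
  unfold Famp
  have hw : ContDiff ℝ ∞ (fun z : ℝ × ℝ => ww z.2) := ww_contDiff.comp contDiff_snd
  have h1 : ContDiff ℝ ∞ (fun z : ℝ × ℝ => chi (z.1 * ww z.2 ^ 2)) :=
    chi_contDiff.comp (contDiff_fst.mul (hw.pow 2))
  have hs : ContDiff ℝ ∞ (fun z : ℝ × ℝ => Real.sqrt (z.2 ^ 2 + 4)) :=
    ContDiff.sqrt (by fun_prop) (fun s => by positivity)
  refine Complex.ofRealCLM.contDiff.comp (h1.mul (((contDiff_fst.pow 2).mul (hw.pow 2)).mul ?_))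
  exact (contDiff_const.mul (hw.pow 2)).div hs (fun z => (Real.sqrt_pos.2 (by positivity)).ne')

/-- the basic oscillatory integral -/
noncomputable def II (α β : ℝ) : ℂ := ∫ t : ℝ, ((chi t * t : ℝ) : ℂ) * e (α / t + β * t)

lemma Famp_zero {τ : ℝ} (h : τ ∈ Set.Icc (1/6:ℝ) 3) {s : ℝ} (hs : s ∉ Set.Icc (-4:ℝ) 4) : Famp (τ, s) = 0 := by
  have : chi (τ * ww s ^ 2) = 0 := by
    rw [Set.mem_Icc, not_and_or, not_le, not_le] at hs
    rcases hs with hs | hs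
    · apply chi_zero_left
      have := ww_small hs.le
      nlinarith [h.1, h.2, ww_pos s]
    · apply chi_zero_right
      have := ww_large hs.le
      nlinarith [h.1, h.2]
  unfold Famp
  simp only [this, zero_mul, Complex.ofReal_zero]

/-- substitution identity -/
lemma II_subst {α β : ℝ} (hα : 0 < α) (hβ : 0 < β) (hτ : Real.sqrt (α / β) ∈ Set.Icc (1/6:ℝ) 3) :
    II α β = e (2 * Real.sqrt (α * β)) *
      ∫ s : ℝ, Famp (Real.sqrt (α / β), s) * e (Real.sqrt (α * β) * s ^ 2) := by
  set τ := Real.sqrt (α / β) with hτd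
  set l := Real.sqrt (α * β) with hld
  have hτ0 : 0 < τ := by linarith [hτ.1]
  have h1 : τ * β = l := by
    rw [hτd, hld, Real.sqrt_div hα.le, Real.sqrt_mul hα.le, div_mul_eq_mul_div, div_eq_iff (by positivity), mul_assoc, Real.mul_self_sqrt hβ.le]
  have h2 : α = l * τ := by
    rw [hτd, hld, Real.sqrt_div hα.le, Real.sqrt_mul hα.le]
    have := Real.mul_self_sqrt hα.le
    have : Real.sqrt β ≠ 0 := by positivity
    field_simp
    nlinarith
  have hd : ∀ s, HasDerivAt (fun s => τ * ww s ^ 2) (τ * (2 * ww s ^ 2 / Real.sqrt (s ^ 2 + 4))) s := by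
    intro s
    refine (((ww_deriv s).pow 2).const_mul τ).congr_deriv ?_
    push_cast; ring
  have hz : ∀ s, s ∉ Set.Ioc (-4:ℝ) 4 → Famp (τ, s) = 0 := by
    intro s hs
    by_cases h : s = -4
    · have : chi (τ * ww s ^ 2) = 0 := by
        apply chi_zero_left
        have := ww_small h.le
        nlinarith [hτ.1, hτ.2, ww_pos s]
      unfold Famp
      simp only [this, zero_mul, Complex.ofReal_zero]
    · apply Famp_zero hτ
      intro h'
      exact hs ⟨lt_of_le_of_ne h'.1 (Ne.symm h), h'.2⟩
  rw [integral_eq_interval (a := -4) (b := 4) (by norm_num) (fun s hs => by rw [hz s hs, zero_mul])]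
  have ha : τ * ww (-4) ^ 2 ≤ 1 / 4 := by nlinarith [ww_small (le_refl (-4:ℝ)), hτ.2, ww_pos (-4)]
  have hb : 2 ≤ τ * ww 4 ^ 2 := by nlinarith [ww_large (le_refl (4:ℝ)), hτ.1]
  unfold II
  rw [integral_eq_interval (a := τ * ww (-4) ^ 2) (b := τ * ww 4 ^ 2) (by linarith) (fun t ht => by
    have : chi t = 0 := by
      rw [Set.mem_Ioc, not_and_or, not_lt, not_le] at ht
      rcases ht with ht | ht
      · exact chi_zero_left (by linarith)
      · exact chi_zero_right (by linarith)
    rw [this]; simp)]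
  have hcd : Continuous (fun s => τ * (2 * ww s ^ 2 / Real.sqrt (s ^ 2 + 4))) := by
    have := ww_contDiff.continuous
    refine continuous_const.mul ((continuous_const.mul (this.pow 2)).div (by fun_prop) (fun s => (Real.sqrt_pos.2 (by positivity)).ne'))
  rw [← intervalIntegral.integral_deriv_smul_comp_of_deriv_nonneg (f := fun s => τ * ww s ^ 2) (f' := fun s => τ * (2 * ww s ^ 2 / Real.sqrt (s ^ 2 + 4)))
    (g := fun t => ((chi t * t : ℝ) : ℂ) * e (α / t + β * t))]
  · rw [← intervalIntegral.integral_const_mul]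
    apply intervalIntegral.integral_congr
    intro s _
    simp only [Function.comp]
    have hw := ww_pos s
    have hph : α / (τ * ww s ^ 2) + β * (τ * ww s ^ 2) = 2 * l + l * s ^ 2 := by
      have hr := ww_rel s
      rw [h2]
      have e1 : l * τ / (τ * ww s ^ 2) = l / ww s ^ 2 := by field_simp
      rw [e1, show β * (τ * ww s ^ 2) = l * ww s ^ 2 by rw [← h1]; ring]
      field_simp
      have : s * ww s = ww s ^ 2 - 1 := by linarith
      have h3 : s ^ 2 * ww s ^ 2 = (ww s ^ 2 - 1) ^ 2 := by rw [← this]; ring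
      linear_combination (-l) * h3
    rw [hph, e_add]
    unfold Famp
    rw [Complex.real_smul]
    push_cast
    ring
  · exact (by have := ww_contDiff.continuous; fun_prop : Continuous _).continuousOn
  · intro s _; exact hd s
  · intro s _; positivity

lemma II_far : ∃ C : ℝ, 0 < C ∧ ∀ α β : ℝ, 1 ≤ α → (β ≤ α / 8 ∨ 32 * α ≤ β) →
    ‖II α β‖ ≤ C / (α + |β|) ^ 2 := by
  let F : ℝ → ℝ := fun t => chi t * t
  have hF : ContDiff ℝ ∞ F := chi_contDiff.mul contDiff_id
  have hF1 : ContDiff ℝ ∞ (deriv F) := (contDiff_infty_iff_deriv.1 hF).2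
  have hF2 : ContDiff ℝ ∞ (deriv (deriv F)) := (contDiff_infty_iff_deriv.1 hF1).2
  have bd : ∀ f : ℝ → ℝ, ContDiff ℝ ∞ f → ∃ A, ∀ t ∈ Set.Icc (1/5:ℝ) (5/2), |f t| ≤ A := fun f hf =>
    isCompact_Icc.exists_bound_of_continuousOn hf.continuous.continuousOn
  obtain ⟨A0, hA0⟩ := bd F hF
  obtain ⟨A1, hA1⟩ := bd _ hF1
  obtain ⟨A2, hA2⟩ := bd _ hF2
  have hA0' : 0 ≤ A0 := (abs_nonneg _).trans (hA0 1 (by constructor <;> norm_num))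
  have hA1' : 0 ≤ A1 := (abs_nonneg _).trans (hA1 1 (by constructor <;> norm_num))
  have hA2' : 0 ≤ A2 := (abs_nonneg _).trans (hA2 1 (by constructor <;> norm_num))
  set A := A0 + A1 + A2 + 1 with hA
  have d1 : deriv F (1/5) = 0 := by
    have : F =ᶠ[nhds (1/5:ℝ)] fun _ => 0 := by
      filter_upwards [Iio_mem_nhds (show (1/5:ℝ) < 1/4 by norm_num)] with t ht
      simp only [F, chi_zero_left (le_of_lt ht), zero_mul]
    rw [this.deriv_eq]; simp
  have d2 : deriv F (5/2) = 0 := by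
    have : F =ᶠ[nhds (5/2:ℝ)] fun _ => 0 := by
      filter_upwards [Ioi_mem_nhds (show (2:ℝ) < 5/2 by norm_num)] with t ht
      simp only [F, chi_zero_right (le_of_lt ht), zero_mul]
    rw [this.deriv_eq]; simp
  refine ⟨(5/2 - 1/5) * (A * (1 + 4 * 750000 + 3 * 750000 ^ 2)) * 200 ^ 2, by positivity, fun α β hα hβ => ?_⟩
  have hα0 : 0 < α := by linarith
  unfold II
  rw [integral_eq_interval (a := 1/5) (b := 5/2) (by norm_num) (fun t ht => by
    have : chi t = 0 := by
      rw [Set.mem_Ioc, not_and_or, not_lt, not_le] at ht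
      rcases ht with ht | ht
      · exact chi_zero_left (by linarith)
      · exact chi_zero_right (by linarith)
    rw [this]; simp)]
  have key := ibp2 (a := 1/5) (b := 5/2) (by norm_num) (F := F) (F1 := deriv F) (F2 := deriv (deriv F))
    (p := fun t => α / t + β * t) (p1 := fun t => - α / t ^ 2 + β) (p2 := fun t => 2 * α / t ^ 3)
    (p3 := fun t => - 6 * α / t ^ 4) (m := (α + |β|) / 200) (A := A) (Q := 750000)
    (by positivity) (by norm_num) (by positivity)
    (fun t _ => (hF.differentiable (by simp) t).hasDerivAt)
    (fun t _ => (hF1.differentiable (by simp) t).hasDerivAt)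
    (fun t ht => by
      have ht0 : t ≠ 0 := by linarith [ht.1]
      refine ((((hasDerivAt_id t).inv ht0).const_mul α).add ((hasDerivAt_id t).const_mul β)).congr_deriv ?_
      simp only [id]
      field_simp)
    (fun t ht => by
      have ht0 : t ≠ 0 := by linarith [ht.1]
      have := ((((hasDerivAt_pow 2 t).fun_inv (by positivity)).const_mul (-α)).add_const β)
      refine this.congr_deriv ?_
      field_simp
      norm_num
      ring)
    (fun t ht => by
      have ht0 : t ≠ 0 := by linarith [ht.1]
      have := ((((hasDerivAt_pow 3 t).fun_inv (by positivity)).const_mul (2*α)))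
      refine this.congr_deriv ?_
      field_simp
      norm_num
      ring)
    hF2.continuous.continuousOn
    (by
      apply ContinuousOn.div continuousOn_const (by fun_prop)
      intro t ht
      have ht0 : 0 < t := by linarith [ht.1]
      positivity)
    (by simp only [F, chi_zero_left (show (1/5:ℝ) ≤ 1/4 by norm_num), zero_mul])
    (by simp only [F, chi_zero_right (show (2:ℝ) ≤ 5/2 by norm_num), zero_mul])
    d1 d2
    (fun t ht => ⟨by linarith [hA0 t ht], by linarith [hA1 t ht], by linarith [hA2 t ht]⟩)
    (fun t ht => by
      have ht0 : 0 < t := by linarith [ht.1]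
      have u1 : α / t ^ 2 ≤ 25 * α := by
        rw [div_le_iff₀ (by positivity)]
        have : 1 ≤ 25 * t ^ 2 := by nlinarith [ht.1]
        nlinarith
      have u2 : 4 / 25 * α ≤ α / t ^ 2 := by
        rw [le_div_iff₀ (by positivity)]
        have : 4 / 25 * t ^ 2 ≤ 1 := by nlinarith [ht.1, ht.2]
        nlinarith
      simp only [neg_div]
      rcases hβ with h | h
      · refine le_trans ?_ (neg_le_abs _)
        rcases le_or_gt 0 β with hb | hb
        · rw [abs_of_nonneg hb]; linarith
        · rw [abs_of_neg hb]; linarith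
      · refine le_trans ?_ (le_abs_self _)
        rw [abs_of_nonneg (by linarith)]; linarith)
    (fun t ht => by
      have ht0 : 0 < t := by linarith [ht.1]
      have ht5 : 1 ≤ 5 * t := by linarith [ht.1]
      have hb := abs_nonneg β
      constructor
      · rw [abs_of_pos (by positivity), div_le_iff₀ (by positivity)]
        have : 1 ≤ 125 * t ^ 3 := by
          have := one_le_pow₀ ht5 (n := 3); nlinarith
        have h2 : 2 * α ≤ 750000 * ((α + |β|) / 200) * (1 / 125) := by linarith
        nlinarith
      · rw [neg_mul, neg_div, abs_neg, abs_of_pos (by positivity), div_le_iff₀ (by positivity)]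
        have : 1 ≤ 625 * t ^ 4 := by
          have := one_le_pow₀ ht5 (n := 4); nlinarith
        have h2 : 6 * α ≤ 750000 * ((α + |β|) / 200) * (1 / 625) := by linarith
        nlinarith)
  refine key.trans (le_of_eq ?_)
  have : (α + |β|) ≠ 0 := by positivity
  field_simp

/-- main term of the oscillatory integral -/
noncomputable def mainII (α β : ℝ) : ℂ :=
  if 0 < β then ((chi (Real.sqrt (α / β)) * (α / β) * (2 * Real.sqrt (α * β)) ^ (-(1/2) : ℝ) : ℝ) : ℂ) *
    e (2 * Real.sqrt (α * β) + 1 / 8) else 0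

lemma II_asymp : ∃ C : ℝ, 0 < C ∧ ∀ α β : ℝ, 1 ≤ α →
    ‖II α β - mainII α β‖ ≤ C * α ^ (-(3/2) : ℝ) / (1 + (β / α) ^ 2) := by
  obtain ⟨C1, hC1, far⟩ := II_far
  obtain ⟨B0, hB0, hb0⟩ := uniform_bound Famp_contDiff (c := 1/6) (d := 3) (a := -4) (b := 4)
    (fun τ hτ s hs => Famp_zero hτ hs) 0
  obtain ⟨B4, hB4, hb4⟩ := uniform_bound Famp_contDiff (c := 1/6) (d := 3) (a := -4) (b := 4)
    (fun τ hτ s hs => Famp_zero hτ hs) 4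
  set B := B0 + B4 with hB
  refine ⟨C1 + 2 * (20 * (8 * B)) * 8 * 1025 , by positivity, fun α β hα => ?_⟩
  have hα0 : 0 < α := by linarith
  by_cases hfar : β ≤ α / 8 ∨ 32 * α ≤ β
  · have hm : mainII α β = 0 := by
      unfold mainII
      split_ifs with h
      · have : chi (Real.sqrt (α / β)) = 0 := by
          rcases hfar with h1 | h1
          · apply chi_zero_right
            apply Real.le_sqrt_of_sq_le
            rw [le_div_iff₀ h]; linarith
          · apply chi_zero_left
            rw [Real.sqrt_le_left (by norm_num), div_le_iff₀ h]; linarith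
        rw [this]; simp
      · rfl
    rw [hm, sub_zero]
    refine (far α β hα hfar).trans ?_
    have h1 : α ^ (-(2:ℝ)) ≤ α ^ (-(3/2) : ℝ) := Real.rpow_le_rpow_of_exponent_le hα (by norm_num)
    have h2 : C1 / (α + |β|) ^ 2 ≤ C1 * α ^ (-(2:ℝ)) / (1 + (β / α) ^ 2) := by
      rw [Real.rpow_neg hα0.le, Real.rpow_two, mul_div_assoc, div_eq_mul_inv C1]
      gcongr
      rw [inv_eq_one_div, div_le_div_iff₀ (by positivity) (by positivity)]
      have : (α ^ 2)⁻¹ * (α + |β|) ^ 2 = (1 + |β| / α) ^ 2 := by field_simp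
      rw [this, one_mul, ← sq_abs (β / α), abs_div, abs_of_pos hα0]
      have : 0 ≤ |β| / α := by positivity
      nlinarith
    refine h2.trans ?_
    gcongr
    have : 0 ≤ 2 * (20 * (8 * B)) * 8 * 1025 := by positivity
    linarith
  · rw [not_or, not_le, not_le] at hfar
    obtain ⟨h1, h2⟩ := hfar
    have hβ0 : 0 < β := by linarith
    have hτ : Real.sqrt (α / β) ∈ Set.Icc (1/6:ℝ) 3 := by
      constructor
      · apply Real.le_sqrt_of_sq_le
        rw [le_div_iff₀ hβ0]; linarith
      · rw [Real.sqrt_le_left (by norm_num), div_le_iff₀ hβ0]; linarith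
    rw [II_subst hα0 hβ0 hτ]
    set τ := Real.sqrt (α / β) with hτd
    set l := Real.sqrt (α * β) with hld
    have hl : 0 < l := Real.sqrt_pos.2 (by positivity)
    have hΦ : ContDiff ℝ ∞ (fun s => Famp (τ, s)) :=
      Famp_contDiff.comp (contDiff_const.prodMk contDiff_id)
    obtain ⟨i1, i2, i3, -, i5⟩ := fourier_bump (Φ := fun s => Famp (τ, s)) hΦ (a := -4) (b := 4) (A := B) (by norm_num)
      (fun s hs => Famp_zero hτ hs) (fun s => by have := hb0 τ hτ s; simp only [iteratedDeriv_zero] at this; linarith)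
      (fun s => by have := hb4 τ hτ s; linarith)
    have key := fresnel_asymp i1 hΦ.continuous i2 i3 hl
    have hF0 : Famp (τ, 0) = ((chi τ * (α / β) : ℝ) : ℂ) := by
      unfold Famp
      simp only [ww_zero]
      rw [show (0:ℝ)^2 + 4 = 2 ^ 2 by norm_num, Real.sqrt_sq (by norm_num), hτd, Real.sq_sqrt (by positivity)]
      norm_num
    have hmain : mainII α β = e (2 * l) * ((((2 * l) ^ (-(1 / 2) : ℝ) : ℝ) : ℂ) * e (1 / 8) * Famp (τ, 0)) := by
      unfold mainII
      rw [if_pos hβ0, hF0, e_add]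
      push_cast
      ring
    rw [hmain, ← mul_sub, norm_mul, norm_e, one_mul]
    refine key.trans ?_
    have hlα : α / 4 ≤ l := by
      apply Real.le_sqrt_of_sq_le; nlinarith
    have h3 : l ^ (-(3/2) : ℝ) ≤ 8 * α ^ (-(3/2) : ℝ) := by
      calc l ^ (-(3/2) : ℝ) ≤ (α / 4) ^ (-(3/2) : ℝ) := Real.rpow_le_rpow_of_nonpos (by positivity) hlα (by norm_num)
        _ = 8 * α ^ (-(3/2) : ℝ) := by
          rw [Real.div_rpow hα0.le (by norm_num), show (4:ℝ) = 2 ^ (2:ℝ) by norm_num, ← Real.rpow_mul (by norm_num)]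
          rw [div_eq_mul_inv, ← Real.rpow_neg (by norm_num)]
          norm_num
          ring
    have h4 : 1 ≤ 1025 / (1 + (β / α) ^ 2) := by
      rw [le_div_iff₀ (by positivity)]
      have : β / α ≤ 32 := by rw [div_le_iff₀ hα0]; exact h2.le
      have : 0 ≤ β / α := by positivity
      nlinarith
    have h5 : 0 < α ^ (-(3/2) : ℝ) := by positivity
    calc 2 * l ^ (-(3/2) : ℝ) * _ ≤ 2 * (8 * α ^ (-(3/2) : ℝ)) * (20 * (8 * B)) := by
          gcongr
          refine i5.trans (le_of_eq (by norm_num))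
      _ ≤ 2 * (8 * α ^ (-(3/2) : ℝ)) * (20 * (8 * B)) * (1025 / (1 + (β / α) ^ 2)) := by
          apply le_mul_of_one_le_right (by positivity) h4
      _ = (2 * (20 * (8 * B)) * 8 * 1025) * α ^ (-(3/2) : ℝ) / (1 + (β / α) ^ 2) := by ring
      _ ≤ _ := by gcongr; linarith

end DivM


namespace DivM
open scoped ContDiff

lemma hasCompactSupport_of_Icc {g : ℝ → ℂ} {a b : ℝ} (hs : ∀ t, t ∉ Set.Icc a b → g t = 0) :
    HasCompactSupport g := HasCompactSupport.intro isCompact_Icc hs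

open FourierTransform in
lemma poisson_scaled {g : ℝ → ℂ} (hg : ContDiff ℝ ∞ g) {a b : ℝ} (hs : ∀ t, t ∉ Set.Icc a b → g t = 0)
    {U : ℝ} (hU : 0 < U) :
    ∑' n : ℤ, g (n / U) = ∑' k : ℤ, (U : ℂ) * ∫ t, g t * e (k * U * t) := by
  have hgc : HasCompactSupport g := hasCompactSupport_of_Icc hs
  have hfc : HasCompactSupport (fun x : ℝ => g (x / U)) := by
    refine HasCompactSupport.intro (K := Set.Icc (a * U) (b * U)) isCompact_Icc (fun x hx => ?_)
    apply hs
    intro h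
    apply hx
    rw [Set.mem_Icc, le_div_iff₀ hU, div_le_iff₀ hU] at h
    exact h
  have hfs : ContDiff ℝ ∞ (fun x : ℝ => g (x / U)) := hg.comp (contDiff_id.div_const U)
  let f : SchwartzMap ℝ ℂ := hfc.toSchwartzMap hfs
  have hf : ∀ x, f x = g (x / U) := fun x => rfl
  have hP := SchwartzMap.tsum_eq_tsum_fourier f 0
  simp only [zero_add, hf] at hP
  rw [hP, ← Equiv.tsum_eq (Equiv.neg ℤ)]
  congr 1; funext k
  have h1 : (fourier (-k)) ((0:ℝ) : UnitAddCircle) = 1 := by simp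
  simp only [Equiv.neg_apply]
  rw [h1, mul_one, SchwartzMap.fourier_coe, Real.fourier_eq']
  have h2 := Measure.integral_comp_div (fun t => g t * e (k * U * t)) U
  rw [abs_of_pos hU, Complex.real_smul] at h2
  rw [← h2]
  congr 1; funext x
  rw [hf, smul_eq_mul, mul_comm]
  unfold e
  congr 3
  have : inner ℝ x (((-k : ℤ) : ℝ)) = -k * x := by simp
  rw [this]
  field_simp

/-- second bump -/
noncomputable def chi2 (t : ℝ) : ℝ := Real.smoothTransition (2 * t - 1) * Real.smoothTransition ((4 - t) / 2)

lemma chi2_contDiff : ContDiff ℝ ∞ chi2 := by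
  unfold chi2
  exact (Real.smoothTransition.contDiff.comp (by fun_prop)).mul (Real.smoothTransition.contDiff.comp (by fun_prop))

lemma chi2_zero_left {t : ℝ} (h : t ≤ 1 / 2) : chi2 t = 0 := by
  unfold chi2; rw [Real.smoothTransition.zero_of_nonpos (by linarith), zero_mul]
lemma chi2_zero_right {t : ℝ} (h : 4 ≤ t) : chi2 t = 0 := by
  unfold chi2; rw [Real.smoothTransition.zero_of_nonpos (x := (4 - t) / 2) (by linarith), mul_zero]
lemma chi2_one {t : ℝ} (h : 1 ≤ t) (h' : t ≤ 2) : chi2 t = 1 := by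
  unfold chi2
  rw [Real.smoothTransition.one_of_one_le (by linarith), Real.smoothTransition.one_of_one_le (by linarith), one_mul]
lemma chi2_nonneg (t : ℝ) : 0 ≤ chi2 t :=
  mul_nonneg (Real.smoothTransition.nonneg _) (Real.smoothTransition.nonneg _)
lemma chi2_le_one (t : ℝ) : chi2 t ≤ 1 :=
  mul_le_one₀ (Real.smoothTransition.le_one _) (Real.smoothTransition.nonneg _) (Real.smoothTransition.le_one _)

lemma smooth_cut {f : ℝ → ℝ} {h : ℝ → ℂ} (hf : ContDiff ℝ ∞ f) {c : ℝ} (hc : 0 < c)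
    (hz : ∀ t, t ≤ c → f t = 0) (hh : ∀ t, 0 < t → ContDiffAt ℝ ∞ h t) :
    ContDiff ℝ ∞ (fun t => ((f t : ℝ) : ℂ) * h t) := by
  rw [contDiff_iff_contDiffAt]
  intro t
  rcases lt_or_ge t c with ht | ht
  · have : (fun t => ((f t : ℝ) : ℂ) * h t) =ᶠ[nhds t] fun _ => 0 := by
      filter_upwards [Iio_mem_nhds ht] with s hs
      rw [hz s (le_of_lt hs)]; simp
    exact contDiffAt_const.congr_of_eventuallyEq this
  · exact (Complex.ofRealCLM.contDiff.comp hf).contDiffAt.mul (hh t (by linarith))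

lemma contDiffAt_e_comp {p : ℝ → ℝ} {t : ℝ} (hp : ContDiffAt ℝ ∞ p t) :
    ContDiffAt ℝ ∞ (fun t => e (p t)) t :=
  (contDiff_e.of_le le_top).contDiffAt.comp t hp

/-- the second oscillatory integral -/
noncomputable def JJ (α κ : ℝ) : ℂ := ∫ t : ℝ, ((chi2 t : ℝ) : ℂ) * e (α * Real.sqrt t + κ * t)

lemma JJ_triv (α κ : ℝ) : ‖JJ α κ‖ ≤ 4 := by
  unfold JJ
  rw [integral_eq_interval (a := 0) (b := 4) (by norm_num) (fun t ht => by
    rw [Set.mem_Ioc, not_and_or, not_lt, not_le] at ht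
    rcases ht with ht | ht
    · rw [chi2_zero_left (by linarith)]; simp
    · rw [chi2_zero_right (by linarith)]; simp)]
  have := intervalIntegral.norm_integral_le_of_norm_le_const (a := 0) (b := 4) (C := 1)
    (f := fun t : ℝ => ((chi2 t : ℝ) : ℂ) * e (α * Real.sqrt t + κ * t)) (fun t _ => by
      rw [norm_mul, norm_e, mul_one, Complex.norm_real, Real.norm_of_nonneg (chi2_nonneg t)]
      exact chi2_le_one t)
  norm_num at this ⊢
  exact this

lemma JJ_far : ∃ C : ℝ, 0 < C ∧ ∀ α κ : ℝ, (|α| ≤ |κ| ∨ κ = 0) → 0 < |α| + |κ| →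
    ‖JJ α κ‖ ≤ C / (|α| + |κ|) ^ 2 := by
  let F : ℝ → ℝ := chi2
  have hF : ContDiff ℝ ∞ F := chi2_contDiff
  have hF1 : ContDiff ℝ ∞ (deriv F) := (contDiff_infty_iff_deriv.1 hF).2
  have hF2 : ContDiff ℝ ∞ (deriv (deriv F)) := (contDiff_infty_iff_deriv.1 hF1).2
  have bd : ∀ f : ℝ → ℝ, ContDiff ℝ ∞ f → ∃ A, ∀ t ∈ Set.Icc (4/9:ℝ) 5, |f t| ≤ A := fun f hf =>
    isCompact_Icc.exists_bound_of_continuousOn hf.continuous.continuousOn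
  obtain ⟨A0, hA0⟩ := bd F hF
  obtain ⟨A1, hA1⟩ := bd _ hF1
  obtain ⟨A2, hA2⟩ := bd _ hF2
  have hA0' : 0 ≤ A0 := (abs_nonneg _).trans (hA0 1 (by constructor <;> norm_num))
  have hA1' : 0 ≤ A1 := (abs_nonneg _).trans (hA1 1 (by constructor <;> norm_num))
  have hA2' : 0 ≤ A2 := (abs_nonneg _).trans (hA2 1 (by constructor <;> norm_num))
  set A := A0 + A1 + A2 + 1 with hA
  have d1 : deriv F (4/9) = 0 := by
    have : F =ᶠ[nhds (4/9:ℝ)] fun _ => 0 := by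
      filter_upwards [Iio_mem_nhds (show (4/9:ℝ) < 1/2 by norm_num)] with t ht
      exact chi2_zero_left (le_of_lt ht)
    rw [this.deriv_eq]; simp
  have d2 : deriv F 5 = 0 := by
    have : F =ᶠ[nhds (5:ℝ)] fun _ => 0 := by
      filter_upwards [Ioi_mem_nhds (show (4:ℝ) < 5 by norm_num)] with t ht
      exact chi2_zero_right (le_of_lt ht)
    rw [this.deriv_eq]; simp
  refine ⟨(5 - 4/9) * (A * (1 + 4 * 100 + 3 * 100 ^ 2)) * 20 ^ 2, by positivity, fun α κ hκ hpos => ?_⟩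
  unfold JJ
  rw [integral_eq_interval (a := 4/9) (b := 5) (by norm_num) (fun t ht => by
    rw [Set.mem_Ioc, not_and_or, not_lt, not_le] at ht
    rcases ht with ht | ht
    · rw [chi2_zero_left (by linarith)]; simp
    · rw [chi2_zero_right (by linarith)]; simp)]
  have hsq : ∀ t ∈ Set.Icc (4/9:ℝ) 5, 2/3 ≤ Real.sqrt t ∧ Real.sqrt t ≤ 5/2 ∧ Real.sqrt t ^ 2 = t := by
    intro t ht
    refine ⟨Real.le_sqrt_of_sq_le (by linarith [ht.1]), ?_, Real.sq_sqrt (by linarith [ht.1])⟩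
    rw [Real.sqrt_le_left (by norm_num)]; linarith [ht.2]
  have hder : ∀ t ∈ Set.Icc (4/9:ℝ) 5, HasDerivAt Real.sqrt ((2 * Real.sqrt t)⁻¹) t := by
    intro t ht
    refine (Real.hasDerivAt_sqrt (by linarith [ht.1])).congr_deriv (by simp)
  have key := ibp2 (a := 4/9) (b := 5) (by norm_num) (F := F) (F1 := deriv F) (F2 := deriv (deriv F))
    (p := fun t => α * Real.sqrt t + κ * t) (p1 := fun t => α / 2 * (Real.sqrt t)⁻¹ + κ)
    (p2 := fun t => -α / 4 * (Real.sqrt t ^ 3)⁻¹)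
    (p3 := fun t => 3 * α / 8 * (Real.sqrt t ^ 5)⁻¹) (m := (|α| + |κ|) / 20) (A := A) (Q := 100)
    (by positivity) (by norm_num) (by positivity)
    (fun t _ => (hF.differentiable (by simp) t).hasDerivAt)
    (fun t _ => (hF1.differentiable (by simp) t).hasDerivAt)
    (fun t ht => by
      refine (((hder t ht).const_mul α).add ((hasDerivAt_id t).const_mul κ)).congr_deriv ?_
      rw [mul_inv]; ring)
    (fun t ht => by
      obtain ⟨h1, h2, h3⟩ := hsq t ht
      have h0 : Real.sqrt t ≠ 0 := by linarith
      refine ((((hder t ht).fun_inv h0).const_mul (α/2)).add_const κ).congr_deriv ?_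
      field_simp; norm_num; try ring)
    (fun t ht => by
      obtain ⟨h1, h2, h3⟩ := hsq t ht
      have h0 : Real.sqrt t ≠ 0 := by linarith
      refine ((((hder t ht).fun_pow 3).fun_inv (by positivity)).const_mul (-α/4)).congr_deriv ?_
      field_simp; norm_num; try ring)
    hF2.continuous.continuousOn
    (by
      apply ContinuousOn.mul continuousOn_const (ContinuousOn.inv₀ (by fun_prop) _)
      intro t ht
      obtain ⟨h1, h2, h3⟩ := hsq t ht
      positivity)
    (chi2_zero_left (by norm_num))
    (chi2_zero_right (by norm_num))
    d1 d2
    (fun t ht => ⟨by linarith [hA0 t ht], by linarith [hA1 t ht], by linarith [hA2 t ht]⟩)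
    (fun t ht => by
      obtain ⟨h1, h2, h3⟩ := hsq t ht
      have h0 : 0 < Real.sqrt t := by linarith
      have u1 : (Real.sqrt t)⁻¹ ≤ 3/2 := by
        rw [inv_le_comm₀ h0 (by norm_num)]; norm_num; linarith
      have u2 : 2/5 ≤ (Real.sqrt t)⁻¹ := by
        rw [le_inv_comm₀ (by norm_num) h0]; norm_num; linarith
      have hav : |α / 2 * (Real.sqrt t)⁻¹| = |α| / 2 * (Real.sqrt t)⁻¹ := by
        rw [abs_mul, abs_div, abs_two, abs_of_pos (by positivity : 0 < (Real.sqrt t)⁻¹)]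
      rcases hκ with h | h
      · have h4 : |κ| - |α / 2 * (Real.sqrt t)⁻¹| ≤ |α / 2 * (Real.sqrt t)⁻¹ + κ| := by
          have := abs_sub_abs_le_abs_sub κ (-(α / 2 * (Real.sqrt t)⁻¹))
          rw [abs_neg, sub_neg_eq_add, add_comm κ] at this
          exact this
        rw [hav] at h4
        nlinarith [abs_nonneg α]
      · subst h
        simp only [add_zero, abs_zero] at *
        rw [hav]; nlinarith [abs_nonneg α])
    (fun t ht => by
      obtain ⟨h1, h2, h3⟩ := hsq t ht
      have h0 : 0 < Real.sqrt t := by linarith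
      have u1 : (Real.sqrt t)⁻¹ ≤ 3/2 := by
        rw [inv_le_comm₀ h0 (by norm_num)]; norm_num; linarith
      have v3 : (Real.sqrt t ^ 3)⁻¹ ≤ 27/8 := by
        rw [← inv_pow]; refine (pow_le_pow_left₀ (by positivity) u1 3).trans (by norm_num)
      have v5 : (Real.sqrt t ^ 5)⁻¹ ≤ 8 := by
        rw [← inv_pow]; refine (pow_le_pow_left₀ (by positivity) u1 5).trans (by norm_num)
      have := abs_nonneg α
      have := abs_nonneg κ
      constructor
      · rw [abs_mul, abs_div, abs_neg, abs_of_pos (by positivity : 0 < (Real.sqrt t ^ 3)⁻¹), abs_of_pos (by norm_num : (0:ℝ) < 4)]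
        nlinarith
      · rw [abs_mul, abs_div, abs_mul, abs_of_pos (by positivity : 0 < (Real.sqrt t ^ 5)⁻¹), abs_of_pos (by norm_num : (0:ℝ) < 8), abs_of_pos (by norm_num : (0:ℝ) < 3)]
        nlinarith)
  refine key.trans (le_of_eq ?_)
  have : (|α| + |κ|) ≠ 0 := by positivity
  field_simp

/-- amplitude for `JJ` after substitution -/
noncomputable def Phi2 (s : ℝ) : ℂ := ((chi2 (s ^ 2) * Real.smoothTransition (4 * s) * (2 * s) : ℝ) : ℂ)

lemma Phi2_contDiff : ContDiff ℝ ∞ Phi2 := by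
  unfold Phi2
  refine Complex.ofRealCLM.contDiff.comp ?_
  refine ((chi2_contDiff.comp (contDiff_id.pow 2)).mul ?_).mul (by fun_prop)
  exact Real.smoothTransition.contDiff.comp (by fun_prop)

lemma Phi2_zero {s : ℝ} (hs : s ∉ Set.Icc (0:ℝ) 2) : Phi2 s = 0 := by
  unfold Phi2
  rw [Set.mem_Icc, not_and_or, not_le, not_le] at hs
  rcases hs with hs | hs
  · rw [Real.smoothTransition.zero_of_nonpos (by linarith)]; simp
  · rw [chi2_zero_right (by nlinarith)]; simp

lemma JJ_subst (α κ : ℝ) : JJ α κ = ∫ s : ℝ, Phi2 s * e (α * s + κ * s ^ 2) := by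
  have hz : ∀ s : ℝ, s ∉ Set.Ioc (0:ℝ) 2 → Phi2 s = 0 := by
    intro s hs
    by_cases h : s = 0
    · subst h; unfold Phi2; simp
    · exact Phi2_zero (fun h' => hs ⟨lt_of_le_of_ne h'.1 (Ne.symm h), h'.2⟩)
  rw [integral_eq_interval (a := 0) (b := 2) (by norm_num) (fun s hs => by rw [hz s hs, zero_mul])]
  unfold JJ
  rw [integral_eq_interval (a := 0) (b := 4) (by norm_num) (fun t ht => by
    rw [Set.mem_Ioc, not_and_or, not_lt, not_le] at ht
    rcases ht with ht | ht
    · rw [chi2_zero_left (by linarith)]; simp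
    · rw [chi2_zero_right (by linarith)]; simp)]
  have := intervalIntegral.integral_deriv_smul_comp_of_deriv_nonneg (a := 0) (b := 2) (f := fun s : ℝ => s ^ 2) (f' := fun s => 2 * s)
    (g := fun t => ((chi2 t : ℝ) : ℂ) * e (α * Real.sqrt t + κ * t)) (by fun_prop)
    (fun s _ => by simpa using hasDerivAt_pow 2 s) (fun s hs => by
      have : 0 < s := by simpa using hs.1
      positivity)
  norm_num at this
  rw [← this]
  apply intervalIntegral.integral_congr
  intro s hs
  rw [Set.uIcc_of_le (by norm_num)] at hs
  simp only
  rw [Real.sqrt_sq hs.1]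
  unfold Phi2
  rcases le_or_gt s (1/4) with h | h
  · rw [chi2_zero_left (by nlinarith [hs.1])]; simp
  · rw [Real.smoothTransition.one_of_one_le (by linarith)]
    push_cast; ring

lemma JJ_mid : ∃ C : ℝ, 0 < C ∧ ∀ α κ : ℝ, κ ≠ 0 → ‖JJ α κ‖ ≤ C * |κ| ^ (-(1/2) : ℝ) := by
  have hF : ContDiff ℝ ∞ (fun z : ℝ × ℝ => Phi2 z.2) := Phi2_contDiff.comp contDiff_snd
  obtain ⟨B0, hB0, hb0⟩ := uniform_bound hF (c := 0) (d := 0) (a := 0) (b := 2)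
    (fun τ hτ s hs => Phi2_zero hs) 0
  obtain ⟨B4, hB4, hb4⟩ := uniform_bound hF (c := 0) (d := 0) (a := 0) (b := 2)
    (fun τ hτ s hs => Phi2_zero hs) 4
  set B := B0 + B4 with hB
  refine ⟨20 * (2 * B) + 1, by positivity, fun α κ hκ => ?_⟩
  rw [JJ_subst]
  set s0 := - α / (2 * κ) with hs0
  have h1 : ∫ s : ℝ, Phi2 s * e (α * s + κ * s ^ 2)
      = e (-(κ * s0 ^ 2)) * ∫ s : ℝ, Phi2 (s + s0) * e (κ * s ^ 2) := by
    rw [← integral_add_right_eq_self (μ := volume) (fun s : ℝ => Phi2 s * e (α * s + κ * s ^ 2)) s0, ← integral_const_mul]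
    congr 1; funext s
    have : α * (s + s0) + κ * (s + s0) ^ 2 = -(κ * s0 ^ 2) + κ * s ^ 2 := by
      rw [hs0]; field_simp; ring
    rw [this, e_add]; ring
  rw [h1, norm_mul, norm_e, one_mul]
  have hΦ : ContDiff ℝ ∞ (fun s => Phi2 (s + s0)) := Phi2_contDiff.comp (by fun_prop)
  obtain ⟨i1, i2, i3, i4, -⟩ := fourier_bump (Φ := fun s => Phi2 (s + s0)) hΦ (a := -s0) (b := 2 - s0) (A := B) (by linarith)
    (fun s hs => Phi2_zero (fun h => hs ⟨by linarith [h.1], by linarith [h.2]⟩))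
    (fun s => by have := hb0 0 (by simp) (s + s0); simp only [iteratedDeriv_zero] at this; linarith)
    (fun s => by
      have := hb4 0 (by simp) (s + s0)
      rw [iteratedDeriv_comp_add_const]
      linarith)
  refine (fresnel_norm i1 i2 hκ).trans ?_
  rw [mul_comm]
  gcongr
  refine i4.trans (le_of_eq (by ring)) |>.trans (by linarith : 20 * (2 * B) ≤ _)

lemma sum_rpow_neg_half (n : ℕ) : ∑ k ∈ Finset.range n, ((k:ℝ) + 1) ^ (-(1/2) : ℝ) ≤ 2 * Real.sqrt n := by
  induction n with
  | zero => simp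
  | succ n ih =>
    rw [Finset.sum_range_succ]
    have h1 : ((n:ℝ) + 1) ^ (-(1/2) : ℝ) = 1 / Real.sqrt (n + 1) := by
      rw [Real.rpow_neg (by positivity), Real.sqrt_eq_rpow, one_div ((n + 1 : ℝ) ^ _)]
    rw [h1]
    push_cast
    have h2 : 1 / Real.sqrt (n + 1) ≤ 2 * Real.sqrt (n + 1) - 2 * Real.sqrt n := by
      have hp : 0 < Real.sqrt ((n:ℝ) + 1) := Real.sqrt_pos.2 (by positivity)
      rw [div_le_iff₀ hp]
      have a1 := Real.mul_self_sqrt (show 0 ≤ (n:ℝ) + 1 by positivity)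
      have a2 := Real.mul_self_sqrt (show 0 ≤ (n:ℝ) by positivity)
      nlinarith [sq_nonneg (Real.sqrt ((n:ℝ) + 1) - Real.sqrt n)]
    linarith

lemma K_bound : ∃ C : ℝ, 0 < C ∧ ∀ M D : ℝ, 1 ≤ M →
    ‖∑' n : ℤ, ((chi2 (n / M) : ℝ) : ℂ) * e (D * Real.sqrt n)‖
      ≤ C * (M / (1 + (D * Real.sqrt M) ^ 2) + 1 / M + |D * Real.sqrt M| ^ (1/2 : ℝ)) := by
  obtain ⟨C1, hC1, far⟩ := JJ_far
  obtain ⟨C2, hC2, mid⟩ := JJ_mid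
  have hZs : Summable (fun n : ℕ => 1 / ((n:ℝ) + 1) ^ 2) := by
    have := (summable_nat_add_iff 1).2 (Real.summable_one_div_nat_pow.2 (by norm_num : 1 < 2))
    simpa using this
  set Z := ∑' n : ℕ, 1 / ((n:ℝ) + 1) ^ 2 with hZ
  have hZ0 : 0 ≤ Z := tsum_nonneg fun n => by positivity
  refine ⟨(2 * C1 + 8) + 2 * (C1 * Z + 2 * C2), by positivity, fun M D hM => ?_⟩
  have hM0 : 0 < M := by linarith
  set α := D * Real.sqrt M with hα
  have hgs : ContDiff ℝ ∞ (fun t => ((chi2 t : ℝ) : ℂ) * e (α * Real.sqrt t)) :=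
    smooth_cut chi2_contDiff (c := 1/2) (by norm_num) (fun t ht => chi2_zero_left ht)
      (fun t ht => contDiffAt_e_comp (contDiffAt_const.mul (Real.contDiffAt_sqrt ht.ne')))
  have hP := poisson_scaled hgs (a := 1/2) (b := 4) (fun t ht => by
    rw [Set.mem_Icc, not_and_or, not_le, not_le] at ht
    rcases ht with ht | ht
    · rw [chi2_zero_left (by linarith)]; simp
    · rw [chi2_zero_right (by linarith)]; simp) hM0
  have hL : ∀ n : ℤ, ((chi2 (n / M) : ℝ) : ℂ) * e (α * Real.sqrt (n / M))
      = ((chi2 (n / M) : ℝ) : ℂ) * e (D * Real.sqrt n) := by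
    intro n
    rw [hα, Real.sqrt_div' _ hM0.le]
    have : Real.sqrt M ≠ 0 := by positivity
    congr 2; field_simp
  have hR : ∀ k : ℤ, ∫ t : ℝ, ((chi2 t : ℝ) : ℂ) * e (α * Real.sqrt t) * e (k * M * t) = JJ α (k * M) := by
    intro k
    unfold JJ
    congr 1; funext t; rw [e_add, mul_assoc]
  simp only [hL, hR] at hP
  rw [hP]
  let c : ℕ → ℝ := fun n => C1 / M * (1 / ((n:ℝ) + 1) ^ 2) +
    if ((n:ℝ) + 1) * M < |α| then C2 * M ^ (1/2 : ℝ) * ((n:ℝ) + 1) ^ (-(1/2) : ℝ) else 0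
  have hfin : ∀ n ∉ Finset.range ⌊|α| / M⌋₊, (if ((n:ℝ) + 1) * M < |α| then C2 * M ^ (1/2 : ℝ) * ((n:ℝ) + 1) ^ (-(1/2) : ℝ) else 0) = 0 := by
    intro n hn
    rw [Finset.mem_range, not_lt] at hn
    rw [if_neg]
    rw [not_lt, ← div_le_iff₀ hM0]
    have := Nat.lt_floor_add_one (|α| / M)
    have : ((⌊|α| / M⌋₊ : ℕ) : ℝ) ≤ n := by exact_mod_cast hn
    linarith
  have hs2 := summable_of_ne_finset_zero (L := SummationFilter.unconditional ℕ) hfin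
  have hs1 : Summable (fun n : ℕ => C1 / M * (1 / ((n:ℝ) + 1) ^ 2)) := hZs.mul_left _
  have hcs : Summable c := hs1.add hs2
  have hc0 : ∑' n, c n ≤ C1 * Z / M + 2 * C2 * |α| ^ (1/2 : ℝ) := by
    have h1 : ∑' n, c n = C1 / M * Z + ∑' n : ℕ, (if ((n:ℝ) + 1) * M < |α| then C2 * M ^ (1/2 : ℝ) * ((n:ℝ) + 1) ^ (-(1/2) : ℝ) else 0) := by
      rw [hs1.tsum_add hs2, tsum_mul_left]
    rw [h1, tsum_eq_sum hfin]
    have h2 : ∑ n ∈ Finset.range ⌊|α| / M⌋₊, (if ((n:ℝ) + 1) * M < |α| then C2 * M ^ (1/2 : ℝ) * ((n:ℝ) + 1) ^ (-(1/2) : ℝ) else 0)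
        ≤ C2 * M ^ (1/2 : ℝ) * (2 * Real.sqrt (⌊|α| / M⌋₊)) := by
      calc _ ≤ ∑ n ∈ Finset.range ⌊|α| / M⌋₊, C2 * M ^ (1/2 : ℝ) * ((n:ℝ) + 1) ^ (-(1/2) : ℝ) := by
            apply Finset.sum_le_sum
            intro n _
            split_ifs
            · exact le_refl _
            · positivity
        _ = C2 * M ^ (1/2 : ℝ) * ∑ n ∈ Finset.range ⌊|α| / M⌋₊, ((n:ℝ) + 1) ^ (-(1/2) : ℝ) := by rw [Finset.mul_sum]
        _ ≤ _ := by gcongr; exact sum_rpow_neg_half _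
    have h3 : Real.sqrt (⌊|α| / M⌋₊) ≤ |α| ^ (1/2 : ℝ) / M ^ (1/2 : ℝ) := by
      rw [← Real.div_rpow (abs_nonneg _) hM0.le, ← Real.sqrt_eq_rpow]
      exact Real.sqrt_le_sqrt (Nat.floor_le (by positivity))
    have h4 : C2 * M ^ (1/2 : ℝ) * (2 * Real.sqrt (⌊|α| / M⌋₊)) ≤ 2 * C2 * |α| ^ (1/2 : ℝ) := by
      calc _ ≤ C2 * M ^ (1/2 : ℝ) * (2 * (|α| ^ (1/2 : ℝ) / M ^ (1/2 : ℝ))) := by gcongr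
        _ = _ := by
          have : M ^ (1/2 : ℝ) ≠ 0 := by positivity
          field_simp
    have h5 : C1 / M * Z = C1 * Z / M := by ring
    linarith
  have hcb : ∀ n : ℕ, ∀ σ : ℝ, |σ| = 1 → ‖(M : ℂ) * JJ α (σ * (n + 1) * M)‖ ≤ c n := by
    intro n σ hσ
    rw [norm_mul, Complex.norm_real, Real.norm_of_nonneg hM0.le]
    have hab : |σ * (n + 1) * M| = (n + 1) * M := by
      rw [abs_mul, abs_mul, hσ, one_mul, abs_of_pos hM0, abs_of_pos (by positivity)]
    simp only [c]
    split_ifs with h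
    · have := mid α (σ * (n + 1) * M) (by rw [← abs_pos, hab]; positivity)
      rw [hab, Real.mul_rpow (by positivity) hM0.le] at this
      have h6 : M * (C2 * (((n:ℝ) + 1) ^ (-(1/2) : ℝ) * M ^ (-(1/2) : ℝ))) = C2 * M ^ (1/2 : ℝ) * ((n:ℝ) + 1) ^ (-(1/2) : ℝ) := by
        have : M * M ^ (-(1/2) : ℝ) = M ^ (1/2 : ℝ) := by
          nth_rw 1 [← Real.rpow_one M]; rw [← Real.rpow_add hM0]; norm_num
        rw [← this]; ring
      have h7 : 0 ≤ C1 / M * (1 / ((n:ℝ) + 1) ^ 2) := by positivity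
      have h8 := mul_le_mul_of_nonneg_left this hM0.le
      linarith
    · rw [not_lt] at h
      have := far α (σ * (n + 1) * M) (Or.inl (by rw [hab]; exact h)) (by rw [hab]; positivity)
      rw [hab] at this
      calc M * ‖JJ α (σ * (n + 1) * M)‖ ≤ M * (C1 / (|α| + (n + 1) * M) ^ 2) := by gcongr
        _ ≤ M * (C1 / (0 + (n + 1) * M) ^ 2) := by gcongr; positivity
        _ = _ := by field_simp; ring
  have hb0 : ‖(M : ℂ) * JJ α 0‖ ≤ (2 * C1 + 8) * (M / (1 + α ^ 2)) := by
    rw [norm_mul, Complex.norm_real, Real.norm_of_nonneg hM0.le]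
    have : ‖JJ α 0‖ ≤ (2 * C1 + 8) / (1 + α ^ 2) := by
      rw [le_div_iff₀ (by positivity)]
      rcases le_or_gt |α| 1 with h | h
      · have h1 := JJ_triv α 0
        have : α ^ 2 ≤ 1 := by rw [← sq_abs]; nlinarith [abs_nonneg α]
        nlinarith [norm_nonneg (JJ α 0)]
      · have h1 := far α 0 (Or.inr rfl) (by rw [abs_zero, add_zero]; linarith)
        rw [abs_zero, add_zero, sq_abs, le_div_iff₀ (by rw [← sq_abs]; positivity)] at h1
        have : 1 ≤ α ^ 2 := by rw [← sq_abs]; nlinarith [abs_nonneg α]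
        nlinarith [norm_nonneg (JJ α 0)]
    calc _ ≤ M * ((2 * C1 + 8) / (1 + α ^ 2)) := by gcongr
      _ = _ := by ring
  let f : ℤ → ℝ := fun k => ‖(M : ℂ) * JJ α (k * M)‖
  have hp : ∀ n : ℕ, f ((n : ℤ) + 1) ≤ c n := fun n => by
    have := hcb n 1 (by simp)
    simp only [f]; push_cast; rwa [one_mul] at this
  have hn : ∀ n : ℕ, f (-((n : ℤ) + 1)) ≤ c n := fun n => by
    have := hcb n (-1) (by simp)
    simp only [f]; push_cast
    rwa [neg_one_mul] at this
  have sp : Summable (fun n : ℕ => f ((n : ℤ) + 1)) := Summable.of_nonneg_of_le (fun n => norm_nonneg _) hp hcs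
  have sn : Summable (fun n : ℕ => f (-((n : ℤ) + 1))) := Summable.of_nonneg_of_le (fun n => norm_nonneg _) hn hcs
  have hs := HasSum.of_add_one_of_neg_add_one sp.hasSum sn.hasSum
  refine (norm_tsum_le_tsum_norm hs.summable).trans ?_
  change ∑' k, f k ≤ _
  rw [hs.tsum_eq]
  have a1 := (sp.tsum_le_tsum hp hcs).trans hc0
  have a2 := (sn.tsum_le_tsum hn hcs).trans hc0
  have a3 : f 0 ≤ (2 * C1 + 8) * (M / (1 + α ^ 2)) := by
    simp only [f]; rw [Int.cast_zero, zero_mul]; exact hb0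
  have p1 : 0 ≤ M / (1 + α ^ 2) := by positivity
  have p2 : 0 ≤ 1 / M := by positivity
  have p3 : 0 ≤ |α| ^ (1/2 : ℝ) := by positivity
  have e1 : C1 * Z / M = C1 * Z * (1 / M) := by ring
  rw [e1] at a1 a2
  have q1 : 0 ≤ C1 * Z := by positivity
  nlinarith [mul_nonneg q1 p1, mul_nonneg q1 p2, mul_nonneg q1 p3, mul_nonneg hC1.le p2, mul_nonneg hC1.le p3,
    mul_nonneg hC2.le p1, mul_nonneg hC2.le p2, mul_nonneg hC2.le p3]

end DivM


namespace DivM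

/-- Dirichlet hyperbola identity in natural numbers. -/
lemma hyperbola_nat (N m : ℕ) (hm : 1 ≤ m) (hmN : m ≤ N) :
    ∑ n ∈ Finset.Icc 1 N, (divfun n : ℝ) =
      ∑ a ∈ Finset.Icc 1 m, ((N / a : ℕ) : ℝ) + ∑ b ∈ Finset.Icc 1 (N / m), (((N / b : ℕ) : ℝ) - m) := by
  have h1 : ∑ n ∈ Finset.Ioc 0 N, divfun n = ∑ n ∈ Finset.Ioc 0 N, (N / n) := by
    have := ArithmeticFunction.sum_Ioc_sigma0_eq_sum_div N
    simpa [ArithmeticFunction.sigma_zero_apply, divfun] using this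
  have h2 : ∀ k : ℕ, Finset.Icc 1 k = Finset.Ioc 0 k := fun k => by ext; simp; omega
  have h3 : ∑ n ∈ Finset.Ioc 0 N, (N / n) = ∑ n ∈ Finset.Ioc 0 m, (N / n) + ∑ n ∈ Finset.Ioc m N, (N / n) :=
    (Finset.sum_Ioc_consecutive (fun n => N / n) (Nat.zero_le m) hmN).symm
  have h4 : ∑ a ∈ Finset.Ioc m N, (N / a) = ∑ b ∈ Finset.Ioc 0 (N / m), (N / b - m) := by
    have e1 : ∀ a ∈ Finset.Ioc m N, N / a = ∑ b ∈ Finset.Ioc 0 (N / m), if a * b ≤ N then 1 else 0 := by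
      intro a ha
      rw [Finset.mem_Ioc] at ha
      rw [← Finset.sum_filter, Finset.sum_const, smul_eq_mul, mul_one]
      have : (Finset.Ioc 0 (N / m)).filter (fun b => a * b ≤ N) = Finset.Ioc 0 (N / a) := by
        ext b
        simp only [Finset.mem_filter, Finset.mem_Ioc]
        rw [Nat.le_div_iff_mul_le (by omega : 0 < m), Nat.le_div_iff_mul_le (by omega : 0 < a)]
        constructor
        · rintro ⟨⟨h, _⟩, h'⟩
          exact ⟨h, by linarith⟩
        · rintro ⟨h, h'⟩
          refine ⟨⟨h, ?_⟩, by linarith⟩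
          calc b * m ≤ b * a := Nat.mul_le_mul_left _ ha.1.le
            _ ≤ N := h'
      rw [this]; simp
    have e2 : ∀ b ∈ Finset.Ioc 0 (N / m), N / b - m = ∑ a ∈ Finset.Ioc m N, if a * b ≤ N then 1 else 0 := by
      intro b hb
      rw [Finset.mem_Ioc] at hb
      rw [← Finset.sum_filter, Finset.sum_const, smul_eq_mul, mul_one]
      have : (Finset.Ioc m N).filter (fun a => a * b ≤ N) = Finset.Ioc m (N / b) := by
        ext a
        simp only [Finset.mem_filter, Finset.mem_Ioc]
        rw [Nat.le_div_iff_mul_le (by omega : 0 < b)]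
        constructor
        · rintro ⟨⟨h, _⟩, h'⟩
          exact ⟨h, h'⟩
        · rintro ⟨h, h'⟩
          refine ⟨⟨h, ?_⟩, h'⟩
          nlinarith
      rw [this]; simp
    rw [Finset.sum_congr rfl e1, Finset.sum_congr rfl e2, Finset.sum_comm]
  rw [h2, h2, h2, ← Nat.cast_sum, h1, h3, h4, Nat.cast_add, Nat.cast_sum, Nat.cast_sum]
  congr 1
  refine Finset.sum_congr rfl fun b hb => ?_
  rw [Finset.mem_Ioc] at hb
  rw [Nat.cast_sub]
  rw [Nat.le_div_iff_mul_le (by omega : 0 < b)]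
  have := hb.2
  rw [Nat.le_div_iff_mul_le (by omega : 0 < m)] at this
  linarith

/-- Sawtooth function. -/
noncomputable def ps (t : ℝ) : ℝ := Int.fract t - 1 / 2

lemma abs_ps_le (t : ℝ) : |ps t| ≤ 1 := by
  unfold ps
  have := Int.fract_nonneg t
  have := Int.fract_lt_one t
  rw [abs_le]; constructor <;> linarith

noncomputable def harm (n : ℕ) : ℝ := ∑ a ∈ Finset.Icc 1 n, (1 : ℝ) / a

lemma harm_succ (n : ℕ) : harm (n + 1) = harm n + 1 / ((n : ℝ) + 1) := by
  unfold harm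
  rw [Finset.sum_Icc_succ_top (by omega)]
  push_cast; rfl

lemma harm_eq (n : ℕ) : harm n = ((harmonic n : ℚ) : ℝ) := by
  induction n with
  | zero => simp [harm]
  | succ n ih => rw [harm_succ, ih, harmonic_succ]; push_cast; rw [one_div]

lemma harm_step (n : ℕ) (hn : 1 ≤ n) :
    |(harm (n+1) - Real.log ((n:ℝ)+1) - 1/(2*((n:ℝ)+1))) - (harm n - Real.log n - 1/(2*(n:ℝ)))|
      ≤ 1/(n:ℝ)^2 - 1/((n:ℝ)+1)^2 := by
  have hn0 : (1:ℝ) ≤ n := by exact_mod_cast hn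
  have hx : |(1:ℝ)/((n:ℝ)+1)| < 1 := by
    rw [abs_of_pos (by positivity), div_lt_one (by positivity)]; linarith
  have h := Real.abs_log_sub_add_sum_range_le hx 2
  have hl : Real.log (1 - 1/((n:ℝ)+1)) = Real.log n - Real.log ((n:ℝ)+1) := by
    rw [← Real.log_div (by positivity) (by positivity)]
    congr 1; field_simp; ring
  rw [hl, abs_of_pos (by positivity : (0:ℝ) < 1/((n:ℝ)+1))] at h
  simp only [Finset.sum_range_succ, Finset.sum_range_zero] at h
  rw [harm_succ]
  have e1 : (1/((n:ℝ)+1))^(2+1)/(1-1/((n:ℝ)+1)) = 1/(n*((n:ℝ)+1)^2) := by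
    have : (1:ℝ) - 1/((n:ℝ)+1) = n/((n:ℝ)+1) := by field_simp; ring
    rw [this, div_pow]; field_simp; ring
  rw [e1] at h
  have e2 : 1/(n:ℝ)^2 - 1/((n:ℝ)+1)^2 = (2*n+1)/((n:ℝ)^2*((n:ℝ)+1)^2) := by field_simp; ring
  have e3 : 1/(2*(n:ℝ)) - 1/(2*((n:ℝ)+1)) - 1/(2*((n:ℝ)+1)^2) = 1/(2*n*((n:ℝ)+1)^2) := by field_simp; ring
  have e4 : 1/(n*((n:ℝ)+1)^2) + 1/(2*n*((n:ℝ)+1)^2) ≤ (2*n+1)/((n:ℝ)^2*((n:ℝ)+1)^2) := by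
    rw [show 1/(n*((n:ℝ)+1)^2) + 1/(2*n*((n:ℝ)+1)^2) = (3/2*n)/((n:ℝ)^2*((n:ℝ)+1)^2) by field_simp; ring]
    gcongr; linarith
  have e5 : 0 ≤ 1/(2*n*((n:ℝ)+1)^2) := by positivity
  rw [e2]
  push_cast at h
  have e6 : (1/((n:ℝ)+1))^2/(1+1) = 1/(2*((n:ℝ)+1)^2) := by field_simp; ring
  have e7 : (1/((n:ℝ)+1))^(0+1)/(0+1) = 2 * (1/(2*((n:ℝ)+1))) := by rw [zero_add, pow_one]; field_simp; ring
  have e8 : (1/((n:ℝ)+1)) = 2 * (1/(2*((n:ℝ)+1))) := by field_simp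
  rw [e7, e6] at h
  rw [e8]
  rw [abs_le] at h ⊢
  constructor <;> linarith [h.1, h.2]

lemma harm_asymp (n : ℕ) (hn : 1 ≤ n) :
    |harm n - Real.log n - 1/(2*(n:ℝ)) - Real.eulerMascheroniConstant| ≤ 1/(n:ℝ)^2 := by
  set s : ℕ → ℝ := fun n => harm n - Real.log n - 1/(2*(n:ℝ)) with hs
  have hst : ∀ k : ℕ, |s (n + k) - s n| ≤ 1/(n:ℝ)^2 - 1/((n + k : ℕ):ℝ)^2 := by
    intro k
    induction k with
    | zero => simp
    | succ k ih =>
      have h := harm_step (n + k) (by omega)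
      have : s (n + (k+1)) - s n = (s (n + k + 1) - s (n+k)) + (s (n+k) - s n) := by
        rw [← add_assoc]; ring
      rw [this]
      refine (abs_add_le _ _).trans ?_
      have h' : |s (n + k + 1) - s (n+k)| ≤ 1/((n+k:ℕ):ℝ)^2 - 1/((n+(k+1):ℕ):ℝ)^2 := by
        have e : ((n + (k+1):ℕ):ℝ) = ((n+k:ℕ):ℝ) + 1 := by push_cast; ring
        rw [e]
        have e' : s (n+k+1) = harm (n+k+1) - Real.log (((n+k:ℕ):ℝ)+1) - 1/(2*(((n+k:ℕ):ℝ)+1)) := by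
          simp only [hs]; push_cast; rfl
        rw [e']; exact h
      linarith
  have hlim : Filter.Tendsto s Filter.atTop (nhds (Real.eulerMascheroniConstant - 0)) := by
    refine Filter.Tendsto.sub ?_ ?_
    · refine Real.tendsto_harmonic_sub_log.congr fun n => ?_
      rw [harm_eq]
    · have := (tendsto_const_nhds (x := (1/2:ℝ))).div_atTop (tendsto_natCast_atTop_atTop (R := ℝ))
      refine this.congr fun n => ?_
      rw [div_div]
  rw [sub_zero] at hlim
  have hlim2 : Filter.Tendsto (fun k => |s (n+k) - s n|) Filter.atTop (nhds |Real.eulerMascheroniConstant - s n|) := by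
    have := (Filter.tendsto_add_atTop_iff_nat n).mpr hlim
    refine ((this.sub_const (s n)).abs).congr fun k => ?_
    rw [add_comm]
  have := le_of_tendsto' hlim2 (fun k => (hst k).trans (sub_le_self _ (by positivity)))
  rw [abs_sub_comm] at this
  exact this

lemma harm_asymp_real (n : ℕ) (hn : 1 ≤ n) (B : ℝ) (h1 : (n:ℝ) ≤ B) (h2 : B ≤ n + 1) :
    |harm n - (Real.log B + Real.eulerMascheroniConstant - (B - n - 1/2)/B)| ≤ 4/(n:ℝ)^2 := by
  have h := harm_asymp n hn
  have hn0 : (1:ℝ) ≤ n := by exact_mod_cast hn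
  have hB : 0 < B := by linarith
  set z := (B - n)/n with hz
  have hz0 : 0 ≤ z := div_nonneg (by linarith) (by linarith)
  have hz1 : z ≤ 1/n := by rw [hz]; gcongr; linarith
  have hlog : Real.log B - Real.log n = Real.log (1 + z) := by
    rw [← Real.log_div (by positivity) (by positivity)]
    congr 1; rw [hz]; field_simp; ring
  have l1 := Real.le_log_one_add_of_nonneg hz0
  have l2 : Real.log (1+z) ≤ z := by
    have := Real.log_le_sub_one_of_pos (by linarith : 0 < 1 + z); linarith
  have l3 : z - z^2 ≤ 2*z/(z+2) := by
    rw [le_div_iff₀ (by linarith)]; nlinarith [pow_nonneg hz0 3, pow_nonneg hz0 2]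
  have l4 : z^2 ≤ 1/(n:ℝ)^2 := by
    calc z^2 ≤ (1/(n:ℝ))^2 := by gcongr
      _ = _ := by rw [div_pow, one_pow]
  have l5 : z - (B-n)/B = z * ((B-n)/B) := by rw [hz]; field_simp
  have l6 : 0 ≤ (B-n)/B := div_nonneg (by linarith) hB.le
  have l7 : (B-n)/B ≤ z := by rw [hz]; gcongr
  have l8 : z * ((B-n)/B) ≤ z^2 := by nlinarith
  have l9 : 0 ≤ z * ((B-n)/B) := by positivity
  have l10 : 1/(2*(n:ℝ)) - 1/(2*B) = (1/2) * ((B-n)/(n*B)) := by field_simp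
  have l11 : (B-n)/(n*B) ≤ 1/(n:ℝ)^2 := by
    rw [sq]; gcongr; linarith
  have l12 : 0 ≤ (B-n)/(n*B) := div_nonneg (by linarith) (by positivity)
  have l13 : (B - n - 1/2)/B = (B-n)/B - 1/(2*B) := by field_simp
  have l14 : 0 ≤ 1/(n:ℝ)^2 := by positivity
  have l15 : 4/(n:ℝ)^2 = 4 * (1/(n:ℝ)^2) := by ring
  rw [l13, l15]
  rw [abs_le] at h ⊢
  constructor <;> linarith [h.1, h.2]

/-- Sharp hyperbola formula with sawtooth functions. -/
lemma hyperbola_ps (x : ℝ) (m n : ℕ) (hm : 1 ≤ m) (hn : 1 ≤ n) (h1 : (n:ℝ) * m ≤ x) (h2 : x < (n + 1) * m) :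
    |DirichletDelta x + ∑ a ∈ Finset.Icc 1 m, ps (x / a) + ∑ b ∈ Finset.Icc 1 n, ps (x / b)| ≤
      1 + 4 * x / (m:ℝ)^2 + 4 * x / (n:ℝ)^2 := by
  have hm0 : (1:ℝ) ≤ m := by exact_mod_cast hm
  have hn0 : (1:ℝ) ≤ n := by exact_mod_cast hn
  have hmp : (0:ℝ) < m := by linarith
  have hx0 : (m:ℝ) ≤ x := by nlinarith
  have hx : 0 < x := by linarith
  set B := x / m with hB
  have hBn : (n:ℝ) ≤ B := by rw [hB, le_div_iff₀ hmp]; exact h1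
  have hBn' : B ≤ n + 1 := by rw [hB, div_le_iff₀ hmp]; exact h2.le
  have hBn2 : B < n + 1 := by rw [hB, div_lt_iff₀ hmp]; exact h2
  have hnm : ⌊x⌋₊ / m = n := by
    rw [← Nat.floor_div_natCast, Nat.floor_eq_iff (by positivity)]
    exact ⟨hBn, hBn2⟩
  have hmN : m ≤ ⌊x⌋₊ := Nat.le_floor hx0
  have key := hyperbola_nat ⌊x⌋₊ m hm hmN
  rw [hnm] at key
  have fl : ∀ a : ℕ, ((⌊x⌋₊ / a : ℕ) : ℝ) = x * (1 / a) - 1/2 - ps (x / a) := by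
    intro a
    rw [← Nat.floor_div_natCast]
    unfold ps
    have h0 : 0 ≤ x / a := by positivity
    rw [← Int.self_sub_floor, natCast_floor_eq_intCast_floor h0]
    ring
  simp only [fl, Finset.sum_sub_distrib, ← Finset.mul_sum] at key
  have c1 : ∑ a ∈ Finset.Icc 1 m, (1:ℝ)/a = harm m := rfl
  have c2 : ∑ a ∈ Finset.Icc 1 n, (1:ℝ)/a = harm n := rfl
  rw [c1, c2] at key
  simp only [Finset.sum_const, Nat.card_Icc, nsmul_eq_mul, Nat.add_sub_cancel] at key
  have a1 := harm_asymp_real m hm m le_rfl (by linarith)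
  have a2 := harm_asymp_real n hn B hBn hBn'
  have hlog : Real.log B = Real.log x - Real.log m := Real.log_div hx.ne' hmp.ne'
  unfold DirichletDelta
  rw [key]
  set γ := Real.eulerMascheroniConstant
  set E1 := harm m - (Real.log m + γ - ((m:ℝ) - m - 1/2)/m) with hE1
  set E2 := harm n - (Real.log B + γ - (B - n - 1/2)/B) with hE2
  have hBpos : 0 < B := by linarith
  have hxB : x / B = m := by rw [hB]; field_simp
  have m1 : harm m = E1 + Real.log m + γ + (1/2)/m := by rw [hE1]; ring
  have m2 : harm n = E2 + (Real.log x - Real.log m) + γ - (B - n - 1/2)/B := by rw [hE2, hlog]; ring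
  have t1 : x * ((1/2)/m) = B/2 := by rw [hB]; ring
  have t2 : x * ((B - n - 1/2)/B) = x - m * (n + 1/2) := by
    rw [show x * ((B - n - 1/2)/B) = (x/B)*(B - n - 1/2) by ring, hxB, hB]; field_simp; ring
  have r : x * harm m + x * harm n = x * E1 + x * E2 + x * Real.log x + 2 * γ * x + B/2 - (x - m * (n + 1/2)) := by
    rw [m1, m2, ← t1, ← t2]; ring
  have b1 : |x * E1| ≤ 4 * x / (m:ℝ)^2 := by
    rw [abs_mul, abs_of_pos hx]
    calc x * |E1| ≤ x * (4/(m:ℝ)^2) := by gcongr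
      _ = _ := by ring
  have b2 : |x * E2| ≤ 4 * x / (n:ℝ)^2 := by
    rw [abs_mul, abs_of_pos hx]
    calc x * |E2| ≤ x * (4/(n:ℝ)^2) := by gcongr
      _ = _ := by ring
  rw [abs_le] at b1 b2 ⊢
  constructor <;> linarith [b1.1, b1.2, b2.1, b2.2]

end DivM


namespace DivM

lemma W0_lipschitz : ∃ L : ℝ, 1 ≤ L ∧ ∀ s t : ℝ, 0 ≤ s → 0 ≤ t → |W0 s - W0 t| ≤ L * |s - t| := by
  have hc : Continuous (deriv W0) := W0_contDiff.continuous_deriv (by simp)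
  obtain ⟨L, hL⟩ := (isCompact_Icc (a := (0:ℝ)) (b := 3)).exists_bound_of_continuousOn hc.continuousOn
  have hd : Differentiable ℝ W0 := W0_contDiff.differentiable (by simp)
  refine ⟨max L 1, le_max_right _ _, ?_⟩
  have hbd : ∀ t : ℝ, 0 ≤ t → ‖deriv W0 t‖ ≤ max L 1 := by
    intro t ht
    by_cases h : t ≤ 3
    · exact (hL t ⟨ht, h⟩).trans (le_max_left _ _)
    · have : W0 =ᶠ[nhds t] fun _ => 0 := by
        filter_upwards [Ioi_mem_nhds (by linarith : (2:ℝ) < t)] with s hs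
        exact W0_zero (le_of_lt hs)
      rw [this.deriv_eq]; simp
  intro s t hs ht
  have := (convex_Ici (0:ℝ)).norm_image_sub_le_of_norm_deriv_le (f := W0) (fun x _ => hd x) (fun x hx => hbd x hx)
    (show t ∈ Set.Ici (0:ℝ) from ht) (show s ∈ Set.Ici (0:ℝ) from hs)
  simpa [Real.norm_eq_abs] using this

/-- Bounding a finite sum supported on `a ≤ K`. -/
lemma sum_supp_le (f : ℕ → ℝ) (N : ℕ) (K B : ℝ) (hK : 0 ≤ K) (hB : 0 ≤ B)
    (h1 : ∀ a : ℕ, 1 ≤ a → (a:ℝ) ≤ K → |f a| ≤ B) (h2 : ∀ a : ℕ, 1 ≤ a → K < a → f a = 0) :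
    |∑ a ∈ Finset.Icc 1 N, f a| ≤ K * B := by
  have e : ∑ a ∈ (Finset.Icc 1 N).filter (fun a => a ≤ ⌊K⌋₊), f a = ∑ a ∈ Finset.Icc 1 N, f a := by
    refine Finset.sum_subset (Finset.filter_subset _ _) ?_
    intro a ha ha'
    simp only [Finset.mem_filter, not_and, not_le] at ha'
    have := ha' ha
    exact h2 a (Finset.mem_Icc.mp ha).1 ((Nat.floor_lt hK).mp this)
  rw [← e]
  refine (Finset.abs_sum_le_sum_abs _ _).trans ?_
  have : ∀ a ∈ (Finset.Icc 1 N).filter (fun a => a ≤ ⌊K⌋₊), |f a| ≤ B := by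
    intro a ha
    simp only [Finset.mem_filter, Finset.mem_Icc] at ha
    exact h1 a ha.1.1 ((Nat.le_floor_iff hK).mp ha.2)
  refine (Finset.sum_le_card_nsmul _ _ _ this).trans ?_
  rw [nsmul_eq_mul]
  gcongr
  have hsub : (Finset.Icc 1 N).filter (fun a => a ≤ ⌊K⌋₊) ⊆ Finset.Icc 1 ⌊K⌋₊ := by
    intro a ha
    simp only [Finset.mem_filter, Finset.mem_Icc] at ha ⊢
    exact ⟨ha.1.1, ha.2⟩
  have := Finset.card_le_card hsub
  rw [Nat.card_Icc] at this
  calc (((Finset.Icc 1 N).filter (fun a => a ≤ ⌊K⌋₊)).card : ℝ) ≤ (⌊K⌋₊ : ℝ) := by exact_mod_cast (by omega)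
    _ ≤ K := Nat.floor_le hK

lemma telescope_ge (f : ℕ → ℝ) (N a : ℕ) (ha : 1 ≤ a) (haN : a ≤ N + 1) :
    ∑ m ∈ Finset.Icc 1 N, (if a ≤ m then f m - f (m+1) else 0) = f a - f (N+1) := by
  induction N with
  | zero =>
    have : a = 1 := by omega
    simp [this]
  | succ N ih =>
    rw [Finset.sum_Icc_succ_top (by omega)]
    by_cases h : a ≤ N + 1
    · rw [ih h, if_pos h]; ring
    · have : a = N + 2 := by omega
      rw [if_neg h, Finset.sum_eq_zero, this]
      · ring
      · intro m hm
        rw [Finset.mem_Icc] at hm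
        rw [if_neg (by omega)]

lemma telescope_le (f : ℕ → ℝ) (N k : ℕ) :
    ∑ m ∈ Finset.Icc 1 N, (if m ≤ k then f m - f (m+1) else 0) = f 1 - f (min N k + 1) := by
  induction N with
  | zero => simp
  | succ N ih =>
    rw [Finset.sum_Icc_succ_top (by omega), ih]
    by_cases h : N + 1 ≤ k
    · rw [if_pos h, min_eq_left h, min_eq_left (by omega)]; ring
    · rw [if_neg h, min_eq_right (by omega), min_eq_right (by omega)]; ring

/-- Smoothed hyperbola formula for large `x`. -/
lemma Delta_smooth_large : ∃ C : ℝ, 0 < C ∧ ∀ x : ℝ, 64 ≤ x →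
    |DirichletDelta x + 2 * ∑ a ∈ Finset.Icc 1 ⌊x⌋₊, W0 (a / Real.sqrt x) * ps (x / a)| ≤ C := by
  obtain ⟨L, hL1, hL⟩ := W0_lipschitz
  refine ⟨2 * L * 600 + 4 * L, by positivity, ?_⟩
  intro x hx
  set X := Real.sqrt x with hXdef
  have hX8 : 8 ≤ X := by
    rw [hXdef]; apply Real.le_sqrt_of_sq_le; linarith
  have hXX : X * X = x := Real.mul_self_sqrt (by linarith)
  have hXp : 0 < X := by linarith
  set N := ⌊x⌋₊ with hN
  have hNx : x < N + 1 := Nat.lt_floor_add_one x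
  set f : ℕ → ℝ := fun m => W0 (m / X) with hf
  set w : ℕ → ℝ := fun m => f m - f (m+1) with hw
  have f1 : f 1 = 1 := by
    simp only [hf]
    apply W0_one (by positivity)
    rw [div_le_iff₀ hXp]; push_cast; linarith
  have fbig : ∀ m : ℕ, 2 * X ≤ m → f m = 0 := by
    intro m hm
    apply W0_zero
    rwa [le_div_iff₀ hXp]
  have fsmall : ∀ m : ℕ, (m:ℝ) ≤ X / 2 → f m = 1 := by
    intro m hm
    apply W0_one (by positivity)
    rw [div_le_iff₀ hXp]; linarith
  have fN : f (N+1) = 0 := by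
    apply fbig; push_cast; nlinarith
  have hwL : ∀ m, |w m| ≤ L / X := by
    intro m
    refine (hL _ _ (by positivity) (by positivity)).trans (le_of_eq ?_)
    rw [← sub_div, abs_div, abs_of_pos hXp]; push_cast
    rw [show (m:ℝ) - (m+1) = -1 by ring]; simp; ring
  have hw0 : ∀ m : ℕ, (m:ℝ) + 1 ≤ X / 2 → w m = 0 := by
    intro m hm
    simp only [hw]
    rw [fsmall m (by linarith), fsmall (m+1) (by push_cast; linarith)]; ring
  have hw0' : ∀ m : ℕ, 2 * X ≤ (m:ℝ) → w m = 0 := by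
    intro m hm
    simp only [hw]
    rw [fbig m hm, fbig (m+1) (by push_cast; linarith)]; ring
  have hwsum : ∑ m ∈ Finset.Icc 1 N, w m = 1 := by
    have := telescope_ge f N 1 le_rfl (by omega)
    rw [f1, fN, sub_zero] at this
    rw [← this]
    refine Finset.sum_congr rfl fun m hm => ?_
    rw [if_pos (Finset.mem_Icc.mp hm).1]
  -- error terms
  set Er : ℕ → ℝ := fun m => DirichletDelta x + ∑ a ∈ Finset.Icc 1 m, ps (x / a) +
    ∑ b ∈ Finset.Icc 1 (N / m), ps (x / b) with hEr
  have hErb : ∀ m : ℕ, 1 ≤ m → X / 2 < (m:ℝ) + 1 → (m:ℝ) < 2 * X → |Er m| ≤ 600 := by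
    intro m hm h1 h2
    have hm1 : (1:ℝ) ≤ m := by exact_mod_cast hm
    have hmp : (0:ℝ) < m := by linarith
    have hmX : X / 4 ≤ m := by linarith
    have hfl : N / m = ⌊x / m⌋₊ := by rw [Nat.floor_div_natCast]
    have hn1 : ((N/m : ℕ):ℝ) ≤ x / m := by rw [hfl]; exact Nat.floor_le (by positivity)
    have hn2 : x / m < ((N/m : ℕ):ℝ) + 1 := by rw [hfl]; exact Nat.lt_floor_add_one _
    have hq : X / 2 ≤ x / m := by
      rw [le_div_iff₀ hmp, ← hXX]; nlinarith
    have hnX : X / 4 ≤ ((N/m : ℕ):ℝ) := by linarith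
    have hnpos : 1 ≤ N / m := by
      have : (0:ℝ) < ((N/m : ℕ):ℝ) := by linarith
      exact_mod_cast this
    have := hyperbola_ps x m (N / m) hm hnpos (by rwa [le_div_iff₀ hmp] at hn1)
      (by rwa [div_lt_iff₀ hmp] at hn2)
    refine this.trans ?_
    have q : ∀ r : ℝ, X / 4 ≤ r → 4 * x / r^2 ≤ 64 := by
      intro r hr
      have hr0 : 0 < r := by linarith
      rw [div_le_iff₀ (by positivity), ← hXX]
      nlinarith
    linarith [q m hmX, q _ hnX]
  have hsumE : |∑ m ∈ Finset.Icc 1 N, w m * Er m| ≤ (2 * X) * (L / X * 600) := by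
    apply sum_supp_le _ _ _ _ (by positivity) (by positivity)
    · intro m hm hm2
      by_cases hc : (m:ℝ) + 1 ≤ X / 2
      · rw [hw0 m hc]; simp; positivity
      · by_cases hc2 : 2 * X ≤ m
        · rw [hw0' m hc2]; simp; positivity
        · rw [abs_mul]
          exact mul_le_mul (hwL m) (hErb m hm (by linarith) (by linarith)) (abs_nonneg _) (by positivity)
    · intro m hm hm2
      rw [hw0' m hm2.le, zero_mul]
  have hexp : ∑ m ∈ Finset.Icc 1 N, w m * Er m = DirichletDelta x +
      ∑ a ∈ Finset.Icc 1 N, ps (x / a) * f a + ∑ b ∈ Finset.Icc 1 N, ps (x / b) * (1 - f (min N (N / b) + 1)) := by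
    have s1 : ∑ m ∈ Finset.Icc 1 N, w m * DirichletDelta x = DirichletDelta x := by
      rw [← Finset.sum_mul, hwsum, one_mul]
    have s2 : ∑ m ∈ Finset.Icc 1 N, w m * ∑ a ∈ Finset.Icc 1 m, ps (x / a) = ∑ a ∈ Finset.Icc 1 N, ps (x / a) * f a := by
      have : ∀ m ∈ Finset.Icc 1 N, w m * ∑ a ∈ Finset.Icc 1 m, ps (x / a) =
          ∑ a ∈ Finset.Icc 1 N, ps (x / a) * (if a ≤ m then w m else 0) := by
        intro m hm
        rw [Finset.mem_Icc] at hm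
        rw [Finset.mul_sum]
        have e : Finset.Icc 1 m = (Finset.Icc 1 N).filter (fun a => a ≤ m) := by
          ext a; simp only [Finset.mem_filter, Finset.mem_Icc]; omega
        rw [e, Finset.sum_filter]
        refine Finset.sum_congr rfl fun a _ => ?_
        split_ifs <;> ring
      rw [Finset.sum_congr rfl this, Finset.sum_comm]
      refine Finset.sum_congr rfl fun a ha => ?_
      rw [Finset.mem_Icc] at ha
      rw [← Finset.mul_sum, telescope_ge f N a ha.1 (by omega), fN, sub_zero]
    have s3 : ∑ m ∈ Finset.Icc 1 N, w m * ∑ b ∈ Finset.Icc 1 (N / m), ps (x / b) =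
        ∑ b ∈ Finset.Icc 1 N, ps (x / b) * (1 - f (min N (N / b) + 1)) := by
      have : ∀ m ∈ Finset.Icc 1 N, w m * ∑ b ∈ Finset.Icc 1 (N / m), ps (x / b) =
          ∑ b ∈ Finset.Icc 1 N, ps (x / b) * (if m ≤ N / b then w m else 0) := by
        intro m hm
        rw [Finset.mem_Icc] at hm
        rw [Finset.mul_sum]
        have e : Finset.Icc 1 (N / m) = (Finset.Icc 1 N).filter (fun b => m ≤ N / b) := by
          ext b; simp only [Finset.mem_filter, Finset.mem_Icc]
          constructor
          · rintro ⟨hb, hb2⟩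
            have : b ≤ N := hb2.trans (Nat.div_le_self _ _)
            refine ⟨⟨hb, this⟩, ?_⟩
            rw [Nat.le_div_iff_mul_le (by omega)] at hb2 ⊢
            linarith
          · rintro ⟨⟨hb, hb1⟩, hb2⟩
            refine ⟨hb, ?_⟩
            rw [Nat.le_div_iff_mul_le (by omega)] at hb2 ⊢
            linarith
        rw [e, Finset.sum_filter]
        refine Finset.sum_congr rfl fun a _ => ?_
        split_ifs <;> ring
      rw [Finset.sum_congr rfl this, Finset.sum_comm]
      refine Finset.sum_congr rfl fun b hb => ?_
      rw [← Finset.mul_sum, telescope_le f N (N / b), f1]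
    simp only [hEr, mul_add, Finset.sum_add_distrib]
    rw [s1, s2, s3]
  have hdiff : |∑ b ∈ Finset.Icc 1 N, ps (x / b) * ((1 - f (min N (N / b) + 1)) - f b)| ≤ (4 * X) * (L / X) := by
    apply sum_supp_le _ _ _ _ (by positivity) (by positivity)
    · intro b hb _
      have hb1 : (1:ℝ) ≤ b := by exact_mod_cast hb
      have hbp : (0:ℝ) < b := by linarith
      rw [min_eq_right (Nat.div_le_self _ _), abs_mul]
      have h1 : (1 - f (N / b + 1)) - f b = W0 (X / b) - W0 (((N / b + 1 : ℕ) : ℝ) / X) := by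
        have := W0_inv (t := b / X) (by positivity)
        rw [inv_div] at this
        simp only [hf]; linarith
      have h2 : |X / b - ((N / b + 1 : ℕ) : ℝ) / X| ≤ 1 / X := by
        have hfl : N / b = ⌊x / b⌋₊ := by rw [Nat.floor_div_natCast]
        have hn1 : ((N/b : ℕ):ℝ) ≤ x / b := by rw [hfl]; exact Nat.floor_le (by positivity)
        have hn2 : x / b < ((N/b : ℕ):ℝ) + 1 := by rw [hfl]; exact Nat.lt_floor_add_one _
        have e : X / b - ((N / b + 1 : ℕ) : ℝ) / X = (x / b - (((N / b : ℕ) : ℝ) + 1)) / X := by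
          rw [← hXX]; push_cast; field_simp
        rw [e, abs_div, abs_of_pos hXp]
        gcongr
        rw [abs_le]; constructor <;> linarith
      rw [h1]
      calc |ps (x / b)| * |W0 (X / b) - W0 (((N / b + 1 : ℕ) : ℝ) / X)| ≤ 1 * (L * (1 / X)) := by
            gcongr
            · exact abs_ps_le _
            · exact (hL _ _ (by positivity) (by positivity)).trans (by gcongr)
        _ = L / X := by ring
    · intro b hb hb2
      have hb1 : (1:ℝ) ≤ b := by exact_mod_cast hb
      have hbp : (0:ℝ) < b := by linarith
      rw [min_eq_right (Nat.div_le_self _ _)]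
      rw [fbig b (by linarith), fsmall]
      · ring
      · have hfl : N / b = ⌊x / b⌋₊ := by rw [Nat.floor_div_natCast]
        have hn1 : ((N/b : ℕ):ℝ) ≤ x / b := by rw [hfl]; exact Nat.floor_le (by positivity)
        have : x / b ≤ X / 4 := by rw [div_le_iff₀ hbp, ← hXX]; nlinarith
        push_cast; linarith
  have hfin : DirichletDelta x + 2 * ∑ a ∈ Finset.Icc 1 N, W0 (a / X) * ps (x / a) =
      ∑ m ∈ Finset.Icc 1 N, w m * Er m - ∑ b ∈ Finset.Icc 1 N, ps (x / b) * ((1 - f (min N (N / b) + 1)) - f b) := by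
    rw [hexp]
    have : ∑ a ∈ Finset.Icc 1 N, W0 (a / X) * ps (x / a) = ∑ a ∈ Finset.Icc 1 N, ps (x / a) * f a :=
      Finset.sum_congr rfl fun a _ => by simp only [hf]; ring
    rw [this]
    simp only [mul_sub, Finset.sum_sub_distrib]
    ring
  rw [hfin]
  refine (abs_sub _ _).trans ?_
  have e1 : (2 * X) * (L / X * 600) = 2 * L * 600 := by field_simp
  have e2 : (4 * X) * (L / X) = 4 * L := by field_simp
  linarith

end DivM


namespace DivM

/-- Independence of the truncation for sums with the weight `W0 (a/√x)`. -/
lemma wsum_indep (g : ℕ → ℝ) (x : ℝ) (hx : 0 < x) (N N' : ℕ) (hN : 2 * Real.sqrt x ≤ N + 1) (hN' : 2 * Real.sqrt x ≤ N' + 1) :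
    ∑ a ∈ Finset.Icc 1 N, W0 (a / Real.sqrt x) * g a = ∑ a ∈ Finset.Icc 1 N', W0 (a / Real.sqrt x) * g a := by
  have key : ∀ N N' : ℕ, N ≤ N' → 2 * Real.sqrt x ≤ N + 1 →
      ∑ a ∈ Finset.Icc 1 N, W0 (a / Real.sqrt x) * g a = ∑ a ∈ Finset.Icc 1 N', W0 (a / Real.sqrt x) * g a := by
    intro N N' h hN
    refine Finset.sum_subset (Finset.Icc_subset_Icc_right h) ?_
    intro a ha ha'
    simp only [Finset.mem_Icc, not_and, not_le] at ha ha'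
    have h1 : N + 1 ≤ a := ha' ha.1
    have h2 : (N:ℝ) + 1 ≤ a := by exact_mod_cast h1
    rw [W0_zero, zero_mul]
    rw [le_div_iff₀ (Real.sqrt_pos.mpr hx)]; linarith
  rcases le_total N N' with h | h
  · exact key _ _ h hN
  · exact (key _ _ h hN').symm

lemma Delta_bdd_small : ∃ C : ℝ, 0 < C ∧ ∀ x : ℝ, 1 ≤ x → x ≤ 64 → |DirichletDelta x| ≤ C := by
  refine ⟨∑ n ∈ Finset.Icc 1 64, (divfun n : ℝ) + 64 * 64 + |2 * Real.eulerMascheroniConstant - 1| * 64, by positivity, ?_⟩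
  intro x h1 h2
  unfold DirichletDelta
  have a1 : |∑ n ∈ Finset.Icc 1 ⌊x⌋₊, (divfun n : ℝ)| ≤ ∑ n ∈ Finset.Icc 1 64, (divfun n : ℝ) := by
    rw [abs_of_nonneg (by positivity)]
    refine Finset.sum_le_sum_of_subset_of_nonneg (Finset.Icc_subset_Icc_right ?_) (fun _ _ _ => by positivity)
    exact Nat.floor_le_of_le (by exact_mod_cast h2)
  have a2 : |x * Real.log x| ≤ 64 * 64 := by
    have := Real.log_nonneg h1
    have h' := Real.log_le_sub_one_of_pos (by linarith : 0 < x)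
    rw [abs_mul, abs_of_pos (by linarith), abs_of_nonneg this]
    nlinarith
  have a3 : |(2 * Real.eulerMascheroniConstant - 1) * x| ≤ |2 * Real.eulerMascheroniConstant - 1| * 64 := by
    rw [abs_mul, abs_of_pos (by linarith : 0 < x)]; gcongr
  refine (abs_sub _ _).trans ?_
  refine (add_le_add_left (abs_sub _ _) _).trans ?_
  linarith

lemma Delta_smooth : ∃ C : ℝ, 0 < C ∧ ∀ x : ℝ, 1 ≤ x → ∀ N : ℕ, 2 * Real.sqrt x ≤ N →
    |DirichletDelta x + 2 * ∑ a ∈ Finset.Icc 1 N, W0 (a / Real.sqrt x) * ps (x / a)| ≤ C := by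
  obtain ⟨C1, hC1, h1⟩ := Delta_smooth_large
  obtain ⟨C2, hC2, h2⟩ := Delta_bdd_small
  refine ⟨C1 + C2 + 32, by positivity, ?_⟩
  intro x hx N hN
  rcases le_total 64 x with h | h
  · have h8 : 8 ≤ Real.sqrt x := by apply Real.le_sqrt_of_sq_le; linarith
    rw [wsum_indep _ x (by linarith) N ⌊x⌋₊ (by linarith)]
    · linarith [h1 x h]
    · have := Nat.lt_floor_add_one x
      have := Real.mul_self_sqrt (by linarith : 0 ≤ x)
      nlinarith
  · have h8 : Real.sqrt x ≤ 8 := by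
      rw [Real.sqrt_le_left (by norm_num)]; linarith
    have hs : |∑ a ∈ Finset.Icc 1 N, W0 (a / Real.sqrt x) * ps (x / a)| ≤ 16 * 1 := by
      apply sum_supp_le _ _ _ _ (by norm_num) (by norm_num)
      · intro a _ _
        rw [abs_mul, abs_of_nonneg (W0_nonneg _)]
        exact mul_le_one₀ (W0_le_one _) (abs_nonneg _) (abs_ps_le _)
      · intro a _ ha
        rw [W0_zero, zero_mul]
        rw [le_div_iff₀ (Real.sqrt_pos.mpr (by linarith))]; linarith
    refine (abs_add_le _ _).trans ?_
    rw [abs_mul, abs_two]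
    linarith [h2 x hx h]

/-- Antiderivative of the sawtooth. -/
noncomputable def Ps (t : ℝ) : ℝ := (Int.fract t ^ 2 - Int.fract t + 1 / 6) / 2

lemma abs_Ps_le (t : ℝ) : |Ps t| ≤ 1 := by
  unfold Ps
  have := Int.fract_nonneg t
  have := Int.fract_lt_one t
  rw [abs_le]; constructor <;> nlinarith

lemma continuous_Ps : Continuous Ps := by
  have := ContinuousOn.comp_fract'' (f := fun u : ℝ => (u ^ 2 - u + 1 / 6) / 2) (by fun_prop) (by norm_num)
  exact this

lemma hasDerivAt_Ps {t : ℝ} (ht : t ∉ Set.range (Int.cast : ℤ → ℝ)) : HasDerivAt Ps (ps t) t := by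
  have hlt : (⌊t⌋ : ℝ) < t := lt_of_le_of_ne (Int.floor_le t) (fun h => ht ⟨_, h⟩)
  have hev : Ps =ᶠ[nhds t] fun s => ((s - ⌊t⌋) ^ 2 - (s - ⌊t⌋) + 1 / 6) / 2 := by
    filter_upwards [Ioo_mem_nhds hlt (Int.lt_floor_add_one t)] with s hs
    have : ⌊s⌋ = ⌊t⌋ := Int.floor_eq_iff.mpr ⟨hs.1.le, hs.2⟩
    unfold Ps
    rw [← Int.self_sub_floor, this]
  refine HasDerivAt.congr_of_eventuallyEq ?_ hev
  have h1 : HasDerivAt (fun s : ℝ => s - ⌊t⌋) 1 t := (hasDerivAt_id t).sub_const _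
  refine ((((h1.fun_pow 2).sub h1).add_const (1/6)).div_const 2).congr_deriv ?_
  unfold ps
  rw [← Int.self_sub_floor]
  push_cast; ring

lemma measurable_ps : Measurable ps := (measurable_fract).sub_const _

lemma ps_intervalIntegrable (a : ℝ) (x y : ℝ) : IntervalIntegrable (fun u => ps (u / a)) volume x y := by
  refine IntervalIntegrable.mono_fun' (g := fun _ => (1:ℝ)) intervalIntegrable_const ?_ ?_
  · exact (measurable_ps.comp (measurable_id.div_const a)).aestronglyMeasurable
  · exact Filter.Eventually.of_forall fun u => abs_ps_le _

lemma integral_ps (a : ℝ) (ha : 0 < a) (x y : ℝ) :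
    ∫ u in x..y, ps (u / a) = a * Ps (y / a) - a * Ps (x / a) := by
  refine MeasureTheory.integral_eq_of_hasDerivAt_off_countable (fun u => a * Ps (u / a)) _
    (s := Set.range (fun n : ℤ => (n:ℝ) * a)) (Set.countable_range _) ?_ ?_ (ps_intervalIntegrable a x y)
  · exact (continuous_const.mul (continuous_Ps.comp (continuous_id.div_const a))).continuousOn
  · intro u hu
    have h : u / a ∉ Set.range (Int.cast : ℤ → ℝ) := by
      rintro ⟨n, hn⟩
      exact hu.2 ⟨n, by simp only; rw [hn]; field_simp⟩
    have h1 := (hasDerivAt_Ps h).comp u ((hasDerivAt_id u).div_const a)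
    refine (h1.const_mul a).congr_deriv ?_
    field_simp

/-- The weighted sum. -/
noncomputable def GG (x : ℝ) : ℝ := ∑ a ∈ Finset.Icc 1 ⌈2 * Real.sqrt x⌉₊, W0 (a / Real.sqrt x) * (a * Ps (x / a))

lemma GG_eq (x : ℝ) (hx : 0 < x) (N : ℕ) (hN : 2 * Real.sqrt x ≤ N) :
    GG x = ∑ a ∈ Finset.Icc 1 N, W0 (a / Real.sqrt x) * (a * Ps (x / a)) := by
  unfold GG
  refine wsum_indep (fun a => a * Ps (x / a)) x hx _ _ ?_ (by linarith)
  linarith [Nat.le_ceil (2 * Real.sqrt x)]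

lemma weight_shift {L : ℝ} (hL1 : 1 ≤ L)
    (hL : ∀ s t : ℝ, 0 ≤ s → 0 ≤ t → |W0 s - W0 t| ≤ L * |s - t|) (x u : ℝ) (hx : 1 ≤ x) (hxu : x ≤ u)
    (a : ℕ) (ha2 : (a:ℝ) ≤ 2 * Real.sqrt u) : |W0 (a / Real.sqrt u) - W0 (a / Real.sqrt x)| ≤ L * (u - x) / x := by
  have hsx : 1 ≤ Real.sqrt x := by apply Real.le_sqrt_of_sq_le; linarith
  have hsu : Real.sqrt x ≤ Real.sqrt u := Real.sqrt_le_sqrt hxu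
  have hx2 := Real.mul_self_sqrt (by linarith : 0 ≤ x)
  have hu2 := Real.mul_self_sqrt (by linarith : 0 ≤ u)
  set X := Real.sqrt x
  set V := Real.sqrt u
  have hX : 0 < X := by linarith
  have hV : 0 < V := by linarith
  refine (hL _ _ (by positivity) (by positivity)).trans ?_
  have e : (a:ℝ) / V - a / X = - ((a / V) * ((V - X) / X)) := by field_simp; ring
  rw [e, abs_neg, abs_of_nonneg (mul_nonneg (by positivity) (div_nonneg (by linarith) hX.le))]
  rw [mul_div_assoc]
  gcongr
  have h1 : (a:ℝ) / V ≤ 2 := by rw [div_le_iff₀ hV]; exact ha2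
  have h2 : 0 ≤ (V - X) / X := div_nonneg (by linarith) hX.le
  calc (a:ℝ)/V * ((V - X)/X) ≤ 2 * ((V - X)/X) := by gcongr
    _ = (2 * X * (V - X)) / (X * X) := by field_simp
    _ ≤ ((V + X) * (V - X)) / (X * X) := by gcongr; linarith
    _ = (u - x) / x := by rw [← hx2, ← hu2]; ring

lemma Delta_intervalIntegrable (x y : ℝ) (hx : 0 < x) (hy : 0 < y) : IntervalIntegrable DirichletDelta volume x y := by
  unfold DirichletDelta
  refine IntervalIntegrable.sub (IntervalIntegrable.sub ?_ ?_) ?_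
  · apply MonotoneOn.intervalIntegrable
    intro a _ b _ hab
    exact Finset.sum_le_sum_of_subset_of_nonneg (Finset.Icc_subset_Icc_right (Nat.floor_mono hab)) (fun _ _ _ => by positivity)
  · refine ContinuousOn.intervalIntegrable ?_
    refine continuousOn_id.mul (Real.continuousOn_log.mono ?_)
    intro t ht
    have : 0 < t := lt_of_lt_of_le (lt_min hx hy) ht.1
    exact this.ne'
  · exact (by fun_prop : Continuous fun x : ℝ => (2 * Real.eulerMascheroniConstant - 1) * x).intervalIntegrable _ _

/-- The window integral of `Δ` in terms of `GG`. -/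
lemma Delta_window : ∃ C : ℝ, 0 < C ∧ ∀ x H : ℝ, 1 ≤ x → 0 < H → H ≤ Real.sqrt x →
    |(∫ u in x..(x + H), DirichletDelta u) + 2 * (GG (x + H) - GG x)| ≤ C * H := by
  obtain ⟨L, hL1, hL⟩ := W0_lipschitz
  obtain ⟨C0, hC0, hD⟩ := Delta_smooth
  refine ⟨C0 + 2 * (4 * L) + 2 * (16 * L), by positivity, ?_⟩
  intro x H hx hH hHx
  have hsx : 1 ≤ Real.sqrt x := by apply Real.le_sqrt_of_sq_le; linarith
  have hx2 := Real.mul_self_sqrt (by linarith : 0 ≤ x)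
  have hsxx : Real.sqrt x ≤ x := by nlinarith
  have hroot : ∀ u, x ≤ u → u ≤ x + H → Real.sqrt u ≤ 2 * Real.sqrt x := by
    intro u h1 h2
    rw [Real.sqrt_le_left (by positivity)]
    nlinarith
  set X := Real.sqrt x with hX
  set N := ⌈4 * X⌉₊ with hN
  have hN4 : 4 * X ≤ N := Nat.le_ceil _
  set F : ℝ → ℝ := fun u => ∑ a ∈ Finset.Icc 1 N, W0 (a / X) * ps (u / a) with hF
  have hFint : IntervalIntegrable F volume x (x + H) := by
    have : F = ∑ a ∈ Finset.Icc 1 N, fun u => W0 (a / X) * ps (u / a) := by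
      ext u; simp [hF]
    rw [this]
    exact IntervalIntegrable.sum _ fun a _ => (ps_intervalIntegrable a _ _).const_mul _
  have hpt : ∀ u, x ≤ u → u ≤ x + H → |DirichletDelta u + 2 * F u| ≤ C0 + 2 * (4 * L) := by
    intro u h1 h2
    have hr := hroot u h1 h2
    have hsu : 0 < Real.sqrt u := Real.sqrt_pos.mpr (by linarith)
    have hxu : X ≤ Real.sqrt u := Real.sqrt_le_sqrt h1
    have hd := hD u (by linarith) N (by linarith)
    have hs : |∑ a ∈ Finset.Icc 1 N, (W0 (a / Real.sqrt u) - W0 (a / X)) * ps (u / a)| ≤ (4 * X) * (L * (u - x) / x) := by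
      apply sum_supp_le _ _ _ _ (by positivity) (div_nonneg (mul_nonneg (by linarith) (by linarith)) (by linarith))
      · intro a ha _
        rw [abs_mul]
        by_cases h : (a:ℝ) ≤ 2 * Real.sqrt u
        · calc _ ≤ (L * (u - x) / x) * 1 := mul_le_mul (weight_shift hL1 hL x u hx h1 a h) (abs_ps_le _) (abs_nonneg _)
                (div_nonneg (mul_nonneg (by linarith) (by linarith)) (by linarith))
            _ = _ := mul_one _
        · rw [W0_zero, W0_zero]
          · simp; exact div_nonneg (mul_nonneg (by linarith) (by linarith)) (by linarith)
          · rw [le_div_iff₀ (by linarith)]; linarith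
          · rw [le_div_iff₀ hsu]; linarith
      · intro a ha h
        rw [W0_zero, W0_zero]
        · simp
        · rw [le_div_iff₀ (by linarith)]; linarith
        · rw [le_div_iff₀ hsu]; linarith
    have hs2 : (4 * X) * (L * (u - x) / x) ≤ 4 * L := by
      rw [← mul_div_assoc, div_le_iff₀ (by linarith)]
      have : u - x ≤ X := by linarith
      calc 4 * X * (L * (u - x)) ≤ 4 * X * (L * X) := by gcongr
        _ = 4 * L * (X * X) := by ring
        _ = 4 * L * x := by rw [hx2]
    have e : DirichletDelta u + 2 * F u = (DirichletDelta u + 2 * ∑ a ∈ Finset.Icc 1 N, W0 (a / Real.sqrt u) * ps (u / a))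
        - 2 * ∑ a ∈ Finset.Icc 1 N, (W0 (a / Real.sqrt u) - W0 (a / X)) * ps (u / a) := by
      simp only [hF, sub_mul, Finset.sum_sub_distrib]; ring
    rw [e]
    refine (abs_sub _ _).trans ?_
    rw [abs_mul, abs_two]
    linarith
  have hI : |∫ u in x..(x+H), (DirichletDelta u + 2 * F u)| ≤ (C0 + 2 * (4 * L)) * H := by
    have := intervalIntegral.norm_integral_le_of_norm_le_const (a := x) (b := x + H) (C := C0 + 2 * (4 * L))
      (f := fun u => DirichletDelta u + 2 * F u) (by
        intro u hu
        rw [Set.uIoc_of_le (by linarith)] at hu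
        exact hpt u hu.1.le hu.2)
    rw [show x + H - x = H by ring, abs_of_pos hH] at this
    exact this
  rw [intervalIntegral.integral_add (Delta_intervalIntegrable _ _ (by linarith) (by linarith)) (hFint.const_mul 2),
    intervalIntegral.integral_const_mul] at hI
  have hFI : ∫ u in x..(x+H), F u = ∑ a ∈ Finset.Icc 1 N, W0 (a / X) * (a * Ps ((x+H) / a)) - GG x := by
    rw [GG_eq x (by linarith) N (by linarith)]
    simp only [hF]
    rw [intervalIntegral.integral_finsetSum (fun (a:ℕ) _ => (ps_intervalIntegrable (a:ℝ) _ _).const_mul _), ← Finset.sum_sub_distrib]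
    refine Finset.sum_congr rfl fun a ha => ?_
    rw [Finset.mem_Icc] at ha
    rw [intervalIntegral.integral_const_mul, integral_ps a (by exact_mod_cast ha.1)]
    ring
  set u := x + H with hu
  have hr := hroot u (by linarith) le_rfl
  have hsu : 0 < Real.sqrt u := Real.sqrt_pos.mpr (by linarith)
  have hxu : X ≤ Real.sqrt u := Real.sqrt_le_sqrt (by linarith)
  have hs : |∑ a ∈ Finset.Icc 1 N, (W0 (a / Real.sqrt u) - W0 (a / X)) * (a * Ps (u / a))| ≤ (4 * X) * (L * (u - x) / x * (4 * X)) := by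
    have hnn : 0 ≤ L * (u - x) / x := div_nonneg (mul_nonneg (by linarith) (by linarith)) (by linarith)
    apply sum_supp_le _ _ _ _ (by positivity) (mul_nonneg hnn (by positivity))
    · intro a ha ha2
      rw [abs_mul]
      by_cases h : (a:ℝ) ≤ 2 * Real.sqrt u
      · refine mul_le_mul (weight_shift hL1 hL x u hx (by linarith) a h) ?_ (abs_nonneg _) hnn
        rw [abs_mul, abs_of_nonneg (by positivity : (0:ℝ) ≤ a)]
        calc (a:ℝ) * |Ps (u / a)| ≤ (4 * X) * 1 := mul_le_mul ha2 (abs_Ps_le _) (abs_nonneg _) (by positivity)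
          _ = _ := mul_one _
      · rw [W0_zero, W0_zero]
        · simp; exact mul_nonneg hnn (by positivity)
        · rw [le_div_iff₀ (by linarith)]; linarith
        · rw [le_div_iff₀ hsu]; linarith
    · intro a ha h
      rw [W0_zero, W0_zero]
      · simp
      · rw [le_div_iff₀ (by linarith)]; linarith
      · rw [le_div_iff₀ hsu]; linarith
  have hs2 : (4 * X) * (L * (u - x) / x * (4 * X)) = 16 * L * H := by
    rw [← hx2, hu, ← hx2]; field_simp; ring
  have e : (∫ u in x..(x + H), DirichletDelta u) + 2 * (GG u - GG x) =
      ((∫ u in x..(x + H), DirichletDelta u) + 2 * ∫ u in x..(x + H), F u) +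
      2 * ∑ a ∈ Finset.Icc 1 N, (W0 (a / Real.sqrt u) - W0 (a / X)) * (a * Ps (u / a)) := by
    rw [← hu, hFI, GG_eq u (by linarith) N (by linarith)]
    simp only [sub_mul, Finset.sum_sub_distrib]; ring
  rw [e]
  refine (abs_add_le _ _).trans ?_
  rw [abs_mul, abs_two]
  rw [hs2] at hs
  linarith

end DivM


namespace DivM
open scoped ContDiff

lemma arctan_step {q : ℝ} (hq : 0 < q) (n : ℕ) :
    1 / (1 + (((n:ℝ) + 1) / q) ^ 2) ≤ q * (Real.arctan (((n:ℝ)+1)/q) - Real.arctan ((n:ℝ)/q)) := by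
  have hlt : (n:ℝ)/q < ((n:ℝ)+1)/q := by gcongr; linarith
  obtain ⟨c, hc, hc'⟩ := exists_hasDerivAt_eq_slope Real.arctan (fun t => 1 / (1 + t^2)) hlt
    Real.continuous_arctan.continuousOn (fun t _ => Real.hasDerivAt_arctan t)
  have hd : ((n:ℝ)+1)/q - (n:ℝ)/q = 1/q := by ring
  rw [hd] at hc'
  have hc0 : 0 ≤ c := le_trans (by positivity) hc.1.le
  have : q * (Real.arctan (((n:ℝ)+1)/q) - Real.arctan ((n:ℝ)/q)) = 1 / (1 + c^2) := by
    rw [hc']; field_simp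
  rw [this]
  have := hc.2.le
  gcongr

lemma sum_lorentz : ∀ q : ℝ, 1 ≤ q → Summable (fun k : ℤ => 1 / (1 + ((k:ℝ) / q) ^ 2)) ∧
    ∑' k : ℤ, 1 / (1 + ((k:ℝ) / q) ^ 2) ≤ 9 * q := by
  intro q hq
  have hq0 : 0 < q := by linarith
  set f : ℤ → ℝ := fun k => 1 / (1 + ((k:ℝ) / q) ^ 2) with hf
  have hb : ∀ n : ℕ, ∑ i ∈ Finset.range n, f ((i:ℤ) + 1) ≤ 4 * q := by
    intro n
    have h1 : ∑ i ∈ Finset.range n, f ((i:ℤ) + 1) ≤ ∑ i ∈ Finset.range n,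
        (q * Real.arctan (((i+1 : ℕ):ℝ)/q) - q * Real.arctan ((i:ℝ)/q)) := by
      refine Finset.sum_le_sum fun i _ => ?_
      have := arctan_step hq0 i
      simp only [hf]; push_cast
      linarith
    rw [Finset.sum_range_sub (fun i : ℕ => q * Real.arctan ((i:ℝ)/q))] at h1
    have h2 : Real.arctan ((n:ℝ)/q) ≤ 4 := by
      have := Real.arctan_lt_pi_div_two ((n:ℝ)/q)
      linarith [Real.pi_le_four]
    simp only [Nat.cast_zero, zero_div, Real.arctan_zero, mul_zero, sub_zero] at h1
    nlinarith
  have hs1 : Summable (fun n : ℕ => f ((n:ℤ) + 1)) := summable_of_sum_range_le (fun n => by simp only [hf]; positivity) hb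
  have ht1 : ∑' n : ℕ, f ((n:ℤ) + 1) ≤ 4 * q := hs1.tsum_le_of_sum_range_le hb
  have hneg : (fun n : ℕ => f (-((n:ℤ) + 1))) = fun n : ℕ => f ((n:ℤ) + 1) := by
    ext n; simp only [hf]; push_cast
    rw [show (-((n:ℝ)+1))/q = -(((n:ℝ)+1)/q) by ring, neg_sq]
  have hs2 : HasSum (fun n : ℕ => f (-((n:ℤ) + 1))) (∑' n : ℕ, f ((n:ℤ) + 1)) := by rw [hneg]; exact hs1.hasSum
  have hall := HasSum.of_add_one_of_neg_add_one hs1.hasSum hs2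
  refine ⟨hall.summable, ?_⟩
  rw [hall.tsum_eq]
  have : f 0 = 1 := by simp [hf]
  rw [this]; linarith

/-- Poisson summation for one dyadic block. -/
lemma block_poisson (b U : ℝ) (hU : 0 < U) :
    ∑' a : ℤ, ((chi (a / U) * a : ℝ) : ℂ) * e (b / a) = ∑' k : ℤ, ((U ^ 2 : ℝ) : ℂ) * II (b / U) (k * U) := by
  have hsm : ContDiff ℝ ∞ (fun t : ℝ => ((chi t * t : ℝ) : ℂ) * e ((b / U) / t)) := by
    refine smooth_cut (f := fun t => chi t * t) (h := fun t => e ((b/U)/t)) (c := 1/4) (chi_contDiff.mul contDiff_id) (by norm_num) ?_ ?_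
    · intro t ht; rw [chi_zero_left ht, zero_mul]
    · intro t ht
      exact contDiffAt_e_comp (contDiffAt_const.div contDiffAt_id ht.ne')
  have hp := poisson_scaled hsm (a := 0) (b := 2) (by
    intro t ht
    simp only [Set.mem_Icc, not_and_or, not_le] at ht
    have : chi t = 0 := by
      rcases ht with h | h
      · exact chi_zero_left (by linarith)
      · exact chi_zero_right (by linarith)
    rw [this]; simp) hU
  have e1 : ∀ a : ℤ, ((chi (a / U) * a : ℝ) : ℂ) * e (b / a) =
      (U:ℂ) * (((chi (a/U) * (a/U) : ℝ) : ℂ) * e ((b / U) / (a / U))) := by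
    intro a
    rw [div_div_div_cancel_right₀ hU.ne']
    push_cast
    have : (U:ℂ) ≠ 0 := by exact_mod_cast hU.ne'
    field_simp
  rw [tsum_congr e1, tsum_mul_left, hp, ← tsum_mul_left]
  refine tsum_congr fun k => ?_
  unfold II
  push_cast
  rw [← mul_assoc, ← sq]
  congr 1
  refine integral_congr_ae (Filter.Eventually.of_forall fun t => ?_)
  simp only
  rw [e_add]; ring

lemma mainII_support {α U : ℝ} (hα : 0 < α) (hU : 0 < U) {k : ℤ} (h : mainII α (k * U) ≠ 0) :
    0 < k ∧ k ≤ ⌈16 * α / U⌉ := by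
  unfold mainII at h
  by_cases hk : 0 < (k:ℝ) * U
  · have hk0 : (0:ℝ) < k := pos_of_mul_pos_left hk hU.le
    refine ⟨by exact_mod_cast hk0, ?_⟩
    rw [if_pos hk] at h
    have hc : chi (Real.sqrt (α / (k * U))) ≠ 0 := by
      intro h0; apply h; rw [h0]; simp
    have h2 : 1/4 < Real.sqrt (α / (k * U)) := by
      by_contra h3
      exact hc (chi_zero_left (not_lt.mp h3))
    rw [Real.lt_sqrt (by norm_num), lt_div_iff₀ hk] at h2
    have h4 : (k:ℝ) ≤ 16 * α / U := by
      rw [le_div_iff₀ hU]; linarith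
    exact_mod_cast h4.trans (Int.le_ceil _)
  · rw [if_neg hk] at h; exact absurd rfl h

lemma mainII_summable {α U : ℝ} (hα : 0 < α) (hU : 0 < U) : Summable (fun k : ℤ => mainII α (k * U)) := by
  refine summable_of_hasFiniteSupport ((Set.finite_Icc (0:ℤ) ⌈16 * α / U⌉).subset ?_)
  intro k hk
  have := mainII_support hα hU hk
  exact ⟨this.1.le, this.2⟩

/-- Amplitude-phase of the main term. -/
noncomputable def cc (x : ℝ) (h k : ℕ+) : ℂ :=
  (((h:ℝ) ^ 2 * ((2:ℝ) ^ (-(1/2):ℝ) * x ^ ((3/4):ℝ) * ((h:ℝ) * k) ^ (-(5/4):ℝ)) : ℝ) : ℂ) *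
    e (2 * Real.sqrt ((h:ℝ) * k * x) + 1/8)

lemma amp_eq {x h k : ℝ} (hx : 0 < x) (hh : 0 < h) (hk : 0 < k) :
    x * (h / k) * (2 * Real.sqrt (h * k * x)) ^ (-(1/2):ℝ) =
      h ^ 2 * ((2:ℝ) ^ (-(1/2):ℝ) * x ^ ((3/4):ℝ) * (h * k) ^ (-(5/4):ℝ)) := by
  rw [Real.sqrt_eq_rpow, Real.mul_rpow (by norm_num) (by positivity), ← Real.rpow_mul (by positivity),
    Real.mul_rpow (by positivity) hx.le]
  have e1 : x = x ^ ((3/4):ℝ) * x ^ ((1/4):ℝ) := by rw [← Real.rpow_add hx]; norm_num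
  have e2 : x ^ ((1/4):ℝ) * x ^ ((1/2) * (-(1/2)):ℝ) = 1 := by rw [← Real.rpow_add hx]; norm_num
  have e3 : (h * k) ^ (-(5/4):ℝ) = (h*k)⁻¹ * (h * k) ^ ((1/2) * (-(1/2)):ℝ) := by
    rw [← Real.rpow_neg_one, ← Real.rpow_add (by positivity)]; norm_num
  have e4 : h ^ 2 * (h * k)⁻¹ = h / k := by field_simp
  rw [e3]
  calc _ = (x ^ ((3/4):ℝ) * x ^ ((1/4):ℝ)) * (h / k) * (2 ^ (-(1/2):ℝ) * ((h * k) ^ ((1/2) * (-(1/2)):ℝ) * x ^ ((1/2) * (-(1/2)):ℝ))) := by rw [← e1]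
    _ = (h/k) * (2 ^ (-(1/2):ℝ) * x ^ ((3/4):ℝ) * (h * k) ^ ((1/2) * (-(1/2)):ℝ)) * (x ^ ((1/4):ℝ) * x ^ ((1/2) * (-(1/2)):ℝ)) := by ring
    _ = _ := by rw [e2, ← e4]; ring

/-- The asymptotics for one frequency and one dyadic block. -/
lemma block_asymp : ∃ C : ℝ, 0 < C ∧ ∀ x : ℝ, 1 ≤ x → ∀ h : ℕ+, ∀ j : ℕ, ∀ N : ℕ, 2 * Real.sqrt x ≤ N →
    ‖∑ a ∈ Finset.Icc 1 N, ((chi (2 ^ j * (a / Real.sqrt x)) * a : ℝ) : ℂ) * e (h * x / a) -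
      ∑' k : ℕ+, ((chi (2 ^ j * Real.sqrt ((h:ℝ) / k)) : ℝ) : ℂ) * cc x h k‖ ≤
      C * (x ^ ((1/4):ℝ) * (h:ℝ) ^ (-(1/2):ℝ) * (1/2) ^ j) ∧
    Summable (fun k : ℕ+ => ((chi (2 ^ j * Real.sqrt ((h:ℝ) / k)) : ℝ) : ℂ) * cc x h k) := by
  obtain ⟨C, hC, hII⟩ := II_asymp
  refine ⟨9 * C, by positivity, ?_⟩
  intro x hx h j N hN
  have hh : (1:ℝ) ≤ h := by exact_mod_cast one_le
  have hh0 : (0:ℝ) < h := by linarith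
  have hx0 : 0 < x := by linarith
  have hXX := Real.mul_self_sqrt hx0.le
  have hX1 : 1 ≤ Real.sqrt x := by apply Real.le_sqrt_of_sq_le; linarith
  set X := Real.sqrt x with hX
  have hX0 : 0 < X := by linarith
  have hp0 : (0:ℝ) < 2 ^ j := by positivity
  have hp1 : (1:ℝ) ≤ 2 ^ j := one_le_pow₀ (by norm_num)
  set U := X / 2 ^ j with hU
  have hU0 : 0 < U := by positivity
  set α := (h:ℝ) * x / U with hα
  have hα2 : α = h * X * 2 ^ j := by rw [hα, hU, ← hXX]; field_simp
  have hα1 : 1 ≤ α := by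
    rw [hα2]; exact one_le_mul_of_one_le_of_one_le (one_le_mul_of_one_le_of_one_le hh hX1) hp1
  have hα0 : 0 < α := by linarith
  -- the finite sum as a sum over ℤ
  have hfin : ∑ a ∈ Finset.Icc 1 N, ((chi (2 ^ j * (a / X)) * a : ℝ) : ℂ) * e (h * x / a) =
      ∑' a : ℤ, ((chi (a / U) * a : ℝ) : ℂ) * e (h * x / a) := by
    have hconv : ∀ t : ℝ, t / U = 2 ^ j * (t / X) := by intro t; rw [hU]; field_simp
    rw [tsum_eq_sum (s := (Finset.Icc 1 N).map Nat.castEmbedding)]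
    · rw [Finset.sum_map]
      refine Finset.sum_congr rfl fun a _ => ?_
      simp only [Nat.castEmbedding_apply, Int.cast_natCast]
      rw [hconv]
    · intro a ha
      have : chi (a / U) = 0 := by
        by_contra hne
        apply ha
        have h1 : 1/4 < (a:ℝ)/U := by
          by_contra h3
          exact hne (chi_zero_left (not_lt.mp h3))
        have h2 : (a:ℝ)/U < 2 := by
          by_contra h3
          exact hne (chi_zero_right (not_lt.mp h3))
        have ha0 : (0:ℝ) < a := by
          have : 0 < (a:ℝ)/U := by linarith
          exact (div_pos_iff_of_pos_right hU0).mp this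
        have ha1 : 0 < a := by exact_mod_cast ha0
        rw [div_lt_iff₀ hU0] at h2
        have hUX : U ≤ X := by rw [hU]; exact div_le_self hX0.le hp1
        have h4 : (a:ℝ) ≤ N := by linarith
        have h5 : a ≤ N := by exact_mod_cast h4
        rw [Finset.mem_map]
        refine ⟨a.toNat, ?_, ?_⟩
        · rw [Finset.mem_Icc]; omega
        · simp only [Nat.castEmbedding_apply]; omega
      rw [this]; simp
  -- main term in terms of ℕ+
  have hterm : ∀ k : ℕ+, ((U ^ 2 : ℝ) : ℂ) * mainII α (((k:ℕ):ℤ) * U) = ((chi (2 ^ j * Real.sqrt ((h:ℝ) / k)) : ℝ) : ℂ) * cc x h k := by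
    intro k
    have hk0 : (0:ℝ) < k := by exact_mod_cast k.pos
    unfold mainII cc
    simp only [Int.cast_natCast]
    rw [if_pos (by positivity)]
    have r1 : α / (k * U) = (2 ^ j) ^ 2 * (h / k) := by
      rw [hα2, hU]; field_simp
    have r2 : Real.sqrt (α / (k * U)) = 2 ^ j * Real.sqrt (h / k) := by
      rw [r1, Real.sqrt_mul (by positivity), Real.sqrt_sq hp0.le]
    have r3 : α * (k * U) = h * k * x := by rw [hα]; field_simp
    rw [r2, r3, r1, ← amp_eq hx0 hh0 hk0, ← mul_assoc (Complex.ofReal _), ← mul_assoc (Complex.ofReal _), ← Complex.ofReal_mul, ← Complex.ofReal_mul]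
    congr 2
    rw [hU, ← hXX]; field_simp
  have hinj : Function.Injective (fun k : ℕ+ => ((k:ℕ):ℤ)) := by
    intro a b hab
    simpa using hab
  have hsupp : Function.support (fun k : ℤ => ((U ^ 2 : ℝ) : ℂ) * mainII α (k * U)) ⊆ Set.range (fun k : ℕ+ => ((k:ℕ):ℤ)) := by
    intro k hk
    have := (mainII_support hα0 hU0 (right_ne_zero_of_mul hk)).1
    exact ⟨⟨k.toNat, by omega⟩, by simp; omega⟩
  have hsm := (mainII_summable hα0 hU0).mul_left ((U ^ 2 : ℝ) : ℂ)
  have hmain : ∑' k : ℕ+, ((chi (2 ^ j * Real.sqrt ((h:ℝ) / k)) : ℝ) : ℂ) * cc x h k =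
      ∑' k : ℤ, ((U ^ 2 : ℝ) : ℂ) * mainII α (k * U) := by
    rw [← hinj.tsum_eq hsupp]
    exact tsum_congr fun k => (hterm k).symm
  refine ⟨?_, ?_⟩
  swap
  · refine (hsm.comp_injective hinj).congr fun k => ?_
    exact hterm k
  rw [hfin, hmain, block_poisson _ _ hU0]
  -- error
  set q : ℝ := h * 4 ^ j with hq
  have hq1 : 1 ≤ q := one_le_mul_of_one_le_of_one_le hh (one_le_pow₀ (by norm_num))
  obtain ⟨hls, hlt⟩ := sum_lorentz q hq1
  have herr : ∀ k : ℤ, ‖((U ^ 2 : ℝ) : ℂ) * II α (k * U) - ((U ^ 2 : ℝ) : ℂ) * mainII α (k * U)‖ ≤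
      (U ^ 2 * C * α ^ (-(3/2):ℝ)) * (1 / (1 + ((k:ℝ) / q) ^ 2)) := by
    intro k
    rw [← mul_sub, norm_mul, Complex.norm_real, Real.norm_of_nonneg (by positivity)]
    have := hII α (k * U) hα1
    have e1 : (k:ℝ) * U / α = k / q := by
      rw [hα2, hU, hq, show (4:ℝ)^j = 2^j * 2^j by rw [← mul_pow]; norm_num]; field_simp
    rw [e1] at this
    calc _ ≤ U ^ 2 * (C * α ^ (-(3/2):ℝ) / (1 + (k / q) ^ 2)) := by gcongr
      _ = _ := by ring
  have hsd : Summable (fun k : ℤ => ((U ^ 2 : ℝ) : ℂ) * II α (k * U) - ((U ^ 2 : ℝ) : ℂ) * mainII α (k * U)) :=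
    Summable.of_norm_bounded (hls.mul_left _) herr
  have hsI : Summable (fun k : ℤ => ((U ^ 2 : ℝ) : ℂ) * II α (k * U)) := by
    refine (hsd.add hsm).congr fun k => ?_
    ring
  rw [← hsI.tsum_sub hsm]
  refine (tsum_of_norm_bounded (hls.mul_left _).hasSum herr).trans ?_
  rw [tsum_mul_left]
  have hpos : 0 ≤ U ^ 2 * C * α ^ (-(3/2):ℝ) := by positivity
  refine (mul_le_mul_of_nonneg_left hlt hpos).trans ?_
  have hfinal : U ^ 2 * α ^ (-(3/2):ℝ) * q = x ^ ((1/4):ℝ) * (h:ℝ) ^ (-(1/2):ℝ) * ((2:ℝ)^j) ^ (-(3/2):ℝ) := by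
    rw [hα2, Real.mul_rpow (by positivity) (by positivity), Real.mul_rpow (by positivity) (by positivity)]
    have e1 : U ^ 2 * q = x * h := by
      rw [hU, hq, show (4:ℝ)^j = 2^j * 2^j by rw [← mul_pow]; norm_num, ← hXX]; field_simp
    have e2 : X ^ (-(3/2):ℝ) = x ^ (-(3/4):ℝ) := by
      rw [hX, Real.sqrt_eq_rpow, ← Real.rpow_mul hx0.le]; norm_num
    have e3 : x * x ^ (-(3/4):ℝ) = x ^ ((1/4):ℝ) := by
      nth_rewrite 1 [← Real.rpow_one x]
      rw [← Real.rpow_add hx0]; norm_num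
    have e4 : (h:ℝ) * (h:ℝ) ^ (-(3/2):ℝ) = (h:ℝ) ^ (-(1/2):ℝ) := by
      nth_rewrite 1 [← Real.rpow_one (h:ℝ)]
      rw [← Real.rpow_add hh0]; norm_num
    rw [e2, ← e3, ← e4]
    linear_combination ((h:ℝ) ^ (-(3/2):ℝ) * x ^ (-(3/4):ℝ) * ((2:ℝ)^j) ^ (-(3/2):ℝ)) * e1
  have h2j : ((2:ℝ)^j) ^ (-(3/2):ℝ) ≤ (1/2)^j := by
    calc ((2:ℝ)^j) ^ (-(3/2):ℝ) ≤ ((2:ℝ)^j) ^ (-1:ℝ) := Real.rpow_le_rpow_of_exponent_le hp1 (by norm_num)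
      _ = (1/2)^j := by rw [Real.rpow_neg_one, one_div, inv_pow]
  calc U ^ 2 * C * α ^ (-(3/2):ℝ) * (9 * q) = 9 * C * (U ^ 2 * α ^ (-(3/2):ℝ) * q) := by ring
    _ = 9 * C * (x ^ ((1/4):ℝ) * (h:ℝ) ^ (-(1/2):ℝ) * ((2:ℝ)^j) ^ (-(3/2):ℝ)) := by rw [hfinal]
    _ ≤ _ := by gcongr

end DivM


namespace DivM

lemma W0_dyadic {t : ℝ} (ht : 0 < t) (J : ℕ) :
    ∑ j ∈ Finset.range J, chi (2 ^ j * t) = W0 t - W0 (2 ^ J * t) := by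
  have : ∀ j ∈ Finset.range J, chi (2 ^ j * t) = W0 (2 ^ j * t) - W0 (2 ^ (j+1) * t) := by
    intro j _
    rw [chi_eq (by positivity), pow_succ]
    congr 2; ring
  rw [Finset.sum_congr rfl this, Finset.sum_range_sub' (fun j => W0 (2 ^ j * t))]
  simp

lemma summable_pnat_rpow {p : ℝ} (hp : p < -1) : Summable (fun n : ℕ+ => (n:ℝ) ^ p) :=
  (Real.summable_nat_rpow.mpr hp).comp_injective PNat.coe_injective

lemma summable_pairs_rpow {p : ℝ} (hp : p < -1) : Summable (fun q : ℕ+ × ℕ+ => ((q.1:ℝ) * q.2) ^ p) := by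
  have := (summable_pnat_rpow hp).mul_of_nonneg (summable_pnat_rpow hp) (fun n => by positivity) (fun n => by positivity)
  refine this.congr fun q => ?_
  rw [Real.mul_rpow (by positivity) (by positivity)]

lemma norm_cc {x : ℝ} (hx : 0 ≤ x) (h k : ℕ+) : ‖cc x h k‖ =
    (h:ℝ) ^ 2 * ((2:ℝ) ^ (-(1/2):ℝ) * x ^ ((3/4):ℝ) * ((h:ℝ) * k) ^ (-(5/4):ℝ)) := by
  unfold cc
  rw [norm_mul, norm_e, mul_one, Complex.norm_real, Real.norm_of_nonneg (by positivity)]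

lemma summable_cc {x : ℝ} (hx : 0 ≤ x) (h : ℕ+) : Summable (fun k => ‖cc x h k‖) := by
  have := ((summable_pnat_rpow (p := -(5/4)) (by norm_num)).mul_left
    ((h:ℝ) ^ 2 * ((2:ℝ) ^ (-(1/2):ℝ) * x ^ ((3/4):ℝ) * (h:ℝ) ^ (-(5/4):ℝ))))
  refine this.congr fun k => ?_
  rw [norm_cc hx, Real.mul_rpow (by positivity) (by positivity)]
  ring

lemma W0_term_norm (x : ℝ) (h k : ℕ+) (t : ℝ) : ‖((W0 t : ℝ) : ℂ) * cc x h k‖ ≤ ‖cc x h k‖ := by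
  rw [norm_mul, Complex.norm_real, Real.norm_of_nonneg (W0_nonneg _)]
  exact mul_le_of_le_one_left (norm_nonneg _) (W0_le_one _)

lemma freq_asymp : ∃ C : ℝ, 0 < C ∧ ∀ x : ℝ, 1 ≤ x → ∀ h : ℕ+, ∀ N : ℕ, 2 * Real.sqrt x ≤ N →
    ‖∑ a ∈ Finset.Icc 1 N, ((W0 (a / Real.sqrt x) * a : ℝ) : ℂ) * e (h * x / a) -
      ∑' k : ℕ+, ((W0 (Real.sqrt ((h:ℝ) / k)) : ℝ) : ℂ) * cc x h k‖ ≤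
      C * (x ^ ((1/4):ℝ) * (h:ℝ) ^ (-(1/2):ℝ)) := by
  obtain ⟨C, hC, hb⟩ := block_asymp
  refine ⟨C * 2, by positivity, ?_⟩
  intro x hx h N hN
  have hx0 : 0 < x := by linarith
  have hh0 : (0:ℝ) < h := by exact_mod_cast h.pos
  have hX0 : 0 < Real.sqrt x := Real.sqrt_pos.mpr hx0
  set S := ∑ a ∈ Finset.Icc 1 N, ((W0 (a / Real.sqrt x) * a : ℝ) : ℂ) * e (h * x / a) with hS
  set D := x ^ ((1/4):ℝ) * (h:ℝ) ^ (-(1/2):ℝ) with hD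
  have hD0 : 0 ≤ D := by positivity
  -- dyadic decomposition
  have hJ : ∀ᶠ J : ℕ in Filter.atTop, ‖S - ∑' k : ℕ+, ((W0 (Real.sqrt ((h:ℝ) / k)) - W0 (2 ^ J * Real.sqrt ((h:ℝ) / k)) : ℝ) : ℂ) * cc x h k‖ ≤ C * 2 * D := by
    have hlarge : ∀ᶠ J : ℕ in Filter.atTop, 2 * Real.sqrt x ≤ (2:ℝ) ^ J :=
      (tendsto_pow_atTop_atTop_of_one_lt (by norm_num : (1:ℝ) < 2)).eventually_ge_atTop _
    filter_upwards [hlarge] with J hJ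
    have e1 : S = ∑ j ∈ Finset.range J, ∑ a ∈ Finset.Icc 1 N, ((chi (2 ^ j * (a / Real.sqrt x)) * a : ℝ) : ℂ) * e (h * x / a) := by
      rw [Finset.sum_comm, hS]
      refine Finset.sum_congr rfl fun a ha => ?_
      have ha1 : (1:ℝ) ≤ a := by exact_mod_cast (Finset.mem_Icc.mp ha).1
      rw [← Finset.sum_mul]
      congr 1
      rw [← Complex.ofReal_sum, ← Finset.sum_mul, W0_dyadic (by positivity), W0_zero (t := 2 ^ J * (a / Real.sqrt x)), sub_zero]
      rw [← mul_div_assoc, le_div_iff₀ hX0]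
      nlinarith
    have e2 : ∑' k : ℕ+, ((W0 (Real.sqrt ((h:ℝ) / k)) - W0 (2 ^ J * Real.sqrt ((h:ℝ) / k)) : ℝ) : ℂ) * cc x h k =
        ∑ j ∈ Finset.range J, ∑' k : ℕ+, ((chi (2 ^ j * Real.sqrt ((h:ℝ) / k)) : ℝ) : ℂ) * cc x h k := by
      rw [← Summable.tsum_finsetSum (fun j _ => (hb x hx h j N hN).2)]
      refine tsum_congr fun k => ?_
      have hk0 : (0:ℝ) < k := by exact_mod_cast k.pos
      rw [← Finset.sum_mul, ← Complex.ofReal_sum, W0_dyadic (Real.sqrt_pos.mpr (by positivity))]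
    rw [e1, e2, ← Finset.sum_sub_distrib]
    refine (norm_sum_le _ _).trans ?_
    have : ∀ j ∈ Finset.range J, _ := fun j (_ : j ∈ Finset.range J) => (hb x hx h j N hN).1
    refine (Finset.sum_le_sum this).trans ?_
    have hg : ∑ j ∈ Finset.range J, ((1:ℝ)/2) ^ j ≤ 2 := by
      have := Summable.sum_le_tsum (Finset.range J) (fun j _ => by positivity) summable_geometric_two
      rw [tsum_geometric_two] at this
      exact this
    calc ∑ j ∈ Finset.range J, C * (D * (1/2) ^ j) = C * D * ∑ j ∈ Finset.range J, ((1:ℝ)/2) ^ j := by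
          rw [Finset.mul_sum]; refine Finset.sum_congr rfl fun j _ => by ring
      _ ≤ C * D * 2 := by gcongr
      _ = _ := by ring
  have hlim : Filter.Tendsto (fun J : ℕ => ∑' k : ℕ+, ((W0 (Real.sqrt ((h:ℝ) / k)) - W0 (2 ^ J * Real.sqrt ((h:ℝ) / k)) : ℝ) : ℂ) * cc x h k)
      Filter.atTop (nhds (∑' k : ℕ+, ((W0 (Real.sqrt ((h:ℝ) / k)) : ℝ) : ℂ) * cc x h k)) := by
    refine tendsto_tsum_of_dominated_convergence (bound := fun k => ‖cc x h k‖) (summable_cc hx0.le h) ?_ ?_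
    · intro k
      have hk0 : (0:ℝ) < k := by exact_mod_cast k.pos
      have hr : 0 < Real.sqrt ((h:ℝ)/k) := Real.sqrt_pos.mpr (by positivity)
      refine tendsto_const_nhds.congr' ?_
      have hlarge : ∀ᶠ J : ℕ in Filter.atTop, 2 / Real.sqrt ((h:ℝ)/k) ≤ (2:ℝ) ^ J :=
        (tendsto_pow_atTop_atTop_of_one_lt (by norm_num : (1:ℝ) < 2)).eventually_ge_atTop _
      filter_upwards [hlarge] with J hJ
      rw [W0_zero (t := 2 ^ J * Real.sqrt ((h:ℝ)/k)), sub_zero]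
      rwa [div_le_iff₀ hr] at hJ
    · refine Filter.Eventually.of_forall fun J k => ?_
      rw [norm_mul, Complex.norm_real, Real.norm_eq_abs]
      refine mul_le_of_le_one_left (norm_nonneg _) ?_
      have h1 := W0_nonneg (Real.sqrt ((h:ℝ)/k))
      have h2 := W0_le_one (Real.sqrt ((h:ℝ)/k))
      have h3 := W0_nonneg (2 ^ J * Real.sqrt ((h:ℝ)/k))
      have h4 := W0_le_one (2 ^ J * Real.sqrt ((h:ℝ)/k))
      rw [abs_le]; constructor <;> linarith
  exact le_of_tendsto ((tendsto_const_nhds.sub hlim).norm) hJ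

lemma hasSum_Ps (t : ℝ) : HasSum (fun h : ℕ+ => 1 / (2 * Real.pi ^ 2 * (h:ℝ) ^ 2) * Real.cos (2 * Real.pi * (h * t))) (Ps t) := by
  have h1 := hasSum_one_div_nat_pow_mul_cos (k := 1) one_ne_zero (x := Int.fract t)
    ⟨Int.fract_nonneg t, (Int.fract_lt_one t).le⟩
  have hB : (Polynomial.map (algebraMap ℚ ℝ) (Polynomial.bernoulli (2 * 1))).eval (Int.fract t) =
      Int.fract t ^ 2 - Int.fract t + 1 / 6 := by
    have h2 := bernoulliFun_two (Int.fract t)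
    unfold bernoulliFun at h2
    simpa using h2
  rw [hB] at h1
  have h3 : HasSum (fun n : ℕ+ => 1 / ((n:ℕ):ℝ) ^ (2 * 1) * Real.cos (2 * Real.pi * (n:ℕ) * Int.fract t)) _ :=
    (PNat.coe_injective.hasSum_iff (f := fun n : ℕ => 1 / (n:ℝ) ^ (2 * 1) * Real.cos (2 * Real.pi * n * Int.fract t)) (by
      intro n hn
      have : n = 0 := by
        by_contra h0
        exact hn ⟨⟨n, Nat.pos_of_ne_zero h0⟩, rfl⟩
      rw [this]; simp)).mpr h1
  have h4 := h3.mul_left (1 / (2 * Real.pi ^ 2))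
  have hfun : (fun h : ℕ+ => 1 / (2 * Real.pi ^ 2 * (h:ℝ) ^ 2) * Real.cos (2 * Real.pi * (h * t))) =
      fun n : ℕ+ => 1 / (2 * Real.pi ^ 2) * (1 / ((n:ℕ):ℝ) ^ (2 * 1) * Real.cos (2 * Real.pi * (n:ℕ) * Int.fract t)) := by
    funext h
    have : Real.cos (2 * Real.pi * (h * t)) = Real.cos (2 * Real.pi * (h:ℕ) * Int.fract t) := by
      rw [← Int.self_sub_floor]
      rw [show 2 * Real.pi * ((h:ℕ):ℝ) * (t - ⌊t⌋) = 2 * Real.pi * (h * t) - ((h:ℤ) * ⌊t⌋ : ℤ) * (2 * Real.pi) by push_cast; ring]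
      rw [Real.cos_sub_int_mul_two_pi]
    rw [this]
    have := Real.pi_pos
    field_simp
    ring
  rw [hfun]
  have hval : ∀ a b : ℝ, a = b → HasSum (fun n : ℕ+ => 1 / (2 * Real.pi ^ 2) * (1 / ((n:ℕ):ℝ) ^ (2 * 1) * Real.cos (2 * Real.pi * (n:ℕ) * Int.fract t))) a →
      HasSum (fun n : ℕ+ => 1 / (2 * Real.pi ^ 2) * (1 / ((n:ℕ):ℝ) ^ (2 * 1) * Real.cos (2 * Real.pi * (n:ℕ) * Int.fract t))) b := by
    intro a b h; rw [h]; exact id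
  refine hval _ _ ?_ h4
  unfold Ps
  have := Real.pi_pos
  simp
  field_simp

end DivM

namespace DivM

noncomputable def ffx (x : ℝ) (n : ℕ) : ℝ :=
  (2:ℝ) ^ (-(1/2):ℝ) / (2 * Real.pi ^ 2) * x ^ ((3/4):ℝ) * (n:ℝ) ^ (-(5/4):ℝ) *
    Real.cos (2 * Real.pi * (2 * Real.sqrt (n * x) + 1/8))

noncomputable def EE (x : ℝ) : ℝ := ∑' n : ℕ+, (divfun n : ℝ) * ffx x n

lemma abs_ffx_le {x : ℝ} (hx : 0 ≤ x) (n : ℕ) : |ffx x n| ≤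
    (2:ℝ) ^ (-(1/2):ℝ) / (2 * Real.pi ^ 2) * x ^ ((3/4):ℝ) * (n:ℝ) ^ (-(5/4):ℝ) := by
  unfold ffx
  rw [abs_mul]
  have h0 : 0 ≤ (2:ℝ) ^ (-(1/2):ℝ) / (2 * Real.pi ^ 2) * x ^ ((3/4):ℝ) * (n:ℝ) ^ (-(5/4):ℝ) := by positivity
  rw [abs_of_nonneg h0]
  exact mul_le_of_le_one_right h0 (Real.abs_cos_le_one _)

lemma summable_pairs_ffx {x : ℝ} (hx : 0 ≤ x) :
    Summable (fun p : ℕ+ × ℕ+ => ‖ffx x ((p.1:ℕ) * (p.2:ℕ))‖) := by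
  refine Summable.of_nonneg_of_le (fun _ => norm_nonneg _) (fun p => ?_)
    ((summable_pairs_rpow (p := -(5/4)) (by norm_num)).mul_left ((2:ℝ) ^ (-(1/2):ℝ) / (2 * Real.pi ^ 2) * x ^ ((3/4):ℝ)))
  have := abs_ffx_le hx ((p.1:ℕ) * (p.2:ℕ))
  rw [Real.norm_eq_abs]
  push_cast at this
  exact this

lemma summable_g {x : ℝ} (hx : 0 ≤ x) :
    Summable (fun p : ℕ+ × ℕ+ => W0 (Real.sqrt ((p.1:ℝ) / p.2)) * ffx x ((p.1:ℕ) * (p.2:ℕ))) := by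
  refine Summable.of_norm_bounded (summable_pairs_ffx hx) (fun p => ?_)
  rw [norm_mul, Real.norm_of_nonneg (W0_nonneg _)]
  exact mul_le_of_le_one_left (norm_nonneg _) (W0_le_one _)

lemma tsum_g {x : ℝ} (hx : 0 ≤ x) :
    ∑' p : ℕ+ × ℕ+, W0 (Real.sqrt ((p.1:ℝ) / p.2)) * ffx x ((p.1:ℕ) * (p.2:ℕ)) = EE x / 2 := by
  have h1 := summable_g hx
  have h2 := (Equiv.prodComm ℕ+ ℕ+).tsum_eq (fun p : ℕ+ × ℕ+ => W0 (Real.sqrt ((p.1:ℝ) / p.2)) * ffx x ((p.1:ℕ) * (p.2:ℕ)))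
  have h3 := (Equiv.prodComm ℕ+ ℕ+).summable_iff.mpr h1
  have h4 := h1.tsum_add h3
  have h5 : (∑' p : ℕ+ × ℕ+, ffx x ((p.1:ℕ) * (p.2:ℕ))) = EE x := by
    have := tsum_div_of_pairs (ffx x) (summable_pairs_ffx hx).of_norm
    simpa [EE] using this
  have h6 : (∑' p : ℕ+ × ℕ+, ffx x ((p.1:ℕ) * (p.2:ℕ))) = ∑' p : ℕ+ × ℕ+, (W0 (Real.sqrt ((p.1:ℝ) / p.2)) * ffx x ((p.1:ℕ) * (p.2:ℕ)) +
      ((fun p : ℕ+ × ℕ+ => W0 (Real.sqrt ((p.1:ℝ) / p.2)) * ffx x ((p.1:ℕ) * (p.2:ℕ))) ∘ (Equiv.prodComm ℕ+ ℕ+)) p) := by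
    refine tsum_congr fun p => ?_
    have hp1 : (0:ℝ) < p.1 := by exact_mod_cast p.1.pos
    have hp2 : (0:ℝ) < p.2 := by exact_mod_cast p.2.pos
    have := W0_inv (t := Real.sqrt ((p.1:ℝ) / p.2)) (by positivity)
    rw [← Real.sqrt_inv, inv_div] at this
    simp only [Function.comp, Equiv.prodComm_apply, Prod.fst_swap, Prod.snd_swap]
    rw [mul_comm (p.2:ℕ) (p.1:ℕ), ← add_mul, this, one_mul]
  rw [← h6, h5] at h4
  simp only [Function.comp] at h4
  rw [h2] at h4
  linarith

lemma re_cc {x : ℝ} (h k : ℕ+) (w : ℝ) : 1 / (2 * Real.pi ^ 2 * (h:ℝ) ^ 2) * ((w : ℂ) * cc x h k).re =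
    w * ffx x ((h:ℕ) * (k:ℕ)) := by
  unfold cc ffx
  rw [Complex.re_ofReal_mul, Complex.re_ofReal_mul, e_re]
  have hp1 : (0:ℝ) < h := by exact_mod_cast h.pos
  have := Real.pi_pos
  push_cast
  field_simp

lemma GG_asymp : ∃ C : ℝ, 0 < C ∧ ∀ x : ℝ, 1 ≤ x → |GG x - EE x / 2| ≤ C * x ^ ((1/4):ℝ) := by
  obtain ⟨C, hC, hf⟩ := freq_asymp
  have hs := summable_pnat_rpow (p := -(5/2)) (by norm_num)
  have hpos : 0 < ∑' n : ℕ+, (n:ℝ) ^ (-(5/2):ℝ) :=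
    hs.tsum_pos (fun n => by positivity) 1 (by simp)
  refine ⟨C * ∑' n : ℕ+, (n:ℝ) ^ (-(5/2):ℝ), by positivity, fun x hx => ?_⟩
  have hx0 : 0 ≤ x := by linarith
  set N := ⌈2 * Real.sqrt x⌉₊ with hN
  have hNle : 2 * Real.sqrt x ≤ N := Nat.le_ceil _
  have h1 : HasSum (fun h : ℕ+ => ∑ a ∈ Finset.Icc 1 N, W0 (a / Real.sqrt x) * ((a:ℝ) *
      (1 / (2 * Real.pi ^ 2 * (h:ℝ) ^ 2) * Real.cos (2 * Real.pi * (h * (x / a)))))) (GG x) := by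
    unfold GG
    exact hasSum_sum fun (a:ℕ) _ => ((hasSum_Ps (x / a)).mul_left (a:ℝ)).mul_left _
  have h2 : ∀ h : ℕ+, ∑ a ∈ Finset.Icc 1 N, W0 (a / Real.sqrt x) * ((a:ℝ) *
      (1 / (2 * Real.pi ^ 2 * (h:ℝ) ^ 2) * Real.cos (2 * Real.pi * (h * (x / a))))) =
      1 / (2 * Real.pi ^ 2 * (h:ℝ) ^ 2) * (∑ a ∈ Finset.Icc 1 N, ((W0 (a / Real.sqrt x) * a : ℝ) : ℂ) * e (h * x / a)).re := by
    intro h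
    rw [Complex.re_sum, Finset.mul_sum]
    refine Finset.sum_congr rfl fun a _ => ?_
    rw [Complex.re_ofReal_mul, e_re, mul_div_assoc]
    ring
  have h3 : ∀ h : ℕ+, 1 / (2 * Real.pi ^ 2 * (h:ℝ) ^ 2) * (∑' k : ℕ+, ((W0 (Real.sqrt ((h:ℝ) / k)) : ℝ) : ℂ) * cc x h k).re
      = ∑' k : ℕ+, W0 (Real.sqrt ((h:ℝ) / k)) * ffx x ((h:ℕ) * (k:ℕ)) := by
    intro h
    rw [Complex.re_tsum, ← tsum_mul_left]
    · exact tsum_congr fun k => re_cc h k _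
    · exact Summable.of_norm_bounded (summable_cc hx0 h) fun k => W0_term_norm x h k _
  have h4 := (summable_g hx0).hasSum.prod_fiberwise (fun h => ((summable_g hx0).prod_factor h).hasSum)
  rw [tsum_g hx0] at h4
  have h5 := h1.sub h4
  rw [← h5.tsum_eq, ← Real.norm_eq_abs]
  have h6 : HasSum (fun h : ℕ+ => C * x ^ ((1/4):ℝ) * (h:ℝ) ^ (-(5/2):ℝ)) (C * x ^ ((1/4):ℝ) * ∑' n : ℕ+, (n:ℝ) ^ (-(5/2):ℝ)) :=
    hs.hasSum.mul_left _
  refine (tsum_of_norm_bounded h6 fun h => ?_).trans (le_of_eq (by ring))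
  have hh := h3 h
  simp only at hh ⊢
  rw [h2, ← hh, ← mul_sub, ← Complex.sub_re, norm_mul]
  have hp1 : (0:ℝ) < h := by exact_mod_cast h.pos
  have hpi := Real.pi_gt_three
  rw [Real.norm_of_nonneg (by positivity)]
  have hk := hf x hx h N hNle
  have hre := (Complex.abs_re_le_norm _).trans hk
  rw [Real.norm_eq_abs]
  have hq : (h:ℝ) ^ (-(5/2):ℝ) = ((h:ℝ)^2)⁻¹ * (h:ℝ) ^ (-(1/2):ℝ) := by
    rw [show (-(5/2):ℝ) = -2 + (-(1/2)) by norm_num, Real.rpow_add hp1, Real.rpow_neg hp1.le]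
    norm_num
  have hc : 1 / (2 * Real.pi ^ 2 * (h:ℝ) ^ 2) ≤ ((h:ℝ)^2)⁻¹ := by
    rw [one_div]
    apply inv_anti₀ (by positivity)
    have : 1 ≤ 2 * Real.pi ^ 2 := by nlinarith
    exact le_mul_of_one_le_left (by positivity) this
  calc _ ≤ ((h:ℝ)^2)⁻¹ * (C * (x ^ ((1/4):ℝ) * (h:ℝ) ^ (-(1/2):ℝ))) :=
        mul_le_mul hc hre (abs_nonneg _) (by positivity)
    _ = _ := by rw [hq]; ring

lemma PropV : ∃ C : ℝ, 0 < C ∧ ∀ x H : ℝ, 1 ≤ x → 0 < H → H ≤ Real.sqrt x →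
    |(∫ u in x..(x+H), DirichletDelta u) + (EE (x+H) - EE x)| ≤ C * (H + x ^ ((1/4):ℝ)) := by
  obtain ⟨C1, hC1, h1⟩ := Delta_window
  obtain ⟨C2, hC2, h2⟩ := GG_asymp
  refine ⟨C1 + 6 * C2, by positivity, fun x H hx hH hHx => ?_⟩
  have a := h1 x H hx hH hHx
  have b := h2 x hx
  have c := h2 (x + H) (by linarith)
  have hsx : Real.sqrt x ≤ x := by
    rw [Real.sqrt_le_left (by linarith)]; nlinarith
  have d : (x + H) ^ ((1/4):ℝ) ≤ 2 * x ^ ((1/4):ℝ) := by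
    calc (x + H) ^ ((1/4):ℝ) ≤ (2 * x) ^ ((1/4):ℝ) :=
          Real.rpow_le_rpow (by linarith) (by linarith) (by norm_num)
      _ = (2:ℝ) ^ ((1/4):ℝ) * x ^ ((1/4):ℝ) := Real.mul_rpow (by norm_num) (by linarith)
      _ ≤ _ := by
        gcongr
        calc (2:ℝ) ^ ((1/4):ℝ) ≤ (2:ℝ) ^ (1:ℝ) := Real.rpow_le_rpow_of_exponent_le (by norm_num) (by norm_num)
          _ = 2 := by simp
  have hx4 : 0 ≤ x ^ ((1/4):ℝ) := by positivity
  have e1 : C2 * (x + H) ^ ((1/4):ℝ) ≤ C2 * (2 * x ^ ((1/4):ℝ)) := by gcongr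
  have p1 : 0 ≤ C1 * x ^ ((1/4):ℝ) := by positivity
  have p2 : 0 ≤ C2 * H := by positivity
  rw [abs_le] at *
  constructor <;> nlinarith [a.1, a.2, b.1, b.2, c.1, c.2]

end DivM

namespace DivM

lemma bdd_integrable {ν : Measure ℝ} [IsFiniteMeasure ν] {f : ℝ → ℂ} (hf : Measurable f) {C : ℝ} (h : ∀ t, ‖f t‖ ≤ C) :
    Integrable f ν :=
  Integrable.of_bound hf.aestronglyMeasurable C (Filter.Eventually.of_forall h)

lemma second_moment_abs {ν : Measure ℝ} [IsFiniteMeasure ν] (F : Finset ℕ) (w : ℕ → ℝ) (φ : ℕ → ℝ → ℂ)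
    (hφ : ∀ n, Measurable (φ n)) (hφ1 : ∀ n t, ‖φ n t‖ ≤ 1) (θ : ℝ → ℂ) (hθ : Measurable θ) (hθ1 : ∀ t, ‖θ t‖ ≤ 1)
    (B : ℝ) (hB : ∀ᵐ t ∂ν, ∫ t', ‖∑ n ∈ F, (w n : ℂ) * (φ n t * (starRingEnd ℂ) (φ n t'))‖ ∂ν ≤ B) :
    ∑ n ∈ F, w n * ‖∫ t, θ t * φ n t ∂ν‖ ^ 2 ≤ B * ν.real Set.univ := by
  set c : ℕ → ℂ := fun n => ∫ t, θ t * φ n t ∂ν with hc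
  have hm : ∀ n, Measurable fun t => θ t * φ n t := fun n => hθ.mul (hφ n)
  have hb : ∀ n t, ‖θ t * φ n t‖ ≤ 1 := fun n t => by
    rw [norm_mul]; exact mul_le_one₀ (hθ1 t) (norm_nonneg _) (hφ1 n t)
  have hi : ∀ n, Integrable (fun t => θ t * φ n t) ν := fun n => bdd_integrable (hm n) (hb n)
  have h1 : ((∑ n ∈ F, w n * ‖c n‖ ^ 2 : ℝ) : ℂ) = ∫ t, ∑ n ∈ F, (w n : ℂ) * ((θ t * φ n t) * (starRingEnd ℂ) (c n)) ∂ν := by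
    rw [integral_finsetSum]
    · push_cast
      refine Finset.sum_congr rfl fun n _ => ?_
      rw [integral_const_mul, integral_mul_const, Complex.mul_conj']
    · intro n _
      exact ((hi n).mul_const _).const_mul _
  have h2 : ∀ t, ∑ n ∈ F, (w n : ℂ) * ((θ t * φ n t) * (starRingEnd ℂ) (c n)) =
      ∫ t', θ t * (starRingEnd ℂ) (θ t') * ∑ n ∈ F, (w n : ℂ) * (φ n t * (starRingEnd ℂ) (φ n t')) ∂ν := by
    intro t
    have : ∀ t', θ t * (starRingEnd ℂ) (θ t') * ∑ n ∈ F, (w n : ℂ) * (φ n t * (starRingEnd ℂ) (φ n t')) =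
        ∑ n ∈ F, (w n : ℂ) * ((θ t * φ n t) * (starRingEnd ℂ) (θ t' * φ n t')) := by
      intro t'
      rw [Finset.mul_sum]
      refine Finset.sum_congr rfl fun n _ => ?_
      rw [map_mul]; ring
    simp_rw [this]
    have hci : ∀ n, Integrable (fun t' => (starRingEnd ℂ) (θ t' * φ n t')) ν := fun n =>
      bdd_integrable (C := 1) (Complex.continuous_conj.measurable.comp (hm n)) (fun t => by
        rw [RCLike.norm_conj]; exact hb n t)
    rw [integral_finsetSum]
    · refine Finset.sum_congr rfl fun n _ => ?_
      rw [integral_const_mul, integral_const_mul, integral_conj]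
    · intro n _
      exact ((hci n).const_mul _).const_mul _
  have hKm : ∀ t, Measurable fun t' => ∑ n ∈ F, (w n : ℂ) * (φ n t * (starRingEnd ℂ) (φ n t')) := fun t =>
    Finset.measurable_sum _ fun n _ => ((Complex.continuous_conj.measurable.comp (hφ n)).const_mul _).const_mul _
  have hKb : ∀ t t', ‖∑ n ∈ F, (w n : ℂ) * (φ n t * (starRingEnd ℂ) (φ n t'))‖ ≤ ∑ n ∈ F, |w n| := by
    intro t t'
    refine (norm_sum_le _ _).trans (Finset.sum_le_sum fun n _ => ?_)
    rw [norm_mul, norm_mul, RCLike.norm_conj, Complex.norm_real, Real.norm_eq_abs]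
    exact mul_le_of_le_one_right (abs_nonneg _) (mul_le_one₀ (hφ1 n t) (norm_nonneg _) (hφ1 n t'))
  have h3 : ∀ᵐ t ∂ν, ‖∑ n ∈ F, (w n : ℂ) * ((θ t * φ n t) * (starRingEnd ℂ) (c n))‖ ≤ B := by
    filter_upwards [hB] with t ht
    rw [h2]
    refine (norm_integral_le_integral_norm _).trans (le_trans ?_ ht)
    refine integral_mono_of_nonneg (Filter.Eventually.of_forall fun _ => norm_nonneg _)
      ((bdd_integrable (hKm t) (hKb t)).norm) (Filter.Eventually.of_forall fun t' => ?_)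
    simp only
    rw [norm_mul, norm_mul, RCLike.norm_conj]
    exact mul_le_of_le_one_left (norm_nonneg _) (mul_le_one₀ (hθ1 t) (norm_nonneg _) (hθ1 t'))
  have h4 := norm_integral_le_of_norm_le_const h3
  rw [← h1, Complex.norm_real] at h4
  exact (Real.le_norm_self _).trans h4

lemma dual_ineq {ν : Measure ℝ} [IsFiniteMeasure ν] (F F' : Finset ℕ) (hFF : F' ⊆ F) (w : ℕ → ℝ) (hw0 : ∀ n, 0 ≤ w n)
    (hw1 : ∀ n ∈ F', 1 ≤ w n) (φ : ℕ → ℝ → ℂ)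
    (hφ : ∀ n, Measurable (φ n)) (hφ1 : ∀ n t, ‖φ n t‖ ≤ 1) (b : ℕ → ℝ)
    (B : ℝ) (hB : ∀ᵐ t ∂ν, ∫ t', ‖∑ n ∈ F, (w n : ℂ) * (φ n t * (starRingEnd ℂ) (φ n t'))‖ ∂ν ≤ B) :
    (∫ t, ‖∑ n ∈ F', (b n : ℂ) * φ n t‖ ∂ν) ^ 2 ≤ (∑ n ∈ F', b n ^ 2) * (B * ν.real Set.univ) := by
  set Z : ℝ → ℂ := fun t => ∑ n ∈ F', (b n : ℂ) * φ n t with hZ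
  have hZm : Measurable Z := Finset.measurable_sum _ fun n _ => (hφ n).const_mul _
  set θ : ℝ → ℂ := fun t => (starRingEnd ℂ) (Z t) / ‖Z t‖ with hθ
  have hθm : Measurable θ := (Complex.continuous_conj.measurable.comp hZm).div
    (Complex.measurable_ofReal.comp hZm.norm)
  have hθ1 : ∀ t, ‖θ t‖ ≤ 1 := by
    intro t
    simp only [hθ, norm_div, RCLike.norm_conj, Complex.norm_real, norm_norm]
    exact div_self_le_one _
  have hθZ : ∀ t, θ t * Z t = (‖Z t‖ : ℂ) := by
    intro t
    simp only [hθ]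
    by_cases h : Z t = 0
    · simp [h]
    · have : (‖Z t‖ : ℂ) ≠ 0 := by simpa using h
      rw [div_mul_eq_mul_div, mul_comm, Complex.mul_conj']
      field_simp
  have hsm := second_moment_abs F w φ hφ hφ1 θ hθm hθ1 B hB
  set c : ℕ → ℂ := fun n => ∫ t, θ t * φ n t ∂ν with hc
  have hi : ∀ n, Integrable (fun t => θ t * φ n t) ν := fun n => bdd_integrable (C := 1) (hθm.mul (hφ n)) (fun t => by
    rw [norm_mul]; exact mul_le_one₀ (hθ1 t) (norm_nonneg _) (hφ1 n t))
  have h1 : ((∫ t, ‖Z t‖ ∂ν : ℝ) : ℂ) = ∑ n ∈ F', (b n : ℂ) * c n := by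
    rw [← integral_complex_ofReal]
    simp_rw [← hθZ]
    have : ∀ t, θ t * Z t = ∑ n ∈ F', (b n : ℂ) * (θ t * φ n t) := by
      intro t
      simp only [hZ]
      rw [Finset.mul_sum]
      exact Finset.sum_congr rfl fun n _ => by ring
    simp_rw [this]
    rw [integral_finsetSum _ fun n _ => (hi n).const_mul _]
    exact Finset.sum_congr rfl fun n _ => integral_const_mul _ _
  have h2 : ∫ t, ‖Z t‖ ∂ν ≤ ∑ n ∈ F', |b n| * ‖c n‖ := by
    have h3 := congrArg norm h1
    rw [Complex.norm_real] at h3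
    refine (Real.le_norm_self _).trans (h3.le.trans ((norm_sum_le _ _).trans (le_of_eq ?_)))
    refine Finset.sum_congr rfl fun n _ => ?_
    rw [norm_mul, Complex.norm_real, Real.norm_eq_abs]
  have h0 : 0 ≤ ∫ t, ‖Z t‖ ∂ν := integral_nonneg fun _ => norm_nonneg _
  calc (∫ t, ‖Z t‖ ∂ν) ^ 2 ≤ (∑ n ∈ F', |b n| * ‖c n‖) ^ 2 := by gcongr
    _ ≤ (∑ n ∈ F', |b n| ^ 2) * ∑ n ∈ F', ‖c n‖ ^ 2 := Finset.sum_mul_sq_le_sq_mul_sq _ _ _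
    _ ≤ (∑ n ∈ F', b n ^ 2) * (B * ν.real Set.univ) := by
      simp_rw [sq_abs]
      refine mul_le_mul_of_nonneg_left ?_ (Finset.sum_nonneg fun _ _ => sq_nonneg _)
      refine le_trans ?_ hsm
      calc ∑ n ∈ F', ‖c n‖ ^ 2 ≤ ∑ n ∈ F', w n * ‖c n‖ ^ 2 :=
            Finset.sum_le_sum fun n hn => le_mul_of_one_le_left (sq_nonneg _) (hw1 n hn)
        _ ≤ _ := Finset.sum_le_sum_of_subset_of_nonneg hFF fun n _ _ => mul_nonneg (hw0 n) (sq_nonneg _)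

lemma KK_bound : ∃ C : ℝ, 0 < C ∧ ∀ M D : ℝ, 1 ≤ M →
    ‖∑ n ∈ Finset.Icc 1 ⌈4 * M⌉₊, ((chi2 ((n:ℝ) / M) : ℝ) : ℂ) * e (D * Real.sqrt n)‖
      ≤ C * (M / (1 + (D * Real.sqrt M) ^ 2) + 1 / M + |D * Real.sqrt M| ^ (1/2 : ℝ)) := by
  obtain ⟨C, hC, h⟩ := K_bound
  refine ⟨C, hC, fun M D hM => ?_⟩
  have h1 := h M D hM
  rw [tsum_eq_sum (s := (Finset.Icc 1 ⌈4 * M⌉₊).map Nat.castEmbedding)] at h1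
  · rw [Finset.sum_map] at h1
    simpa using h1
  · intro n hn
    have hM0 : 0 < M := by linarith
    have : chi2 ((n:ℝ) / M) = 0 := by
      by_cases hn0 : n ≤ 0
      · apply chi2_zero_left
        have : (n:ℝ) / M ≤ 0 := div_nonpos_of_nonpos_of_nonneg (by exact_mod_cast hn0) hM0.le
        linarith
      · apply chi2_zero_right
        rw [le_div_iff₀ hM0]
        by_contra hlt
        push Not at hlt hn0
        apply hn
        rw [Finset.mem_map]
        refine ⟨n.toNat, ?_, ?_⟩
        · rw [Finset.mem_Icc]
          refine ⟨by omega, ?_⟩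
          have h2 : ((n.toNat : ℕ):ℝ) = (n:ℝ) := by
            have : ((n.toNat : ℕ):ℤ) = n := Int.toNat_of_nonneg hn0.le
            exact_mod_cast this
          have : ((n.toNat : ℕ):ℝ) ≤ (⌈4 * M⌉₊ : ℕ) := by
            rw [h2]; exact hlt.le.trans (Nat.le_ceil _)
          exact_mod_cast this
        · simp [Nat.castEmbedding]; omega
    rw [this]; simp

end DivM

namespace DivM

noncomputable def ZZ (M t : ℝ) : ℂ :=
  ∑ n ∈ Finset.Ioc ⌊M⌋₊ ⌊2 * M⌋₊, (((divfun n : ℝ) / (n:ℝ) ^ ((3:ℝ)/4) : ℝ) : ℂ) * e (2 * Real.sqrt (n * t))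

lemma continuous_ZZ (M : ℝ) : Continuous (ZZ M) := by
  unfold ZZ
  refine continuous_finsetSum _ fun n _ => continuous_const.mul (continuous_e.comp ?_)
  fun_prop

lemma integral_lorentz (k t M : ℝ) (hk : 0 < k) :
    Integrable (fun t' : ℝ => M * (1 + (k * (t - t')) ^ 2)⁻¹) ∧
    ∫ t' : ℝ, M * (1 + (k * (t - t')) ^ 2)⁻¹ = M * Real.pi / k := by
  have hi : Integrable (fun u : ℝ => M * (1 + (k * u) ^ 2)⁻¹) :=
    ((integrable_inv_one_add_sq.comp_mul_left' hk.ne').const_mul M)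
  constructor
  · exact hi.comp_sub_left t
  · rw [integral_sub_left_eq_self (fun u : ℝ => M * (1 + (k * u) ^ 2)⁻¹) volume t, integral_const_mul,
      Measure.integral_comp_mul_left (fun u : ℝ => (1 + u ^ 2)⁻¹) k, integral_univ_inv_one_add_sq,
      abs_of_pos (inv_pos.mpr hk), smul_eq_mul]
    field_simp

lemma inner_K : ∃ C : ℝ, 0 < C ∧ ∀ M T T0 s : ℝ, 1 ≤ M → 1 ≤ T → 0 < T0 → ∀ A : Set ℝ, MeasurableSet A →
    A ⊆ Set.Icc s (s + T0) → A ⊆ Set.Icc (T/2) (3*T) → ∀ t ∈ A,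
    ∫ t' in A, ‖∑ n ∈ Finset.Icc 1 ⌈4 * M⌉₊, ((chi2 ((n:ℝ) / M) : ℝ) : ℂ) *
      (e (2 * Real.sqrt (n * t)) * (starRingEnd ℂ) (e (2 * Real.sqrt (n * t'))))‖ ≤
      C * (Real.sqrt (M * T) + (1 / M + (2 * Real.sqrt M * T0 / Real.sqrt T) ^ ((1/2):ℝ)) * volume.real A) := by
  obtain ⟨C, hC, hK⟩ := KK_bound
  refine ⟨C * 8, by positivity, fun M T T0 s hM hT hT0 A hA hAs hAT t ht => ?_⟩
  have hM0 : 0 < M := by linarith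
  have hT' : 0 < T := by linarith
  have hAfin : volume A < ⊤ := lt_of_le_of_lt (measure_mono hAs) (by simp)
  have : IsFiniteMeasure (volume.restrict A) := ⟨by simpa using hAfin⟩
  set k := Real.sqrt (M / (3 * T)) with hk
  have hk0 : 0 < k := Real.sqrt_pos.mpr (by positivity)
  have hksq : k ^ 2 = M / (3 * T) := Real.sq_sqrt (by positivity)
  set q := (2 * Real.sqrt M * T0 / Real.sqrt T) ^ ((1/2):ℝ) with hq
  have hpt : ∀ t' ∈ A, ‖∑ n ∈ Finset.Icc 1 ⌈4 * M⌉₊, ((chi2 ((n:ℝ) / M) : ℝ) : ℂ) *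
      (e (2 * Real.sqrt (n * t)) * (starRingEnd ℂ) (e (2 * Real.sqrt (n * t'))))‖ ≤
      C * (M * (1 + (k * (t - t')) ^ 2)⁻¹ + (1 / M + q)) := by
    intro t' ht'
    have h1 := hAT ht
    have h2 := hAT ht'
    have h3 := hAs ht
    have h4 := hAs ht'
    have e1 : ∀ n : ℕ, e (2 * Real.sqrt (n * t)) * (starRingEnd ℂ) (e (2 * Real.sqrt (n * t'))) =
        e ((2 * (Real.sqrt t - Real.sqrt t')) * Real.sqrt n) := by
      intro n
      rw [← e_neg, ← e_add, Real.sqrt_mul (by positivity), Real.sqrt_mul (by positivity)]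
      congr 1; ring
    simp_rw [e1]
    refine (hK M (2 * (Real.sqrt t - Real.sqrt t')) hM).trans ?_
    have st := Real.sq_sqrt (show 0 ≤ t by linarith [h1.1])
    have st' := Real.sq_sqrt (show 0 ≤ t' by linarith [h2.1])
    have sM := Real.sq_sqrt hM0.le
    have sT := Real.sq_sqrt hT'.le
    have pt := Real.sqrt_nonneg t
    have pt' := Real.sqrt_nonneg t'
    have pT : 0 < Real.sqrt T := Real.sqrt_pos.mpr hT'
    set a := Real.sqrt t
    set b := Real.sqrt t'
    have f1 : (k * (t - t')) ^ 2 ≤ (2 * (a - b) * Real.sqrt M) ^ 2 := by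
      rw [mul_pow, mul_pow _ (Real.sqrt M), sM, hksq, ← st, ← st']
      rw [show M / (3 * T) * (a ^ 2 - b ^ 2) ^ 2 = ((a - b) ^ 2 * M) * ((a + b) ^ 2 / (3 * T)) by ring]
      rw [show (2 * (a - b)) ^ 2 * M = ((a - b) ^ 2 * M) * 4 by ring]
      apply mul_le_mul_of_nonneg_left _ (by positivity)
      rw [div_le_iff₀ (by positivity)]
      nlinarith [sq_nonneg (a - b), h1.2, h2.2]
    have f2 : |2 * (a - b) * Real.sqrt M| ≤ 2 * Real.sqrt M * T0 / Real.sqrt T := by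
      rw [abs_mul, abs_of_nonneg (Real.sqrt_nonneg M), abs_mul, abs_two]
      have : |a - b| ≤ T0 / Real.sqrt T := by
        rw [le_div_iff₀ pT]
        have h5 : |a - b| * (a + b) ≤ T0 := by
          rw [← abs_of_nonneg (show 0 ≤ a + b by positivity), ← abs_mul,
            show (a - b) * (a + b) = t - t' by rw [← st, ← st']; ring, abs_le]
          constructor <;> linarith [h3.1, h3.2, h4.1, h4.2]
        have h6 : Real.sqrt T ≤ a + b := by
          apply Real.sqrt_le_iff.mpr ⟨by positivity, ?_⟩
          nlinarith [mul_nonneg pt pt', h1.1, h2.1]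
        calc |a - b| * Real.sqrt T ≤ |a - b| * (a + b) := by gcongr
          _ ≤ _ := h5
      calc 2 * |a - b| * Real.sqrt M ≤ 2 * (T0 / Real.sqrt T) * Real.sqrt M := by gcongr
        _ = _ := by ring
    have f3 : |2 * (a - b) * Real.sqrt M| ^ ((1/2):ℝ) ≤ q := Real.rpow_le_rpow (abs_nonneg _) f2 (by norm_num)
    have f4 : M / (1 + (2 * (a - b) * Real.sqrt M) ^ 2) ≤ M * (1 + (k * (t - t')) ^ 2)⁻¹ := by
      rw [div_eq_mul_inv]
      gcongr
    apply mul_le_mul_of_nonneg_left _ hC.le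
    linarith
  obtain ⟨hi, hI⟩ := integral_lorentz k t M hk0
  have hRi : Integrable (fun t' => C * (M * (1 + (k * (t - t')) ^ 2)⁻¹ + (1 / M + q))) (volume.restrict A) :=
    (hi.restrict.add (integrable_const _)).const_mul _
  have hmono : ∫ t' in A, ‖∑ n ∈ Finset.Icc 1 ⌈4 * M⌉₊, ((chi2 ((n:ℝ) / M) : ℝ) : ℂ) *
      (e (2 * Real.sqrt (n * t)) * (starRingEnd ℂ) (e (2 * Real.sqrt (n * t'))))‖ ≤
      ∫ t' in A, C * (M * (1 + (k * (t - t')) ^ 2)⁻¹ + (1 / M + q)) := by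
    refine integral_mono_of_nonneg (Filter.Eventually.of_forall fun _ => norm_nonneg _) hRi ?_
    exact (ae_restrict_iff' hA).mpr (Filter.Eventually.of_forall hpt)
  refine hmono.trans ?_
  rw [integral_const_mul, integral_add hi.restrict (integrable_const _), integral_const]
  have h7 : ∫ t' in A, M * (1 + (k * (t - t')) ^ 2)⁻¹ ≤ M * Real.pi / k := by
    rw [← hI]
    exact setIntegral_le_integral hi (Filter.Eventually.of_forall fun t' => by positivity)
  have h8 : M * Real.pi / k ≤ 8 * Real.sqrt (M * T) := by
    have hk2 : k = Real.sqrt (M * T) / (Real.sqrt 3 * T) := by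
      rw [hk, show M / (3 * T) = M * T / (3 * T ^ 2) by field_simp, Real.sqrt_div (by positivity),
        Real.sqrt_mul (show (0:ℝ) ≤ 3 by norm_num), Real.sqrt_sq hT'.le]
    have hs := Real.sq_sqrt (show 0 ≤ M * T by positivity)
    have hs0 : 0 < Real.sqrt (M * T) := Real.sqrt_pos.mpr (by positivity)
    have h3 : Real.sqrt 3 ≤ 2 := by rw [Real.sqrt_le_left] <;> norm_num
    rw [div_le_iff₀ hk0, hk2]
    rw [show 8 * Real.sqrt (M * T) * (Real.sqrt (M * T) / (Real.sqrt 3 * T)) = 8 * (Real.sqrt (M * T)) ^ 2 / (Real.sqrt 3 * T) by ring, hs,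
      le_div_iff₀ (by positivity)]
    have : Real.pi * Real.sqrt 3 ≤ 8 := by nlinarith [Real.pi_lt_four, Real.pi_pos, Real.sqrt_nonneg 3]
    calc M * Real.pi * (Real.sqrt 3 * T) = (M * T) * (Real.pi * Real.sqrt 3) := by ring
      _ ≤ (M * T) * 8 := by gcongr
      _ = _ := by ring
  have h9 : (volume.restrict A).real Set.univ • (1 / M + q) = (1 / M + q) * volume.real A := by
    simp [Measure.real, mul_comm]
  rw [h9]
  have hq0 : 0 ≤ (1 / M + q) * volume.real A := by positivity
  rw [mul_assoc]
  apply mul_le_mul_of_nonneg_left _ hC.le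
  linarith

lemma sum_bsq (δ : ℝ) (hδ : 0 < δ) : ∃ C : ℝ, 0 < C ∧ ∀ M : ℝ, 1 ≤ M →
    ∑ n ∈ Finset.Ioc ⌊M⌋₊ ⌊2 * M⌋₊, ((divfun n : ℝ) / (n:ℝ) ^ ((3:ℝ)/4)) ^ 2 ≤ C * M ^ (2 * δ - 1/2) := by
  obtain ⟨C, hC, hd⟩ := divfun_le δ hδ
  refine ⟨2 * (C * 2 ^ δ) ^ 2, by positivity, fun M hM => ?_⟩
  have hM0 : 0 < M := by linarith
  have hterm : ∀ n ∈ Finset.Ioc ⌊M⌋₊ ⌊2 * M⌋₊, ((divfun n : ℝ) / (n:ℝ) ^ ((3:ℝ)/4)) ^ 2 ≤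
      (C * 2 ^ δ * M ^ (δ - 3/4)) ^ 2 := by
    intro n hn
    rw [Finset.mem_Ioc] at hn
    have h1 : M < n := (Nat.floor_lt hM0.le).mp hn.1
    have h2 : (n:ℝ) ≤ 2 * M := (Nat.le_floor_iff (by positivity)).mp hn.2
    have : (divfun n : ℝ) / (n:ℝ) ^ ((3:ℝ)/4) ≤ C * 2 ^ δ * M ^ (δ - 3/4) := by
      rw [Real.rpow_sub hM0]
      calc (divfun n : ℝ) / (n:ℝ) ^ ((3:ℝ)/4) ≤ C * (2 * M) ^ δ / M ^ ((3:ℝ)/4) := by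
            have := hd n
            gcongr
            refine this.trans ?_
            gcongr
        _ = _ := by rw [Real.mul_rpow (by norm_num) hM0.le]; ring
    gcongr
  refine (Finset.sum_le_card_nsmul _ _ _ hterm).trans ?_
  rw [nsmul_eq_mul, Nat.card_Ioc]
  have hc : ((⌊2 * M⌋₊ - ⌊M⌋₊ : ℕ) : ℝ) ≤ 2 * M := by
    calc ((⌊2 * M⌋₊ - ⌊M⌋₊ : ℕ) : ℝ) ≤ (⌊2 * M⌋₊ : ℕ) := by exact_mod_cast Nat.sub_le _ _
      _ ≤ 2 * M := Nat.floor_le (by positivity)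
  have hp : M * (M ^ (δ - 3/4)) ^ 2 = M ^ (2 * δ - 1/2) := by
    rw [← Real.rpow_natCast, ← Real.rpow_mul hM0.le]
    nth_rw 1 [← Real.rpow_one M]
    rw [← Real.rpow_add hM0]; congr 1; push_cast; ring
  calc _ ≤ (2 * M) * (C * 2 ^ δ * M ^ (δ - 3/4)) ^ 2 := by gcongr
    _ = 2 * (C * 2 ^ δ) ^ 2 * (M * (M ^ (δ - 3/4)) ^ 2) := by ring
    _ = _ := by rw [hp]

lemma dual_Z (δ : ℝ) (hδ : 0 < δ) : ∃ C : ℝ, 0 < C ∧ ∀ M T T0 s : ℝ, 1 ≤ M → 1 ≤ T → 0 < T0 → ∀ A : Set ℝ, MeasurableSet A →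
    A ⊆ Set.Icc s (s + T0) → A ⊆ Set.Icc (T/2) (3*T) →
    ∫ t in A, ‖ZZ M t‖ ≤ C * (M ^ δ * T ^ ((1/4):ℝ) * Real.sqrt (volume.real A) + M ^ (δ - 1/4) * volume.real A +
      M ^ (δ - 1/8) * T0 ^ ((1/4):ℝ) * T ^ (-(1/8):ℝ) * volume.real A) := by
  obtain ⟨C1, hC1, hb⟩ := sum_bsq δ hδ
  obtain ⟨C2, hC2, hK⟩ := inner_K
  refine ⟨Real.sqrt (2 * C1 * C2), by positivity, fun M T T0 s hM hT hT0 A hA hAs hAT => ?_⟩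
  have hM0 : 0 < M := by linarith
  have hT' : 0 < T := by linarith
  have hAfin : volume A < ⊤ := lt_of_le_of_lt (measure_mono hAs) (by simp)
  have : IsFiniteMeasure (volume.restrict A) := ⟨by simpa using hAfin⟩
  have h1 := dual_ineq (ν := volume.restrict A) (Finset.Icc 1 ⌈4 * M⌉₊) (Finset.Ioc ⌊M⌋₊ ⌊2 * M⌋₊)
    (by
      intro n hn
      rw [Finset.mem_Ioc] at hn
      rw [Finset.mem_Icc]
      have : (n:ℝ) ≤ (⌈4 * M⌉₊ : ℕ) := by
        have h2 : (n:ℝ) ≤ 2 * M := (Nat.le_floor_iff (by positivity)).mp hn.2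
        exact le_trans (by linarith) (Nat.le_ceil _)
      refine ⟨by omega, by exact_mod_cast this⟩)
    (fun n => chi2 ((n:ℝ) / M)) (fun n => chi2_nonneg _)
    (by
      intro n hn
      rw [Finset.mem_Ioc] at hn
      have h1 : M < n := (Nat.floor_lt hM0.le).mp hn.1
      have h2 : (n:ℝ) ≤ 2 * M := (Nat.le_floor_iff (by positivity)).mp hn.2
      refine (chi2_one ?_ ?_).ge
      · rw [le_div_iff₀ hM0]; linarith
      · rw [div_le_iff₀ hM0]; linarith)
    (fun n t => e (2 * Real.sqrt (n * t)))
    (fun n => (continuous_e.comp (by fun_prop : Continuous fun t : ℝ => 2 * Real.sqrt (n * t))).measurable)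
    (fun n t => (norm_e _).le) (fun n => (divfun n : ℝ) / (n:ℝ) ^ ((3:ℝ)/4)) _
    ((ae_restrict_iff' hA).mpr (Filter.Eventually.of_forall (hK M T T0 s hM hT hT0 A hA hAs hAT)))
  have hμ : (volume.restrict A).real Set.univ = volume.real A := by simp [Measure.real]
  rw [hμ] at h1
  set μ := volume.real A with hmu
  have hμ0 : 0 ≤ μ := measureReal_nonneg
  set I := ∫ t in A, ‖ZZ M t‖ with hI
  have hI0 : 0 ≤ I := integral_nonneg fun _ => norm_nonneg _
  have h2 : I ^ 2 ≤ (C1 * M ^ (2 * δ - 1/2)) * (C2 * (Real.sqrt (M * T) + (1 / M + (2 * Real.sqrt M * T0 / Real.sqrt T) ^ ((1/2):ℝ)) * μ) * μ) := by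
    refine le_trans h1 ?_
    exact mul_le_mul_of_nonneg_right (hb M hM) (by positivity)
  set p := M ^ δ * T ^ ((1/4):ℝ) * Real.sqrt μ with hp
  set q := M ^ (δ - 1/4) * μ with hq
  set r := M ^ (δ - 1/8) * T0 ^ ((1/4):ℝ) * T ^ (-(1/8):ℝ) * μ with hr
  have hp0 : 0 ≤ p := by positivity
  have hq0 : 0 ≤ q := by positivity
  have hr0 : 0 ≤ r := by positivity
  have sqr : ∀ (z : ℝ) (a : ℝ), 0 ≤ z → (z ^ a) ^ 2 = z ^ (2 * a) := by
    intro z a hz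
    rw [← Real.rpow_natCast, ← Real.rpow_mul hz]; congr 1; push_cast; ring
  have ep : M ^ (2 * δ - 1/2) * (Real.sqrt (M * T) * μ) = p ^ 2 := by
    rw [hp, mul_pow, mul_pow, Real.sq_sqrt hμ0, sqr _ _ hM0.le, sqr _ _ hT'.le, Real.sqrt_eq_rpow,
      Real.mul_rpow hM0.le hT'.le, show 2 * δ = (2 * δ - 1/2) + 1/2 by ring, Real.rpow_add hM0]
    norm_num
    ring
  have eq1 : M ^ (2 * δ - 1/2) * ((1 / M) * μ * μ) ≤ q ^ 2 := by
    rw [hq, mul_pow, sqr _ _ hM0.le, show 2 * (δ - 1/4) = 2 * δ - 1/2 by ring]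
    have : 1 / M ≤ 1 := by rw [div_le_one hM0]; exact hM
    apply mul_le_mul_of_nonneg_left _ (by positivity)
    calc 1 / M * μ * μ ≤ 1 * μ * μ := by gcongr
      _ = _ := by ring
  have er : M ^ (2 * δ - 1/2) * ((2 * Real.sqrt M * T0 / Real.sqrt T) ^ ((1/2):ℝ) * μ * μ) ≤ 2 * r ^ 2 := by
    have h3 : (2 * Real.sqrt M * T0 / Real.sqrt T) ^ ((1/2):ℝ) = (2:ℝ) ^ ((1/2):ℝ) * M ^ ((1/4):ℝ) * T0 ^ ((1/2):ℝ) * T ^ (-(1/4):ℝ) := by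
      rw [Real.div_rpow (by positivity) (by positivity), Real.mul_rpow (by positivity) hT0.le,
        Real.mul_rpow (by norm_num) (by positivity), Real.sqrt_eq_rpow, Real.sqrt_eq_rpow,
        ← Real.rpow_mul hM0.le, ← Real.rpow_mul hT'.le, Real.rpow_neg hT'.le, ← div_eq_mul_inv]
      norm_num
    have h4 : (2:ℝ) ^ ((1/2):ℝ) ≤ 2 := by
      calc (2:ℝ) ^ ((1/2):ℝ) ≤ (2:ℝ) ^ (1:ℝ) := Real.rpow_le_rpow_of_exponent_le (by norm_num) (by norm_num)
          _ = 2 := by simp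
    have h5 : r ^ 2 = M ^ (2 * δ - 1/2) * (M ^ ((1/4):ℝ) * T0 ^ ((1/2):ℝ) * T ^ (-(1/4):ℝ)) * μ ^ 2 := by
      rw [hr, mul_pow, mul_pow, mul_pow, sqr _ _ hM0.le, sqr _ _ hT'.le, sqr _ _ hT0.le,
        show 2 * (δ - 1/8) = (2 * δ - 1/2) + 1/4 by ring, Real.rpow_add hM0,
        show 2 * (-(1/8):ℝ) = -(1/4) by norm_num, show (2:ℝ) * (1/4) = 1/2 by norm_num]
      ring
    rw [h3, h5]
    calc _ = (2:ℝ) ^ ((1/2):ℝ) * (M ^ (2 * δ - 1/2) * (M ^ ((1/4):ℝ) * T0 ^ ((1/2):ℝ) * T ^ (-(1/4):ℝ)) * μ ^ 2) := by ring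
      _ ≤ _ := by gcongr
  have h6 : I ^ 2 ≤ (2 * C1 * C2) * (p + q + r) ^ 2 := by
    calc I ^ 2 ≤ _ := h2
      _ = C1 * C2 * (M ^ (2 * δ - 1/2) * (Real.sqrt (M * T) * μ) + M ^ (2 * δ - 1/2) * ((1 / M) * μ * μ) +
          M ^ (2 * δ - 1/2) * ((2 * Real.sqrt M * T0 / Real.sqrt T) ^ ((1/2):ℝ) * μ * μ)) := by ring
      _ ≤ C1 * C2 * (p ^ 2 + q ^ 2 + 2 * r ^ 2) := by
        rw [ep]; gcongr
      _ ≤ C1 * C2 * (2 * (p + q + r) ^ 2) := by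
        gcongr
        nlinarith [mul_nonneg hp0 hq0, mul_nonneg hp0 hr0, mul_nonneg hq0 hr0]
      _ = _ := by ring
  rw [← pow_le_pow_iff_left₀ hI0 (by positivity) two_ne_zero, mul_pow, Real.sq_sqrt (by positivity)]
  exact h6

end DivM

namespace DivM

lemma summable_div_rpow {p : ℝ} (hp : p < -1) : Summable (fun n : ℕ => (divfun n : ℝ) * (n:ℝ) ^ p) := by
  obtain ⟨C, hC, hd⟩ := divfun_le ((-1 - p) / 2) (by linarith)
  refine Summable.of_nonneg_of_le (fun n => by positivity) (fun n => ?_)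
    ((Real.summable_nat_rpow (p := p + (-1 - p) / 2)).mpr (by linarith) |>.mul_left C)
  rcases Nat.eq_zero_or_pos n with h | h
  · subst h; simp [divfun]; positivity
  · have hn : (0:ℝ) < n := by exact_mod_cast h
    calc (divfun n : ℝ) * (n:ℝ) ^ p ≤ (C * (n:ℝ) ^ ((-1 - p) / 2)) * (n:ℝ) ^ p := by
          gcongr; exact hd n
      _ = _ := by rw [Real.rpow_add hn]; ring

noncomputable def rho (n : ℕ) (t : ℝ) : ℝ :=
  (1 / (Real.sqrt 2 * Real.pi)) * (1 / (n : ℝ) ^ ((3 : ℝ) / 4) * t ^ ((1 : ℝ) / 4) *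
      Real.cos (4 * Real.pi * Real.sqrt (n * t) - Real.pi / 4))

lemma R1_eq_rho (y x : ℝ) : R1 y x = ∑ n ∈ Finset.Icc 1 ⌊y⌋₊, (divfun n : ℝ) * rho n x := by
  unfold R1 rho
  rw [Finset.mul_sum]
  exact Finset.sum_congr rfl fun n _ => by ring

lemma continuous_rho (n : ℕ) : Continuous (rho n) := by
  unfold rho
  have : Continuous fun t : ℝ => t ^ ((1:ℝ)/4) := Real.continuous_rpow_const (by norm_num)
  fun_prop

lemma continuous_R1 (y : ℝ) : Continuous (R1 y) := by
  have : R1 y = fun x => ∑ n ∈ Finset.Icc 1 ⌊y⌋₊, (divfun n : ℝ) * rho n x := funext (R1_eq_rho y)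
  rw [this]
  exact continuous_finsetSum _ fun n _ => continuous_const.mul (continuous_rho n)

lemma hasDerivAt_ffx (n : ℕ) (hn : 1 ≤ n) (t : ℝ) (ht : 0 < t) :
    HasDerivAt (fun t => ffx t n) (-rho n t + (2:ℝ) ^ (-(1/2):ℝ) / (2 * Real.pi ^ 2) * ((3/4) * t ^ (-(1/4):ℝ)) * (n:ℝ) ^ (-(5/4):ℝ) *
    Real.cos (2 * Real.pi * (2 * Real.sqrt (n * t) + 1/8))) t := by
  have hn0 : (0:ℝ) < n := by exact_mod_cast hn
  have h1 : HasDerivAt (fun t : ℝ => t ^ ((3/4):ℝ)) ((3/4) * t ^ (-(1/4):ℝ)) t := by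
    have := Real.hasDerivAt_rpow_const (x := t) (p := 3/4) (Or.inl ht.ne')
    exact this.congr_deriv (by norm_num)
  have h2 : HasDerivAt (fun t : ℝ => Real.sqrt (n * t)) (n / (2 * Real.sqrt (n * t))) t := by
    have := ((hasDerivAt_id t).const_mul (n:ℝ)).sqrt (by simp; constructor <;> positivity)
    exact this.congr_deriv (by simp)
  have h3 : HasDerivAt (fun t : ℝ => 2 * Real.pi * (2 * Real.sqrt (n * t) + 1/8)) (2 * Real.pi * (2 * (n / (2 * Real.sqrt (n * t))))) t :=
    ((h2.const_mul 2).add_const _).const_mul _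
  have h4 := (((h1.const_mul ((2:ℝ) ^ (-(1/2):ℝ) / (2 * Real.pi ^ 2))).mul_const ((n:ℝ) ^ (-(5/4):ℝ))).mul h3.cos)
  refine h4.congr_deriv ?_
  have hsin : Real.sin (2 * Real.pi * (2 * Real.sqrt (n * t) + 1/8)) = Real.cos (4 * Real.pi * Real.sqrt (n * t) - Real.pi / 4) := by
    rw [show 2 * Real.pi * (2 * Real.sqrt (n * t) + 1/8) = 4 * Real.pi * Real.sqrt (n * t) + Real.pi / 4 by ring,
      Real.sin_add, Real.cos_sub, Real.cos_pi_div_four, Real.sin_pi_div_four]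
    ring
  rw [hsin]
  unfold rho
  set c := Real.cos (4 * Real.pi * Real.sqrt (n * t) - Real.pi / 4)
  have e1 : (2:ℝ) ^ (-(1/2):ℝ) = 1 / Real.sqrt 2 := by
    rw [Real.rpow_neg (by norm_num), Real.sqrt_eq_rpow, one_div ((2:ℝ) ^ (1/2:ℝ))]
  have e2 : (n:ℝ) ^ (-(5/4):ℝ) * n * t ^ ((3/4):ℝ) = 1 / (n:ℝ) ^ ((3:ℝ)/4) * t ^ ((1:ℝ)/4) * Real.sqrt (n * t) := by
    rw [Real.sqrt_eq_rpow, Real.mul_rpow hn0.le ht.le, one_div, ← Real.rpow_neg hn0.le]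
    rw [show (n:ℝ) ^ (-(3/4):ℝ) * t ^ ((1:ℝ)/4) * ((n:ℝ) ^ ((1:ℝ)/2) * t ^ ((1:ℝ)/2)) =
      ((n:ℝ) ^ (-(3/4):ℝ) * (n:ℝ) ^ ((1:ℝ)/2)) * (t ^ ((1:ℝ)/4) * t ^ ((1:ℝ)/2)) by ring]
    rw [← Real.rpow_add hn0, ← Real.rpow_add ht]
    nth_rw 2 [← Real.rpow_one (n:ℝ)]
    rw [← Real.rpow_add hn0]
    norm_num
  have hs : Real.sqrt (n * t) ≠ 0 := (Real.sqrt_pos.mpr (by positivity)).ne'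
  have hpi := Real.pi_ne_zero
  have e3 : (n:ℝ) ^ (-(5/4):ℝ) * n * t ^ ((3/4):ℝ) / Real.sqrt (n * t) = 1 / (n:ℝ) ^ ((3:ℝ)/4) * t ^ ((1:ℝ)/4) := by
    rw [e2]; field_simp
  have e4 : (2:ℝ) ^ (-(1/2):ℝ) / (2 * Real.pi ^ 2) * t ^ ((3/4):ℝ) * (n:ℝ) ^ (-(5/4):ℝ) * (-c * (2 * Real.pi * (2 * (n / (2 * Real.sqrt (n * t)))))) =
      -(1 / (Real.sqrt 2 * Real.pi) * ((n:ℝ) ^ (-(5/4):ℝ) * n * t ^ ((3/4):ℝ) / Real.sqrt (n * t) * c)) := by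
    rw [e1]
    have : Real.sqrt 2 ≠ 0 := by positivity
    field_simp
  rw [e4, e3]
  ring

lemma ffx_diff (n : ℕ) (hn : 1 ≤ n) (x H : ℝ) (hx : 1 ≤ x) (hH : 0 < H) :
    |ffx (x + H) n - ffx x n + ∫ t in x..(x+H), rho n t| ≤ H * (n:ℝ) ^ (-(5/4):ℝ) := by
  have hpos : ∀ t ∈ Set.uIcc x (x+H), 1 ≤ t := by
    intro t ht
    rw [Set.uIcc_of_le (by linarith)] at ht
    linarith [ht.1]
  set q : ℝ → ℝ := fun t => (2:ℝ) ^ (-(1/2):ℝ) / (2 * Real.pi ^ 2) * ((3/4) * t ^ (-(1/4):ℝ)) * (n:ℝ) ^ (-(5/4):ℝ) *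
    Real.cos (2 * Real.pi * (2 * Real.sqrt (n * t) + 1/8)) with hq
  have hqc : ContinuousOn q (Set.uIcc x (x+H)) := by
    have : ContinuousOn (fun t : ℝ => t ^ (-(1/4):ℝ)) (Set.uIcc x (x+H)) := by
      intro t ht
      exact (Real.continuousAt_rpow_const t _ (Or.inl (by linarith [hpos t ht]))).continuousWithinAt
    simp only [hq]
    fun_prop
  have hqi : IntervalIntegrable q volume x (x+H) := hqc.intervalIntegrable
  have hri : IntervalIntegrable (rho n) volume x (x+H) := (continuous_rho n).intervalIntegrable _ _
  have h1 := intervalIntegral.integral_eq_sub_of_hasDerivAt (f := fun t => ffx t n) (f' := fun t => -rho n t + q t)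
    (a := x) (b := x + H) (fun t ht => hasDerivAt_ffx n hn t (by linarith [hpos t ht])) (hri.neg.add hqi)
  have h1' := intervalIntegral.integral_add hri.neg hqi
  simp only [Pi.neg_apply, intervalIntegral.integral_neg] at h1'
  rw [h1'] at h1
  have h2 : ffx (x + H) n - ffx x n + ∫ t in x..(x+H), rho n t = ∫ t in x..(x+H), q t := by
    linarith
  rw [h2]
  have h3 := intervalIntegral.norm_integral_le_of_norm_le_const (a := x) (b := x+H) (f := q) (C := (n:ℝ) ^ (-(5/4):ℝ)) (by
    intro t ht
    have ht1 : 1 ≤ t := hpos t (Set.uIoc_subset_uIcc ht)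
    have hpi := Real.pi_gt_three
    simp only [hq]
    rw [norm_mul, norm_mul, Real.norm_of_nonneg (show 0 ≤ (2:ℝ) ^ (-(1/2):ℝ) / (2 * Real.pi ^ 2) * ((3/4) * t ^ (-(1/4):ℝ)) by positivity),
      Real.norm_of_nonneg (show 0 ≤ (n:ℝ) ^ (-(5/4):ℝ) by positivity)]
    have a1 : ‖Real.cos (2 * Real.pi * (2 * Real.sqrt (n * t) + 1/8))‖ ≤ 1 := Real.abs_cos_le_one _
    have a2 : t ^ (-(1/4):ℝ) ≤ 1 := Real.rpow_le_one_of_one_le_of_nonpos ht1 (by norm_num)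
    have a3 : (2:ℝ) ^ (-(1/2):ℝ) ≤ 1 := Real.rpow_le_one_of_one_le_of_nonpos (by norm_num) (by norm_num)
    have a4 : (2:ℝ) ^ (-(1/2):ℝ) / (2 * Real.pi ^ 2) ≤ 1 := by
      rw [div_le_one (by positivity)]; nlinarith
    have a5 : (2:ℝ) ^ (-(1/2):ℝ) / (2 * Real.pi ^ 2) * ((3/4) * t ^ (-(1/4):ℝ)) ≤ 1 :=
      mul_le_one₀ a4 (by positivity) (by linarith)
    calc _ ≤ 1 * (n:ℝ) ^ (-(5/4):ℝ) * 1 := by gcongr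
      _ = _ := by ring)
  rw [Real.norm_eq_abs] at h3
  refine h3.trans (le_of_eq ?_)
  rw [show x + H - x = H by ring, abs_of_pos hH]; ring

lemma EE_tail : ∃ C : ℝ, 0 < C ∧ ∀ z N : ℝ, 0 ≤ z → 1 ≤ N →
    |EE z - ∑ n ∈ Finset.Icc 1 ⌊N⌋₊, (divfun n : ℝ) * ffx z n| ≤ C * (z ^ ((3/4):ℝ) * N ^ (-(24/100):ℝ)) := by
  have hs := summable_div_rpow (p := -(101/100)) (by norm_num)
  set S := ∑' n : ℕ, (divfun n : ℝ) * (n:ℝ) ^ (-(101/100):ℝ) with hS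
  have hS0 : 0 ≤ S := tsum_nonneg fun n => by positivity
  refine ⟨S + 1, by positivity, fun z N hz hN => ?_⟩
  have hN0 : 0 < N := by linarith
  have hEE : HasSum (fun n : ℕ => (divfun n : ℝ) * ffx z n) (EE z) := by
    have h1 : Summable (fun n : ℕ => (divfun n : ℝ) * ffx z n) := by
      refine Summable.of_norm_bounded (((summable_div_rpow (p := -(5/4)) (by norm_num)).mul_left ((2:ℝ) ^ (-(1/2):ℝ) / (2 * Real.pi ^ 2) * z ^ ((3/4):ℝ)))) fun n => ?_
      rw [norm_mul, Real.norm_of_nonneg (by positivity), Real.norm_eq_abs]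
      have := abs_ffx_le hz n
      calc (divfun n : ℝ) * |ffx z n| ≤ (divfun n : ℝ) * ((2:ℝ) ^ (-(1/2):ℝ) / (2 * Real.pi ^ 2) * z ^ ((3/4):ℝ) * (n:ℝ) ^ (-(5/4):ℝ)) := by gcongr
        _ = _ := by ring
    have h2 : EE z = ∑' n : ℕ, (divfun n : ℝ) * ffx z n := by
      unfold EE
      refine PNat.coe_injective.tsum_eq (f := fun n : ℕ => (divfun n : ℝ) * ffx z n) ?_
      intro n hn
      rcases Nat.eq_zero_or_pos n with h | h
      · exfalso; apply hn; subst h; simp [divfun]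
      · exact ⟨⟨n, h⟩, rfl⟩
    rw [h2]; exact h1.hasSum
  have hfin : HasSum (fun n : ℕ => if n ∈ Finset.Icc 1 ⌊N⌋₊ then (divfun n : ℝ) * ffx z n else 0)
      (∑ n ∈ Finset.Icc 1 ⌊N⌋₊, if n ∈ Finset.Icc 1 ⌊N⌋₊ then (divfun n : ℝ) * ffx z n else 0) :=
    hasSum_sum_of_ne_finset_zero fun n hn => by simp only [hn, if_false]
  rw [Finset.sum_congr rfl (fun n hn => if_pos hn)] at hfin
  have h3 := hEE.sub hfin
  rw [← h3.tsum_eq, ← Real.norm_eq_abs]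
  have h4 := hs.hasSum.mul_left (z ^ ((3/4):ℝ) * N ^ (-(24/100):ℝ))
  refine (tsum_of_norm_bounded h4 fun n => ?_).trans ?_
  · by_cases hn : n ∈ Finset.Icc 1 ⌊N⌋₊
    · simp only [hn, if_true, sub_self, norm_zero]; positivity
    · simp only [hn, if_false, sub_zero]
      rcases Nat.eq_zero_or_pos n with h | h
      · subst h; simp [divfun]
      · have hnN : N < n := by
          rw [Finset.mem_Icc] at hn
          push Not at hn
          exact (Nat.floor_lt hN0.le).mp (hn h)
        have hn0 : (0:ℝ) < n := by exact_mod_cast h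
        rw [norm_mul, Real.norm_of_nonneg (by positivity), Real.norm_eq_abs]
        have h5 := abs_ffx_le hz n
        have a3 : (2:ℝ) ^ (-(1/2):ℝ) ≤ 1 := Real.rpow_le_one_of_one_le_of_nonpos (by norm_num) (by norm_num)
        have a4 : (2:ℝ) ^ (-(1/2):ℝ) / (2 * Real.pi ^ 2) ≤ 1 := by
          rw [div_le_one (by positivity)]; nlinarith [Real.pi_gt_three]
        have h6 : (n:ℝ) ^ (-(5/4):ℝ) ≤ N ^ (-(24/100):ℝ) * (n:ℝ) ^ (-(101/100):ℝ) := by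
          rw [show (-(5/4):ℝ) = -(24/100) + -(101/100) by norm_num, Real.rpow_add hn0]
          exact mul_le_mul_of_nonneg_right (Real.rpow_le_rpow_of_nonpos hN0 hnN.le (by norm_num)) (by positivity)
        calc (divfun n : ℝ) * |ffx z n| ≤ (divfun n : ℝ) * (1 * z ^ ((3/4):ℝ) * (N ^ (-(24/100):ℝ) * (n:ℝ) ^ (-(101/100):ℝ))) := by
              refine mul_le_mul_of_nonneg_left (h5.trans ?_) (by positivity)
              gcongr
          _ = _ := by ring
  · have : 0 ≤ z ^ ((3/4):ℝ) * N ^ (-(24/100):ℝ) := by positivity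
    rw [← hS]; nlinarith

lemma Rwin : ∃ C : ℝ, 0 < C ∧ ∀ x H N : ℝ, 1 ≤ x → 0 < H → H ≤ Real.sqrt x → 1 ≤ N →
    |(∫ u in x..(x+H), DirichletDelta u) - ∫ t in x..(x+H), R1 N t| ≤
      C * (H + x ^ ((1/4):ℝ) + x ^ ((3/4):ℝ) * N ^ (-(24/100):ℝ)) := by
  obtain ⟨C1, hC1, hV⟩ := PropV
  obtain ⟨C2, hC2, hT⟩ := EE_tail
  have hs := summable_div_rpow (p := -(5/4)) (by norm_num)
  set S := ∑' n : ℕ, (divfun n : ℝ) * (n:ℝ) ^ (-(5/4):ℝ) with hS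
  have hS0 : 0 ≤ S := tsum_nonneg fun n => by positivity
  refine ⟨C1 + 3 * C2 + S, by positivity, fun x H N hx hH hHx hN => ?_⟩
  have a1 := hV x H hx hH hHx
  have a2 := hT x N (by linarith) hN
  have a3 := hT (x+H) N (by linarith) hN
  have hR : ∫ t in x..(x+H), R1 N t = ∑ n ∈ Finset.Icc 1 ⌊N⌋₊, (divfun n : ℝ) * ∫ t in x..(x+H), rho n t := by
    simp_rw [R1_eq_rho]
    rw [intervalIntegral.integral_finsetSum]
    · exact Finset.sum_congr rfl fun n _ => intervalIntegral.integral_const_mul _ _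
    · intro n _
      exact (continuous_const.mul (continuous_rho n)).intervalIntegrable _ _
  have a4 : |(∑ n ∈ Finset.Icc 1 ⌊N⌋₊, (divfun n : ℝ) * ffx (x+H) n) - (∑ n ∈ Finset.Icc 1 ⌊N⌋₊, (divfun n : ℝ) * ffx x n) +
      ∫ t in x..(x+H), R1 N t| ≤ H * S := by
    rw [hR, ← Finset.sum_sub_distrib, ← Finset.sum_add_distrib]
    refine (Finset.abs_sum_le_sum_abs _ _).trans ?_
    calc _ ≤ ∑ n ∈ Finset.Icc 1 ⌊N⌋₊, H * ((divfun n : ℝ) * (n:ℝ) ^ (-(5/4):ℝ)) := by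
          refine Finset.sum_le_sum fun n hn => ?_
          have := ffx_diff n (Finset.mem_Icc.mp hn).1 x H hx hH
          rw [← mul_sub, ← mul_add, abs_mul, abs_of_nonneg (show (0:ℝ) ≤ divfun n by positivity)]
          calc _ ≤ (divfun n : ℝ) * (H * (n:ℝ) ^ (-(5/4):ℝ)) := by gcongr
            _ = _ := by ring
      _ = H * ∑ n ∈ Finset.Icc 1 ⌊N⌋₊, ((divfun n : ℝ) * (n:ℝ) ^ (-(5/4):ℝ)) := by rw [Finset.mul_sum]
      _ ≤ _ := by
        gcongr
        exact hs.sum_le_tsum _ fun n _ => by positivity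
  have hsx : Real.sqrt x ≤ x := by
    rw [Real.sqrt_le_left (by linarith)]; nlinarith
  have d : (x + H) ^ ((3/4):ℝ) ≤ 2 * x ^ ((3/4):ℝ) := by
    calc (x + H) ^ ((3/4):ℝ) ≤ (2 * x) ^ ((3/4):ℝ) :=
          Real.rpow_le_rpow (by linarith) (by linarith) (by norm_num)
      _ = (2:ℝ) ^ ((3/4):ℝ) * x ^ ((3/4):ℝ) := Real.mul_rpow (by norm_num) (by linarith)
      _ ≤ _ := by
        gcongr
        calc (2:ℝ) ^ ((3/4):ℝ) ≤ (2:ℝ) ^ (1:ℝ) := Real.rpow_le_rpow_of_exponent_le (by norm_num) (by norm_num)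
          _ = 2 := by simp
  have hNp : 0 ≤ N ^ (-(24/100):ℝ) := by positivity
  have d2 : C2 * ((x + H) ^ ((3/4):ℝ) * N ^ (-(24/100):ℝ)) ≤ 2 * C2 * (x ^ ((3/4):ℝ) * N ^ (-(24/100):ℝ)) := by
    calc _ ≤ C2 * ((2 * x ^ ((3/4):ℝ)) * N ^ (-(24/100):ℝ)) := by gcongr
      _ = _ := by ring
  have p0 : 0 ≤ x ^ ((1/4):ℝ) := by positivity
  have p1 : 0 ≤ x ^ ((3/4):ℝ) * N ^ (-(24/100):ℝ) := by positivity
  have q1 := mul_nonneg hC1.le p1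
  have q2 := mul_nonneg hC2.le p0
  have q3 := mul_nonneg hC2.le hH.le
  have q4 := mul_nonneg hS0 p0
  have q5 := mul_nonneg hS0 p1
  rw [abs_le] at *
  constructor <;> nlinarith [a1.1, a1.2, a2.1, a2.2, a3.1, a3.2, a4.1, a4.2]

end DivM

namespace DivM

lemma mono_Delta {u v : ℝ} (hu : 1 ≤ u) (huv : u ≤ v) :
    DirichletDelta u ≤ DirichletDelta v + (v - u) * (Real.log v + 2) := by
  unfold DirichletDelta
  have h1 : (∑ n ∈ Finset.Icc 1 ⌊u⌋₊, (divfun n : ℝ)) ≤ ∑ n ∈ Finset.Icc 1 ⌊v⌋₊, (divfun n : ℝ) :=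
    Finset.sum_le_sum_of_subset_of_nonneg (Finset.Icc_subset_Icc_right (Nat.floor_mono huv)) (fun _ _ _ => by positivity)
  have h2 : u * (Real.log v - Real.log u) ≤ v - u := by
    have hu0 : 0 < u := by linarith
    rw [← Real.log_div (by linarith) (by linarith)]
    have := Real.log_le_sub_one_of_pos (x := v / u) (div_pos (by linarith) hu0)
    calc u * Real.log (v / u) ≤ u * (v / u - 1) := by gcongr
      _ = v - u := by field_simp
  have h3 := Real.one_half_lt_eulerMascheroniConstant
  have h4 := Real.eulerMascheroniConstant_lt_two_thirds
  nlinarith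

lemma sandwich_up {x H : ℝ} (hx : 1 ≤ x) (hH : 0 < H) :
    H * DirichletDelta x ≤ (∫ u in x..(x+H), DirichletDelta u) + H ^ 2 * (Real.log (x + H) + 2) := by
  have hi := Delta_intervalIntegrable x (x+H) (by linarith) (by linarith)
  have hl : 0 ≤ Real.log (x+H) := Real.log_nonneg (by linarith)
  have h1 : ∫ u in x..(x+H), (DirichletDelta x - H * (Real.log (x+H) + 2)) ≤ ∫ u in x..(x+H), DirichletDelta u := by
    refine intervalIntegral.integral_mono_on (by linarith) (by simp) hi fun u hu => ?_
    have h2 := mono_Delta hx hu.1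
    have h3 : (u - x) * (Real.log u + 2) ≤ H * (Real.log (x+H) + 2) := by
      have : Real.log u ≤ Real.log (x+H) := Real.log_le_log (by linarith [hu.1]) hu.2
      have h5 : 0 ≤ Real.log u := Real.log_nonneg (by linarith [hu.1])
      apply mul_le_mul <;> linarith [hu.1, hu.2]
    linarith
  rw [intervalIntegral.integral_const, smul_eq_mul, show x + H - x = H by ring] at h1
  nlinarith

lemma sandwich_lo {x H : ℝ} (hx : 1 ≤ x - H) (hH : 0 < H) :
    (∫ u in (x-H)..x, DirichletDelta u) ≤ H * DirichletDelta x + H ^ 2 * (Real.log x + 2) := by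
  have hi := Delta_intervalIntegrable (x-H) x (by linarith) (by linarith)
  have hl : 0 ≤ Real.log x := Real.log_nonneg (by linarith)
  have h1 : ∫ u in (x-H)..x, DirichletDelta u ≤ ∫ u in (x-H)..x, (DirichletDelta x + H * (Real.log x + 2)) := by
    refine intervalIntegral.integral_mono_on (by linarith) hi (by simp) fun u hu => ?_
    have h2 := mono_Delta (show 1 ≤ u by linarith [hu.1]) hu.2
    have h3 : (x - u) * (Real.log x + 2) ≤ H * (Real.log x + 2) := by
      apply mul_le_mul_of_nonneg_right <;> linarith [hu.1, hu.2]
    linarith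
  rw [intervalIntegral.integral_const, smul_eq_mul, show x - (x - H) = H by ring] at h1
  nlinarith

lemma PW : ∃ C : ℝ, 0 < C ∧ ∀ T x H N c : ℝ, 10 ≤ T → T ≤ x → x ≤ 2 * T → 0 < H → H ^ 3 ≤ T → 1 ≤ N →
    H * |DirichletDelta x - c| ≤ (∫ t in (x-H)..(x+H), |R1 N t - c|) +
      C * (H ^ 2 * (1 + Real.log T) + H + T ^ ((1/4):ℝ) + T ^ ((3/4):ℝ) * N ^ (-(24/100):ℝ)) := by
  obtain ⟨C, hC, hR⟩ := Rwin
  refine ⟨4 + 2 * C, by positivity, fun T x H N c hT hTx hxT hH hH3 hN => ?_⟩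
  have hH2 : H ^ 2 ≤ T / 2 := by
    by_cases h : H ≤ 2
    · nlinarith
    · push Not at h
      nlinarith [sq_nonneg H]
  have hH1 : H ≤ T / 2 := by
    by_cases h : H ≤ 2
    · linarith
    · push Not at h
      nlinarith
  have hT0 : 0 < T := by linarith
  have hlT : 0 ≤ Real.log T := Real.log_nonneg (by linarith)
  have hlog : Real.log (x + H) ≤ 2 + Real.log T := by
    have : Real.log (x+H) ≤ Real.log (3 * T) := Real.log_le_log (by linarith) (by linarith)
    rw [Real.log_mul (by norm_num) hT0.ne'] at this
    have h3 := Real.log_le_sub_one_of_pos (x := 3) (by norm_num)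
    linarith
  have hlog2 : Real.log x ≤ 2 + Real.log T := (Real.log_le_log (by linarith) (by linarith)).trans hlog
  have b1 := hR x H N (by linarith) hH (Real.le_sqrt_of_sq_le (by linarith)) hN
  have b2 := hR (x-H) H N (by linarith) hH (Real.le_sqrt_of_sq_le (by linarith)) hN
  rw [sub_add_cancel] at b2
  have pw : ∀ a : ℝ, 0 < a → a ≤ 1 → ∀ z, 0 ≤ z → z ≤ 2 * T → z ^ a ≤ 2 * T ^ a := by
    intro a ha ha1 z hz hzT
    calc z ^ a ≤ (2 * T) ^ a := Real.rpow_le_rpow hz hzT ha.le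
      _ = (2:ℝ) ^ a * T ^ a := Real.mul_rpow (by norm_num) hT0.le
      _ ≤ _ := by
        gcongr
        calc (2:ℝ) ^ a ≤ (2:ℝ) ^ (1:ℝ) := Real.rpow_le_rpow_of_exponent_le (by norm_num) ha1
          _ = 2 := by simp
  have c1 := pw (1/4) (by norm_num) (by norm_num) x (by linarith) hxT
  have c2 := pw (3/4) (by norm_num) (by norm_num) x (by linarith) hxT
  have c3 := pw (1/4) (by norm_num) (by norm_num) (x-H) (by linarith) (by linarith)
  have c4 := pw (3/4) (by norm_num) (by norm_num) (x-H) (by linarith) (by linarith)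
  have hNp : 0 ≤ N ^ (-(24/100):ℝ) := by positivity
  set E := H + T ^ ((1/4):ℝ) + T ^ ((3/4):ℝ) * N ^ (-(24/100):ℝ) with hE
  have d1 : C * (H + x ^ ((1/4):ℝ) + x ^ ((3/4):ℝ) * N ^ (-(24/100):ℝ)) ≤ 2 * C * E := by
    rw [mul_comm 2 C, mul_assoc]
    apply mul_le_mul_of_nonneg_left _ hC.le
    nlinarith
  have d2 : C * (H + (x-H) ^ ((1/4):ℝ) + (x-H) ^ ((3/4):ℝ) * N ^ (-(24/100):ℝ)) ≤ 2 * C * E := by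
    rw [mul_comm 2 C, mul_assoc]
    apply mul_le_mul_of_nonneg_left _ hC.le
    nlinarith
  have b1' := abs_le.mp (b1.trans d1)
  have b2' := abs_le.mp (b2.trans d2)
  have s1 := sandwich_up (x := x) (H := H) (by linarith) hH
  have s2 := sandwich_lo (x := x) (H := H) (by linarith) hH
  have hc : Continuous fun t => R1 N t - c := (continuous_R1 N).sub continuous_const
  have i1 : ∀ a b, IntervalIntegrable (fun t => |R1 N t - c|) volume a b := fun a b => hc.abs.intervalIntegrable _ _
  have hsplit := intervalIntegral.integral_add_adjacent_intervals (i1 (x-H) x) (i1 x (x+H))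
  have n1 : 0 ≤ ∫ t in (x-H)..x, |R1 N t - c| := intervalIntegral.integral_nonneg (by linarith) fun _ _ => abs_nonneg _
  have n2 : 0 ≤ ∫ t in x..(x+H), |R1 N t - c| := intervalIntegral.integral_nonneg (by linarith) fun _ _ => abs_nonneg _
  have u1 : (∫ t in x..(x+H), R1 N t) - H * c ≤ ∫ t in x..(x+H), |R1 N t - c| := by
    have h1 : ∫ t in x..(x+H), (R1 N t - c) = (∫ t in x..(x+H), R1 N t) - H * c := by
      rw [intervalIntegral.integral_sub ((continuous_R1 N).intervalIntegrable _ _) (by simp), intervalIntegral.integral_const]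
      simp
    rw [← h1]
    exact intervalIntegral.integral_mono_on (by linarith) (hc.intervalIntegrable _ _) (i1 _ _) fun t _ => le_abs_self _
  have u2 : H * c - (∫ t in (x-H)..x, R1 N t) ≤ ∫ t in (x-H)..x, |R1 N t - c| := by
    have h1 : ∫ t in (x-H)..x, (c - R1 N t) = H * c - (∫ t in (x-H)..x, R1 N t) := by
      rw [intervalIntegral.integral_sub (by simp) ((continuous_R1 N).intervalIntegrable _ _), intervalIntegral.integral_const]
      simp
    rw [← h1]
    refine intervalIntegral.integral_mono_on (by linarith) ((continuous_const.sub (continuous_R1 N)).intervalIntegrable _ _) (i1 _ _) fun t _ => ?_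
    rw [abs_sub_comm]; exact le_abs_self _
  have g1 : H ^ 2 * (Real.log (x+H) + 2) ≤ 4 * (H ^ 2 * (1 + Real.log T)) := by
    have : Real.log (x+H) + 2 ≤ 4 * (1 + Real.log T) := by linarith
    have h9 := mul_le_mul_of_nonneg_left this (sq_nonneg H)
    linarith
  have g2 : H ^ 2 * (Real.log x + 2) ≤ 4 * (H ^ 2 * (1 + Real.log T)) := by
    have : Real.log x + 2 ≤ 4 * (1 + Real.log T) := by linarith
    have h9 := mul_le_mul_of_nonneg_left this (sq_nonneg H)
    linarith
  have hE0 : 0 ≤ E := by positivity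
  have hG0 : 0 ≤ H ^ 2 * (1 + Real.log T) := by positivity
  have key : C * (H ^ 2 * (1 + Real.log T)) ≥ 0 := by positivity
  have target : (4 + 2 * C) * (H ^ 2 * (1 + Real.log T) + H + T ^ ((1/4):ℝ) + T ^ ((3/4):ℝ) * N ^ (-(24/100):ℝ)) =
      (4 + 2 * C) * (H ^ 2 * (1 + Real.log T)) + (4 + 2 * C) * E := by rw [hE]; ring
  rw [target, ← hsplit]
  rcases abs_cases (DirichletDelta x - c) with ⟨h, _⟩ | ⟨h, _⟩ <;> rw [h] <;> linarith [b1'.1, b1'.2, b2'.1, b2'.2]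

lemma sum_div_le (a b : ℝ) (hb : 0 ≤ b) (hab : 1 < a + b) : ∃ C : ℝ, 0 < C ∧ ∀ N : ℝ, 1 ≤ N →
    ∑ n ∈ Finset.Icc 1 ⌊N⌋₊, (divfun n : ℝ) * (n:ℝ) ^ (-a) ≤ C * N ^ b := by
  have hs := summable_div_rpow (p := -(a+b)) (by linarith)
  set S := ∑' n : ℕ, (divfun n : ℝ) * (n:ℝ) ^ (-(a+b)) with hS
  have hS0 : 0 ≤ S := tsum_nonneg fun n => by positivity
  refine ⟨S + 1, by positivity, fun N hN => ?_⟩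
  have hN0 : 0 < N := by linarith
  calc _ ≤ ∑ n ∈ Finset.Icc 1 ⌊N⌋₊, ((divfun n : ℝ) * (n:ℝ) ^ (-(a+b))) * N ^ b := by
        refine Finset.sum_le_sum fun n hn => ?_
        rw [Finset.mem_Icc] at hn
        have hn0 : (0:ℝ) < n := by exact_mod_cast hn.1
        have hnN : (n:ℝ) ≤ N := (Nat.le_floor_iff hN0.le).mp hn.2
        rw [show -a = -(a+b) + b by ring, Real.rpow_add hn0, ← mul_assoc]
        exact mul_le_mul_of_nonneg_left (Real.rpow_le_rpow hn0.le hnN hb) (by positivity)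
    _ = (∑ n ∈ Finset.Icc 1 ⌊N⌋₊, ((divfun n : ℝ) * (n:ℝ) ^ (-(a+b)))) * N ^ b := by rw [Finset.sum_mul]
    _ ≤ S * N ^ b := by
        gcongr
        exact hs.sum_le_tsum _ fun n _ => by positivity
    _ ≤ _ := by gcongr; linarith

lemma const_le_one : 1 / (Real.sqrt 2 * Real.pi) ≤ 1 := by
  have h1 : 1 ≤ Real.sqrt 2 := Real.one_le_sqrt.mpr (by norm_num)
  have h2 := Real.pi_gt_three
  rw [div_le_one (by positivity)]; nlinarith

lemma abs_rho_le (n : ℕ) {t : ℝ} (ht : 0 ≤ t) : |rho n t| ≤ (n:ℝ) ^ (-(3/4):ℝ) * t ^ ((1/4):ℝ) := by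
  unfold rho
  rw [abs_mul, abs_mul, abs_of_nonneg (show 0 ≤ 1 / (Real.sqrt 2 * Real.pi) by positivity),
    abs_of_nonneg (show 0 ≤ 1 / (n:ℝ) ^ ((3:ℝ)/4) * t ^ ((1:ℝ)/4) by positivity), one_div ((n:ℝ) ^ ((3:ℝ)/4)), ← Real.rpow_neg (by positivity)]
  have := const_le_one
  have h2 := Real.abs_cos_le_one (4 * Real.pi * Real.sqrt (n * t) - Real.pi / 4)
  calc _ ≤ 1 * ((n:ℝ) ^ (-(3/4):ℝ) * t ^ ((1/4):ℝ) * 1) := by gcongr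
    _ = _ := by ring

lemma abs_R1_le : ∃ C : ℝ, 0 < C ∧ ∀ N t : ℝ, 1 ≤ N → 0 ≤ t → |R1 N t| ≤ C * (t ^ ((1/4):ℝ) * N ^ ((26/100):ℝ)) := by
  obtain ⟨C, hC, h⟩ := sum_div_le (3/4) (26/100) (by norm_num) (by norm_num)
  refine ⟨C, hC, fun N t hN ht => ?_⟩
  rw [R1_eq_rho]
  refine (Finset.abs_sum_le_sum_abs _ _).trans ?_
  calc _ ≤ ∑ n ∈ Finset.Icc 1 ⌊N⌋₊, ((divfun n : ℝ) * (n:ℝ) ^ (-(3/4):ℝ)) * t ^ ((1/4):ℝ) := by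
        refine Finset.sum_le_sum fun n _ => ?_
        rw [abs_mul, abs_of_nonneg (show (0:ℝ) ≤ divfun n by positivity), mul_assoc]
        exact mul_le_mul_of_nonneg_left (abs_rho_le n ht) (by positivity)
    _ = (∑ n ∈ Finset.Icc 1 ⌊N⌋₊, ((divfun n : ℝ) * (n:ℝ) ^ (-(3/4):ℝ))) * t ^ ((1/4):ℝ) := by rw [Finset.sum_mul]
    _ ≤ (C * N ^ ((26/100):ℝ)) * t ^ ((1/4):ℝ) := by gcongr; exact h N hN
    _ = _ := by ring

lemma rho_lip (n : ℕ) (hn : 1 ≤ n) {T t x : ℝ} (hT : 10 ≤ T) (ht : T/2 ≤ t) (hx : T/2 ≤ x) (hx3 : x ≤ 3 * T) :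
    |rho n t - rho n x| ≤ 30 * ((n:ℝ) ^ (-(1/4):ℝ) * T ^ (-(1/4):ℝ)) * |t - x| := by
  have hn0 : (0:ℝ) < n := by exact_mod_cast hn
  have hn1 : (1:ℝ) ≤ n := by exact_mod_cast hn
  have hT0 : 0 < T := by linarith
  have ht0 : 0 ≤ t := by linarith
  have hx0 : 0 ≤ x := by linarith
  have hsT : 0 < Real.sqrt T := Real.sqrt_pos.mpr hT0
  have st := Real.sq_sqrt ht0
  have sx := Real.sq_sqrt hx0
  have pt := Real.sqrt_nonneg t
  have px := Real.sqrt_nonneg x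
  have h1 : |Real.sqrt t - Real.sqrt x| ≤ |t - x| / Real.sqrt T := by
    rw [le_div_iff₀ hsT]
    have h6 : Real.sqrt T ≤ Real.sqrt t + Real.sqrt x := by
      apply Real.sqrt_le_iff.mpr ⟨by positivity, ?_⟩
      nlinarith [mul_nonneg pt px]
    calc _ ≤ |Real.sqrt t - Real.sqrt x| * |Real.sqrt t + Real.sqrt x| := by
          rw [abs_of_nonneg (show 0 ≤ Real.sqrt t + Real.sqrt x by positivity)]; gcongr
      _ = |t - x| := by rw [← abs_mul]; congr 1; nlinarith
  have rr : ∀ z : ℝ, 0 ≤ z → z ^ ((1:ℝ)/4) = Real.sqrt (Real.sqrt z) := by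
    intro z hz
    rw [Real.sqrt_eq_rpow, Real.sqrt_eq_rpow, ← Real.rpow_mul hz]; norm_num
  have h2 : |t ^ ((1:ℝ)/4) - x ^ ((1:ℝ)/4)| ≤ |t - x| / Real.sqrt T := by
    refine le_trans ?_ h1
    rw [rr t ht0, rr x hx0]
    have sst := Real.sq_sqrt pt
    have ssx := Real.sq_sqrt px
    have one1 : 1 ≤ Real.sqrt (Real.sqrt t) := Real.one_le_sqrt.mpr (Real.one_le_sqrt.mpr (by linarith))
    have one2 : 0 ≤ Real.sqrt (Real.sqrt x) := Real.sqrt_nonneg _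
    calc |Real.sqrt (Real.sqrt t) - Real.sqrt (Real.sqrt x)| ≤ |Real.sqrt (Real.sqrt t) - Real.sqrt (Real.sqrt x)| *
          |Real.sqrt (Real.sqrt t) + Real.sqrt (Real.sqrt x)| := by
            apply le_mul_of_one_le_right (abs_nonneg _)
            rw [abs_of_nonneg (by positivity)]; linarith
      _ = _ := by rw [← abs_mul]; congr 1; nlinarith
  set A := 4 * Real.pi * Real.sqrt (n * t) - Real.pi / 4 with hA
  set B := 4 * Real.pi * Real.sqrt (n * x) - Real.pi / 4 with hB
  have h3 : |Real.cos A - Real.cos B| ≤ 4 * Real.pi * Real.sqrt n * (|t - x| / Real.sqrt T) := by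
    have h4 : |Real.cos A - Real.cos B| ≤ |A - B| := by
      have := Real.lipschitzWith_cos.dist_le_mul A B
      simpa [Real.dist_eq] using this
    refine h4.trans ?_
    rw [hA, hB, Real.sqrt_mul hn0.le, Real.sqrt_mul hn0.le,
      show 4 * Real.pi * (Real.sqrt n * Real.sqrt t) - Real.pi / 4 - (4 * Real.pi * (Real.sqrt n * Real.sqrt x) - Real.pi / 4) =
        (4 * Real.pi * Real.sqrt n) * (Real.sqrt t - Real.sqrt x) by ring, abs_mul,
      abs_of_nonneg (show 0 ≤ 4 * Real.pi * Real.sqrt n by positivity)]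
    gcongr
  have hx4 : x ^ ((1:ℝ)/4) ≤ 2 * T ^ ((1:ℝ)/4) := by
    calc x ^ ((1:ℝ)/4) ≤ (16 * T) ^ ((1:ℝ)/4) := Real.rpow_le_rpow hx0 (by linarith) (by norm_num)
      _ = (16:ℝ) ^ ((1:ℝ)/4) * T ^ ((1:ℝ)/4) := Real.mul_rpow (by norm_num) hT0.le
      _ = _ := by
        rw [show (16:ℝ) = 2 ^ (4:ℝ) by norm_num, ← Real.rpow_mul (by norm_num)]; norm_num
  have h5 : |t ^ ((1:ℝ)/4) * Real.cos A - x ^ ((1:ℝ)/4) * Real.cos B| ≤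
      (1 + 2 * T ^ ((1:ℝ)/4) * (4 * Real.pi * Real.sqrt n)) * (|t - x| / Real.sqrt T) := by
    rw [show t ^ ((1:ℝ)/4) * Real.cos A - x ^ ((1:ℝ)/4) * Real.cos B =
      (t ^ ((1:ℝ)/4) - x ^ ((1:ℝ)/4)) * Real.cos A + x ^ ((1:ℝ)/4) * (Real.cos A - Real.cos B) by ring]
    refine (abs_add_le _ _).trans ?_
    rw [abs_mul, abs_mul, abs_of_nonneg (show 0 ≤ x ^ ((1:ℝ)/4) by positivity)]
    have := Real.abs_cos_le_one A
    calc _ ≤ (|t - x| / Real.sqrt T) * 1 + (2 * T ^ ((1:ℝ)/4)) * (4 * Real.pi * Real.sqrt n * (|t - x| / Real.sqrt T)) := by gcongr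
      _ = _ := by ring
  have hsn : 1 ≤ Real.sqrt n := Real.one_le_sqrt.mpr hn1
  have hT4 : 1 ≤ T ^ ((1:ℝ)/4) := Real.one_le_rpow (by linarith) (by norm_num)
  have h6 : 1 + 2 * T ^ ((1:ℝ)/4) * (4 * Real.pi * Real.sqrt n) ≤ (Real.sqrt 2 * Real.pi) * (30 * (T ^ ((1:ℝ)/4) * Real.sqrt n)) := by
    have hs2 : 1 ≤ Real.sqrt 2 := Real.one_le_sqrt.mpr (by norm_num)
    have hpi := Real.pi_gt_three
    have hTn : 1 ≤ T ^ ((1:ℝ)/4) * Real.sqrt n := by nlinarith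
    set q := T ^ ((1:ℝ)/4) * Real.sqrt n
    have : 1 + 2 * T ^ ((1:ℝ)/4) * (4 * Real.pi * Real.sqrt n) = 1 + 8 * Real.pi * q := by ring
    rw [this]
    have : Real.pi * (30 * q) ≤ Real.sqrt 2 * Real.pi * (30 * q) := by
      rw [mul_assoc]; apply le_mul_of_one_le_left (by positivity) hs2
    nlinarith
  unfold rho
  rw [show 1 / (Real.sqrt 2 * Real.pi) * (1 / (n:ℝ) ^ ((3:ℝ)/4) * t ^ ((1:ℝ)/4) * Real.cos A) -
    1 / (Real.sqrt 2 * Real.pi) * (1 / (n:ℝ) ^ ((3:ℝ)/4) * x ^ ((1:ℝ)/4) * Real.cos B) =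
    (1 / (Real.sqrt 2 * Real.pi) * (1 / (n:ℝ) ^ ((3:ℝ)/4))) * (t ^ ((1:ℝ)/4) * Real.cos A - x ^ ((1:ℝ)/4) * Real.cos B) by ring,
    abs_mul, abs_of_nonneg (show 0 ≤ 1 / (Real.sqrt 2 * Real.pi) * (1 / (n:ℝ) ^ ((3:ℝ)/4)) by positivity)]
  calc _ ≤ (1 / (Real.sqrt 2 * Real.pi) * (1 / (n:ℝ) ^ ((3:ℝ)/4))) * (((Real.sqrt 2 * Real.pi) * (30 * (T ^ ((1:ℝ)/4) * Real.sqrt n))) * (|t - x| / Real.sqrt T)) := by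
        refine mul_le_mul_of_nonneg_left (h5.trans ?_) (by positivity)
        gcongr
    _ = 30 * ((1 / (n:ℝ) ^ ((3:ℝ)/4) * Real.sqrt n) * (T ^ ((1:ℝ)/4) / Real.sqrt T)) * |t - x| := by
        have : Real.sqrt 2 * Real.pi ≠ 0 := by positivity
        field_simp
    _ = _ := by
        rw [Real.sqrt_eq_rpow, Real.sqrt_eq_rpow, one_div ((n:ℝ) ^ ((3:ℝ)/4)), ← Real.rpow_neg hn0.le, ← Real.rpow_add hn0, ← Real.rpow_sub hT0]
        norm_num

end DivM

namespace DivM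

lemma rpow_quarter_le {T t : ℝ} (hT : 0 < T) (ht : 0 ≤ t) (h : t ≤ 3 * T) : t ^ ((1/4):ℝ) ≤ 2 * T ^ ((1/4):ℝ) := by
  calc t ^ ((1/4):ℝ) ≤ (16 * T) ^ ((1/4):ℝ) := Real.rpow_le_rpow ht (by linarith) (by norm_num)
    _ = (16:ℝ) ^ ((1/4):ℝ) * T ^ ((1/4):ℝ) := Real.mul_rpow (by norm_num) hT.le
    _ = _ := by
      rw [show (16:ℝ) = 2 ^ (4:ℝ) by norm_num, ← Real.rpow_mul (by norm_num)]; norm_num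

lemma H_facts {T a : ℝ} (hT : 10 ≤ T) (ha : a ≤ 1/3) : (T ^ a) ^ 3 ≤ T ∧ T ^ a ≤ T / 2 := by
  have hT0 : 0 < T := by linarith
  have h3 : (T ^ a) ^ 3 ≤ T := by
    rw [← Real.rpow_natCast, ← Real.rpow_mul hT0.le]
    calc T ^ (a * (3:ℕ)) ≤ T ^ (1:ℝ) := Real.rpow_le_rpow_of_exponent_le (by linarith) (by push_cast; linarith)
      _ = T := Real.rpow_one T
  refine ⟨h3, ?_⟩
  have hp : 0 < T ^ a := by positivity
  set H := T ^ a
  by_cases h : H ≤ 2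
  · linarith
  · push Not at h
    have hH2 : H ^ 2 ≤ T / 2 := by nlinarith [sq_nonneg H]
    nlinarith

lemma one_add_log_le {T κ : ℝ} (hT : 1 ≤ T) (hκ : 0 < κ) : 1 + Real.log T ≤ (1 + 1 / κ) * T ^ κ := by
  have h1 := Real.log_le_rpow_div (x := T) (by linarith) hκ
  have h2 : 1 ≤ T ^ κ := Real.one_le_rpow hT hκ.le
  calc 1 + Real.log T ≤ T ^ κ + T ^ κ / κ := add_le_add h2 h1
    _ = _ := by ring

lemma R2_sup : ∃ C : ℝ, 0 < C ∧ ∀ T x : ℝ, 10 ≤ T → T ≤ x → x ≤ 2 * T →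
    |R2 (T ^ ((1:ℝ)/4)) x| ≤ C * T ^ ((34/100):ℝ) := by
  obtain ⟨C1, hC1, hP⟩ := PW
  obtain ⟨C2, hC2, hR⟩ := abs_R1_le
  refine ⟨8 * C2 + C1 * 205, by positivity, fun T x hT hTx hxT => ?_⟩
  have hT0 : 0 < T := by linarith
  have hT1 : 1 ≤ T := by linarith
  obtain ⟨f1, f2⟩ := H_facts (a := 1/3) hT le_rfl
  have le : ∀ a b : ℝ, a ≤ b → T ^ a ≤ T ^ b := fun a b h => Real.rpow_le_rpow_of_exponent_le hT1 h
  have hN1 : 1 ≤ T ^ ((1:ℝ)/3) := Real.one_le_rpow hT1 (by norm_num)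
  have hy1 : 1 ≤ T ^ ((1:ℝ)/4) := Real.one_le_rpow hT1 (by norm_num)
  set H := T ^ ((1:ℝ)/3) with hH
  have hH0 : 0 < H := by positivity
  have h1 := hP T x H H (R1 (T ^ ((1:ℝ)/4)) x) hT hTx hxT hH0 f1 hN1
  have hb : ∀ t ∈ Set.uIoc (x-H) (x+H), ‖|R1 H t - R1 (T ^ ((1:ℝ)/4)) x|‖ ≤ 4 * C2 * T ^ ((34/100):ℝ) := by
    intro t ht
    rw [Set.uIoc_of_le (by linarith)] at ht
    rw [Real.norm_eq_abs, abs_abs]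
    have a1 := hR H t hN1 (by linarith [ht.1])
    have a2 := hR (T ^ ((1:ℝ)/4)) x hy1 (by linarith)
    have a3 := rpow_quarter_le hT0 (show 0 ≤ t by linarith [ht.1]) (by linarith [ht.2])
    have a4 := rpow_quarter_le hT0 (show 0 ≤ x by linarith) (by linarith)
    have e1 : H ^ ((26/100):ℝ) ≤ T ^ ((9/100):ℝ) := by
      rw [hH, ← Real.rpow_mul hT0.le]; exact le _ _ (by norm_num)
    have e2 : (T ^ ((1:ℝ)/4)) ^ ((26/100):ℝ) ≤ T ^ ((9/100):ℝ) := by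
      rw [← Real.rpow_mul hT0.le]; exact le _ _ (by norm_num)
    have e3 : T ^ ((1/4):ℝ) * T ^ ((9/100):ℝ) = T ^ ((34/100):ℝ) := by rw [← Real.rpow_add hT0]; norm_num
    calc _ ≤ |R1 H t| + |R1 (T ^ ((1:ℝ)/4)) x| := abs_sub _ _
      _ ≤ C2 * ((2 * T ^ ((1/4):ℝ)) * T ^ ((9/100):ℝ)) + C2 * ((2 * T ^ ((1/4):ℝ)) * T ^ ((9/100):ℝ)) := by
          refine add_le_add (a1.trans ?_) (a2.trans ?_) <;> gcongr
      _ = 4 * C2 * (T ^ ((1/4):ℝ) * T ^ ((9/100):ℝ)) := by ring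
      _ = _ := by rw [e3]
  have h2 := intervalIntegral.norm_integral_le_of_norm_le_const hb
  rw [show x + H - (x - H) = 2 * H by ring, abs_of_pos (by positivity)] at h2
  have h3 := (Real.le_norm_self _).trans h2
  have hl := one_add_log_le (κ := 5/1000) hT1 (by norm_num)
  have g1 : H ^ 2 * (1 + Real.log T) ≤ H * (201 * T ^ ((34/100):ℝ)) := by
    have : H * T ^ ((5/1000):ℝ) ≤ T ^ ((34/100):ℝ) := by
      rw [hH, ← Real.rpow_add hT0]; exact le _ _ (by norm_num)
    norm_num at hl
    calc H ^ 2 * (1 + Real.log T) ≤ H ^ 2 * (201 * T ^ ((5/1000):ℝ)) := by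
          gcongr; norm_num; exact hl
      _ = H * (201 * (H * T ^ ((5/1000):ℝ))) := by ring
      _ ≤ _ := by gcongr
  have g2 : H ≤ H * T ^ ((34/100):ℝ) := le_mul_of_one_le_right hH0.le (Real.one_le_rpow hT1 (by norm_num))
  have g3 : T ^ ((1/4):ℝ) ≤ H * T ^ ((34/100):ℝ) := by
    rw [hH, ← Real.rpow_add hT0]; exact le _ _ (by norm_num)
  have g4 : T ^ ((3/4):ℝ) * H ^ (-(24/100):ℝ) ≤ H * T ^ ((34/100):ℝ) := by
    rw [hH, ← Real.rpow_mul hT0.le, ← Real.rpow_add hT0, ← Real.rpow_add hT0]; exact le _ _ (by norm_num)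
  have h4 : H * |R2 (T ^ ((1:ℝ)/4)) x| ≤ H * ((8 * C2 + C1 * 205) * T ^ ((34/100):ℝ)) := by
    unfold R2
    refine h1.trans ?_
    have : C1 * (H ^ 2 * (1 + Real.log T) + H + T ^ ((1/4):ℝ) + T ^ ((3/4):ℝ) * H ^ (-(24/100):ℝ)) ≤
        C1 * (205 * (H * T ^ ((34/100):ℝ))) := by
      apply mul_le_mul_of_nonneg_left _ hC1.le
      linarith
    linarith
  exact le_of_mul_le_mul_left h4 hH0

lemma R1_diff (M t : ℝ) (hM : 1 ≤ M) (ht : 0 ≤ t) : |R1 (2 * M) t - R1 M t| ≤ t ^ ((1/4):ℝ) * ‖ZZ M t‖ := by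
  have hM0 : 0 < M := by linarith
  have hfl : ⌊M⌋₊ ≤ ⌊2 * M⌋₊ := Nat.floor_mono (by linarith)
  have h1 : R1 (2 * M) t - R1 M t = ∑ n ∈ Finset.Ioc ⌊M⌋₊ ⌊2 * M⌋₊, (divfun n : ℝ) * rho n t := by
    rw [R1_eq_rho, R1_eq_rho, sub_eq_iff_eq_add, add_comm]
    have : ∀ k : ℕ, Finset.Icc 1 k = Finset.Ioc 0 k := fun k => rfl
    rw [this, this, Finset.sum_Ioc_consecutive _ (Nat.zero_le _) hfl]
  have h2 : R1 (2 * M) t - R1 M t = (1 / (Real.sqrt 2 * Real.pi)) * t ^ ((1/4):ℝ) * (e (-(1/8)) * ZZ M t).re := by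
    rw [h1]
    unfold ZZ
    rw [Finset.mul_sum, Complex.re_sum, Finset.mul_sum]
    refine Finset.sum_congr rfl fun n _ => ?_
    rw [mul_left_comm, Complex.re_ofReal_mul, ← e_add, e_re]
    unfold rho
    rw [show 2 * Real.pi * (-(1/8) + 2 * Real.sqrt (n * t)) = 4 * Real.pi * Real.sqrt (n * t) - Real.pi / 4 by ring]
    ring
  rw [h2, abs_mul, abs_of_nonneg (by positivity)]
  have h3 := Complex.abs_re_le_norm (e (-(1/8)) * ZZ M t)
  rw [norm_mul, norm_e, one_mul] at h3
  have := const_le_one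
  calc _ ≤ 1 * t ^ ((1/4):ℝ) * ‖ZZ M t‖ := by gcongr
    _ = _ := by ring

lemma R1_dyadic (y t : ℝ) (hy : 1 ≤ y) (ht : 0 ≤ t) (I : ℕ) :
    |R1 (2 ^ I * y) t - R1 y t| ≤ t ^ ((1/4):ℝ) * ∑ i ∈ Finset.range I, ‖ZZ (2 ^ i * y) t‖ := by
  induction I with
  | zero => simp
  | succ k ih =>
    rw [Finset.sum_range_succ, mul_add]
    have h1 := R1_diff (2 ^ k * y) t (by
      have : (1:ℝ) ≤ 2 ^ k := one_le_pow₀ (by norm_num)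
      nlinarith) ht
    rw [show (2:ℝ) ^ (k+1) * y = 2 * (2 ^ k * y) by ring]
    calc _ ≤ |R1 (2 * (2 ^ k * y)) t - R1 (2 ^ k * y) t| + |R1 (2 ^ k * y) t - R1 y t| := abs_sub_le _ _ _
      _ ≤ _ := by linarith

lemma R1_lip : ∃ C : ℝ, 0 < C ∧ ∀ T t x y : ℝ, 10 ≤ T → T/2 ≤ t → T/2 ≤ x → x ≤ 3 * T → 1 ≤ y →
    |R1 y t - R1 y x| ≤ C * (y ^ ((76/100):ℝ) * T ^ (-(1/4):ℝ) * |t - x|) := by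
  obtain ⟨C, hC, h⟩ := sum_div_le (1/4) (76/100) (by norm_num) (by norm_num)
  refine ⟨30 * C, by positivity, fun T t x y hT ht hx hx3 hy => ?_⟩
  have hT0 : 0 < T := by linarith
  rw [R1_eq_rho, R1_eq_rho, ← Finset.sum_sub_distrib]
  refine (Finset.abs_sum_le_sum_abs _ _).trans ?_
  calc _ ≤ ∑ n ∈ Finset.Icc 1 ⌊y⌋₊, ((divfun n : ℝ) * (n:ℝ) ^ (-(1/4):ℝ)) * (30 * T ^ (-(1/4):ℝ) * |t - x|) := by
        refine Finset.sum_le_sum fun n hn => ?_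
        rw [← mul_sub, abs_mul, abs_of_nonneg (show (0:ℝ) ≤ divfun n by positivity), mul_assoc]
        refine mul_le_mul_of_nonneg_left ((rho_lip n (Finset.mem_Icc.mp hn).1 hT ht hx hx3).trans (le_of_eq (by ring))) (by positivity)
    _ = (∑ n ∈ Finset.Icc 1 ⌊y⌋₊, ((divfun n : ℝ) * (n:ℝ) ^ (-(1/4):ℝ))) * (30 * T ^ (-(1/4):ℝ) * |t - x|) := by rw [Finset.sum_mul]
    _ ≤ (C * y ^ ((76/100):ℝ)) * (30 * T ^ (-(1/4):ℝ) * |t - x|) := by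
        gcongr; exact h y hy
    _ = _ := by ring

lemma R2_pw : ∃ C : ℝ, 0 < C ∧ ∀ (T x : ℝ) (I : ℕ), 10 ≤ T → T ≤ x → x ≤ 2 * T → T ^ 2 ≤ 2 ^ I →
    |R2 (T ^ ((1:ℝ)/4)) x| ≤ (2 * T ^ ((1/4):ℝ) / T ^ ((249/1000):ℝ)) *
      (∫ t in (x - T ^ ((249/1000):ℝ))..(x + T ^ ((249/1000):ℝ)), ∑ i ∈ Finset.range I, ‖ZZ (2 ^ i * T ^ ((1:ℝ)/4)) t‖) +
      C * T ^ ((2495/10000):ℝ) := by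
  obtain ⟨C1, hC1, hP⟩ := PW
  obtain ⟨C2, hC2, hL⟩ := R1_lip
  refine ⟨2 * C2 + C1 * 2004, by positivity, fun T x I hT hTx hxT hI => ?_⟩
  have hT0 : 0 < T := by linarith
  have hT1 : 1 ≤ T := by linarith
  obtain ⟨f1, f2⟩ := H_facts (a := 249/1000) hT (by norm_num)
  have le : ∀ a b : ℝ, a ≤ b → T ^ a ≤ T ^ b := fun a b h => Real.rpow_le_rpow_of_exponent_le hT1 h
  have hy1 : 1 ≤ T ^ ((1:ℝ)/4) := Real.one_le_rpow hT1 (by norm_num)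
  set H := T ^ ((249/1000):ℝ) with hH
  set y := T ^ ((1:ℝ)/4) with hy
  have hH0 : 0 < H := by positivity
  have hI1 : (1:ℝ) ≤ 2 ^ I := one_le_pow₀ (by norm_num)
  have hN1 : 1 ≤ 2 ^ I * y := by nlinarith
  have h1 := hP T x H (2 ^ I * y) (R1 y x) hT hTx hxT hH0 f1 hN1
  set S : ℝ → ℝ := fun t => ∑ i ∈ Finset.range I, ‖ZZ (2 ^ i * y) t‖ with hS
  have hSc : Continuous S := continuous_finsetSum _ fun i _ => (continuous_ZZ _).norm
  have hpt : ∀ t ∈ Set.Icc (x-H) (x+H), |R1 (2 ^ I * y) t - R1 y x| ≤ 2 * T ^ ((1/4):ℝ) * S t + C2 * T ^ ((2495/10000):ℝ) := by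
    intro t ht
    have a1 := R1_dyadic y t hy1 (by linarith [ht.1]) I
    have a2 := hL T t x y hT (by linarith [ht.1]) (by linarith) (by linarith) hy1
    have a3 := rpow_quarter_le hT0 (show 0 ≤ t by linarith [ht.1]) (by linarith [ht.2])
    have a4 : |t - x| ≤ H := by rw [abs_le]; constructor <;> linarith [ht.1, ht.2]
    have hS0 : 0 ≤ S t := Finset.sum_nonneg fun _ _ => norm_nonneg _
    have a5 : y ^ ((76/100):ℝ) * T ^ (-(1/4):ℝ) * |t - x| ≤ T ^ ((2495/10000):ℝ) := by
      calc _ ≤ y ^ ((76/100):ℝ) * T ^ (-(1/4):ℝ) * H := by gcongr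
        _ ≤ _ := by
          rw [hy, hH, ← Real.rpow_mul hT0.le, ← Real.rpow_add hT0, ← Real.rpow_add hT0]; exact le _ _ (by norm_num)
    calc _ ≤ |R1 (2 ^ I * y) t - R1 y t| + |R1 y t - R1 y x| := abs_sub_le _ _ _
      _ ≤ t ^ ((1/4):ℝ) * S t + C2 * (y ^ ((76/100):ℝ) * T ^ (-(1/4):ℝ) * |t - x|) := add_le_add a1 a2
      _ ≤ _ := by gcongr
  have h2 : ∫ t in (x-H)..(x+H), |R1 (2 ^ I * y) t - R1 y x| ≤
      ∫ t in (x-H)..(x+H), (2 * T ^ ((1/4):ℝ) * S t + C2 * T ^ ((2495/10000):ℝ)) := by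
    refine intervalIntegral.integral_mono_on (by linarith) ?_ ?_ hpt
    · exact ((continuous_R1 _).sub continuous_const).abs.intervalIntegrable _ _
    · exact ((continuous_const.mul hSc).add continuous_const).intervalIntegrable _ _
  have hi1 : IntervalIntegrable (fun t => 2 * T ^ ((1/4):ℝ) * S t) volume (x-H) (x+H) :=
    (continuous_const.mul hSc).intervalIntegrable _ _
  have hi2 : IntervalIntegrable (fun _ : ℝ => C2 * T ^ ((2495/10000):ℝ)) volume (x-H) (x+H) :=
    continuous_const.intervalIntegrable _ _
  rw [intervalIntegral.integral_add hi1 hi2,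
    intervalIntegral.integral_const_mul, intervalIntegral.integral_const, smul_eq_mul,
    show x + H - (x - H) = 2 * H by ring] at h2
  have hl := one_add_log_le (κ := 5/10000) hT1 (by norm_num)
  have g1 : H ^ 2 * (1 + Real.log T) ≤ H * (2001 * T ^ ((2495/10000):ℝ)) := by
    have : H * T ^ ((5/10000):ℝ) ≤ T ^ ((2495/10000):ℝ) := by
      rw [hH, ← Real.rpow_add hT0]; exact le _ _ (by norm_num)
    calc H ^ 2 * (1 + Real.log T) ≤ H ^ 2 * (2001 * T ^ ((5/10000):ℝ)) := by
          refine mul_le_mul_of_nonneg_left (hl.trans (le_of_eq ?_)) (by positivity)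
          norm_num
      _ = H * (2001 * (H * T ^ ((5/10000):ℝ))) := by ring
      _ ≤ _ := by gcongr
  have g2 : H ≤ H * T ^ ((2495/10000):ℝ) := le_mul_of_one_le_right hH0.le (Real.one_le_rpow hT1 (by norm_num))
  have g3 : T ^ ((1/4):ℝ) ≤ H * T ^ ((2495/10000):ℝ) := by
    rw [hH, ← Real.rpow_add hT0]; exact le _ _ (by norm_num)
  have g4 : T ^ ((3/4):ℝ) * (2 ^ I * y) ^ (-(24/100):ℝ) ≤ H * T ^ ((2495/10000):ℝ) := by
    have hb : T ^ ((9/4):ℝ) ≤ 2 ^ I * y := by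
      rw [show ((9/4):ℝ) = 2 + 1/4 by norm_num, Real.rpow_add hT0, hy]
      gcongr
      exact_mod_cast hI
    have : (2 ^ I * y) ^ (-(24/100):ℝ) ≤ (T ^ ((9/4):ℝ)) ^ (-(24/100):ℝ) :=
      Real.rpow_le_rpow_of_nonpos (by positivity) hb (by norm_num)
    calc _ ≤ T ^ ((3/4):ℝ) * (T ^ ((9/4):ℝ)) ^ (-(24/100):ℝ) := by gcongr
      _ ≤ _ := by
        rw [hH, ← Real.rpow_mul hT0.le, ← Real.rpow_add hT0, ← Real.rpow_add hT0]; exact le _ _ (by norm_num)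
  have h4 : H * |R2 y x| ≤ H * ((2 * T ^ ((1/4):ℝ) / H) * (∫ t in (x-H)..(x+H), S t) + (2 * C2 + C1 * 2004) * T ^ ((2495/10000):ℝ)) := by
    unfold R2
    refine h1.trans ?_
    have h5 : C1 * (H ^ 2 * (1 + Real.log T) + H + T ^ ((1/4):ℝ) + T ^ ((3/4):ℝ) * (2 ^ I * y) ^ (-(24/100):ℝ)) ≤
        C1 * (2004 * (H * T ^ ((2495/10000):ℝ))) := by
      apply mul_le_mul_of_nonneg_left _ hC1.le
      linarith
    have h6 : H * ((2 * T ^ ((1/4):ℝ) / H) * (∫ t in (x-H)..(x+H), S t) + (2 * C2 + C1 * 2004) * T ^ ((2495/10000):ℝ)) =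
      2 * T ^ ((1/4):ℝ) * (∫ t in (x-H)..(x+H), S t) + H * (2 * C2 + C1 * 2004) * T ^ ((2495/10000):ℝ) := by
      field_simp
    rw [h6]
    linarith
  exact le_of_mul_le_mul_left h4 hH0

end DivM

namespace DivM

lemma measurable_R2 (y : ℝ) : Measurable (R2 y) := by
  have h1 : Measurable (DirichletDelta) := by
    unfold DirichletDelta
    have : Measurable (fun x : ℝ => ∑ n ∈ Finset.Icc 1 ⌊x⌋₊, (divfun n : ℝ)) := by
      have h2 : Measurable (fun k : ℕ => ∑ n ∈ Finset.Icc 1 k, (divfun n : ℝ)) := measurable_from_nat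
      exact h2.comp Nat.measurable_floor
    fun_prop
  unfold R2
  exact h1.sub (continuous_R1 y).measurable

lemma shift_setIntegral (F : ℝ → ℝ) (E : Set ℝ) (τ : ℝ) :
    ∫ x in E, F (x + τ) = ∫ t in (fun t => t + (-τ)) ⁻¹' E, F t := by
  have h := (measurePreserving_add_right (volume : Measure ℝ) τ).setIntegral_preimage_emb
    (measurableEmbedding_addRight τ) F ((fun t => t + (-τ)) ⁻¹' E)
  rw [← h]
  congr 2
  ext x; simp

lemma shift_volume (E : Set ℝ) (τ : ℝ) :
    volume.real ((fun t => t + (-τ)) ⁻¹' E) = volume.real E := by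
  simp only [Measure.real, measure_preimage_add_right]

lemma window_swap (F : ℝ → ℝ) (hF : Continuous F) (E : Set ℝ) (a b H : ℝ) (hH : 0 ≤ H)
    (hEab : E ⊆ Set.Icc a b) :
    IntegrableOn (fun x => ∫ t in (x - H)..(x + H), F t) E ∧
    ∫ x in E, (∫ t in (x - H)..(x + H), F t) = ∫ τ in (-H)..H, ∫ t in (fun t => t + (-τ)) ⁻¹' E, F t := by
  have e1 : ∀ x : ℝ, ∫ t in (x - H)..(x + H), F t = ∫ τ in Set.Ioc (-H) H, F (x + τ) := by
    intro x
    rw [← intervalIntegral.integral_of_le (by linarith), intervalIntegral.integral_comp_add_left]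
    rfl
  have hintg : Integrable (fun p : ℝ × ℝ => F (p.1 + p.2)) ((volume.restrict E).prod (volume.restrict (Set.Ioc (-H) H))) := by
    rw [Measure.prod_restrict, ← Measure.volume_eq_prod]
    have hc : IntegrableOn (fun p : ℝ × ℝ => F (p.1 + p.2)) (Set.Icc a b ×ˢ Set.Icc (-H) H) volume :=
      ContinuousOn.integrableOn_compact (isCompact_Icc.prod isCompact_Icc) (by fun_prop)
    exact hc.mono_set (Set.prod_mono hEab Set.Ioc_subset_Icc_self)
  simp only [e1]
  refine ⟨hintg.integral_prod_left, ?_⟩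
  rw [integral_integral_swap hintg, intervalIntegral.integral_of_le (by linarith)]
  refine integral_congr_ae (Filter.Eventually.of_forall fun τ => ?_)
  exact shift_setIntegral F E τ

lemma exists_I : ∃ C : ℝ, 0 < C ∧ ∀ T : ℝ, 10 ≤ T → ∃ I : ℕ, T ^ 2 ≤ 2 ^ I ∧ (2:ℝ) ^ I ≤ 2 * T ^ 2 ∧
    (I : ℝ) ≤ C * T ^ ((1/10000):ℝ) := by
  refine ⟨4 * 10001, by norm_num, fun T hT => ?_⟩
  have hT0 : 0 < T := by linarith
  have hT1 : 1 ≤ T := by linarith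
  have hT2 : (1:ℝ) ≤ T ^ 2 := one_le_pow₀ hT1
  have hl0 : 0 ≤ Real.logb 2 (T ^ 2) := Real.logb_nonneg (by norm_num) hT2
  have hp : (2:ℝ) ^ Real.logb 2 (T ^ 2) = T ^ 2 := Real.rpow_logb (by norm_num) (by norm_num) (by positivity)
  refine ⟨⌈Real.logb 2 (T ^ 2)⌉₊, ?_, ?_, ?_⟩
  · rw [← Real.rpow_natCast 2]
    refine hp.symm.le.trans ?_
    exact Real.rpow_le_rpow_of_exponent_le (by norm_num) (Nat.le_ceil _)
  · rw [← Real.rpow_natCast 2]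
    calc (2:ℝ) ^ ((⌈Real.logb 2 (T ^ 2)⌉₊ : ℕ) : ℝ) ≤ 2 ^ (Real.logb 2 (T ^ 2) + 1) :=
          Real.rpow_le_rpow_of_exponent_le (by norm_num) (Nat.ceil_lt_add_one hl0).le
      _ = _ := by rw [Real.rpow_add (by norm_num), hp, Real.rpow_one]; ring
  · have h1 := (Nat.ceil_lt_add_one hl0).le
    have h2 : Real.logb 2 (T ^ 2) ≤ 4 * Real.log T := by
      rw [Real.logb, Real.log_pow, div_le_iff₀ (Real.log_pos (by norm_num))]
      have := Real.log_two_gt_d9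
      have hl := Real.log_nonneg hT1
      push_cast
      nlinarith
    have h3 := one_add_log_le (κ := 1/10000) hT1 (by norm_num)
    norm_num at h3 ⊢
    linarith

end DivM

namespace DivM

lemma dyadic_sum : ∃ C : ℝ, 0 < C ∧ ∀ T : ℝ, 10 ≤ T → ∃ I : ℕ, T ^ 2 ≤ 2 ^ I ∧
    ∀ (T0 s : ℝ) (A : Set ℝ), 0 < T0 → MeasurableSet A → A ⊆ Set.Icc s (s + T0) → A ⊆ Set.Icc (T/2) (3*T) →
    ∫ t in A, (∑ i ∈ Finset.range I, ‖ZZ (2 ^ i * T ^ ((1:ℝ)/4)) t‖) ≤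
      C * (T ^ ((2504/10000):ℝ) * √(volume.real A) + T ^ (-(623/10000):ℝ) * volume.real A +
        T ^ (-(1561/10000):ℝ) * T0 ^ ((1/4):ℝ) * volume.real A) := by
  obtain ⟨C1, hC1, hI⟩ := exists_I
  obtain ⟨C2, hC2, hD⟩ := dual_Z (1/10000) (by norm_num)
  refine ⟨C1 * C2, by positivity, fun T hT => ?_⟩
  obtain ⟨I, i1, i2, i3⟩ := hI T hT
  refine ⟨I, i1, fun T0 s A hT0' hA hAs hAT => ?_⟩
  have hT0 : 0 < T := by linarith
  have hT1 : 1 ≤ T := by linarith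
  have le : ∀ a b : ℝ, a ≤ b → T ^ a ≤ T ^ b := fun a b h => Real.rpow_le_rpow_of_exponent_le hT1 h
  have hy1 : 1 ≤ T ^ ((1:ℝ)/4) := Real.one_le_rpow hT1 (by norm_num)
  have hAint : ∀ i : ℕ, IntegrableOn (fun t => ‖ZZ (2 ^ i * T ^ ((1:ℝ)/4)) t‖) A := fun i =>
    ((continuous_ZZ _).norm.continuousOn.integrableOn_compact isCompact_Icc).mono_set hAs
  rw [integral_finsetSum _ fun i _ => hAint i]
  set m := volume.real A with hm
  have hm0 : 0 ≤ m := measureReal_nonneg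
  have hT04 : 0 ≤ T0 ^ ((1/4):ℝ) := by positivity
  have key : ∀ i ∈ Finset.range I, ∫ t in A, ‖ZZ (2 ^ i * T ^ ((1:ℝ)/4)) t‖ ≤
      C2 * (T ^ ((2503/10000):ℝ) * √m + T ^ (-(624/10000):ℝ) * m + T ^ (-(1562/10000):ℝ) * T0 ^ ((1/4):ℝ) * m) := by
    intro i hi
    have p1 : (1:ℝ) ≤ 2 ^ i := one_le_pow₀ (by norm_num)
    have p2 : (2:ℝ) ^ i ≤ 2 ^ I := pow_le_pow_right₀ (by norm_num) (Finset.mem_range.mp hi).le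
    have hMl : T ^ ((1:ℝ)/4) ≤ 2 ^ i * T ^ ((1:ℝ)/4) := le_mul_of_one_le_left (by positivity) p1
    have hMu : 2 ^ i * T ^ ((1:ℝ)/4) ≤ T ^ (3:ℝ) := by
      have q : T ^ ((1:ℝ)/4) ≤ T / 2 := (H_facts hT (by norm_num)).2
      calc 2 ^ i * T ^ ((1:ℝ)/4) ≤ (2 * T ^ 2) * (T / 2) := by
            apply mul_le_mul (p2.trans i2) q (by positivity) (by positivity)
        _ = T ^ 3 := by ring
        _ = _ := by norm_cast
    refine (hD _ T T0 s (hy1.trans hMl) hT1 hT0' A hA hAs hAT).trans ?_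
    rw [← hm]
    set M := 2 ^ i * T ^ ((1:ℝ)/4) with hM
    have hM0 : 0 < M := by positivity
    apply mul_le_mul_of_nonneg_left _ hC2.le
    have r1 : M ^ ((1/10000):ℝ) * T ^ ((1/4):ℝ) ≤ T ^ ((2503/10000):ℝ) := by
      calc _ ≤ (T ^ (3:ℝ)) ^ ((1/10000):ℝ) * T ^ ((1/4):ℝ) := by gcongr
        _ = _ := by rw [← Real.rpow_mul hT0.le, ← Real.rpow_add hT0]; norm_num
    have r2 : M ^ ((1/10000 - 1/4):ℝ) ≤ T ^ (-(624/10000):ℝ) := by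
      calc _ ≤ (T ^ ((1:ℝ)/4)) ^ ((1/10000 - 1/4):ℝ) := Real.rpow_le_rpow_of_nonpos (by positivity) hMl (by norm_num)
        _ ≤ _ := by rw [← Real.rpow_mul hT0.le]; exact le _ _ (by norm_num)
    have r3 : M ^ ((1/10000 - 1/8):ℝ) * T ^ (-(1/8):ℝ) ≤ T ^ (-(1562/10000):ℝ) := by
      calc _ ≤ (T ^ ((1:ℝ)/4)) ^ ((1/10000 - 1/8):ℝ) * T ^ (-(1/8):ℝ) := by
            apply mul_le_mul_of_nonneg_right _ (by positivity)
            exact Real.rpow_le_rpow_of_nonpos (by positivity) hMl (by norm_num)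
        _ ≤ _ := by rw [← Real.rpow_mul hT0.le, ← Real.rpow_add hT0]; exact le _ _ (by norm_num)
    have s1 := mul_le_mul_of_nonneg_right r1 (Real.sqrt_nonneg m)
    have s2 := mul_le_mul_of_nonneg_right r2 hm0
    have s3 := mul_le_mul_of_nonneg_right r3 (mul_nonneg hT04 hm0)
    linarith
  refine (Finset.sum_le_sum key).trans ?_
  rw [Finset.sum_const, Finset.card_range, nsmul_eq_mul]
  set X := T ^ ((2503/10000):ℝ) * √m + T ^ (-(624/10000):ℝ) * m + T ^ (-(1562/10000):ℝ) * T0 ^ ((1/4):ℝ) * m with hX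
  have hX0 : 0 ≤ X := by positivity
  calc (I:ℝ) * (C2 * X) ≤ (C1 * T ^ ((1/10000):ℝ)) * (C2 * X) := by gcongr
    _ = C1 * C2 * (T ^ ((1/10000):ℝ) * X) := by ring
    _ = _ := by
      congr 1
      rw [show ((2504/10000):ℝ) = 1/10000 + 2503/10000 by norm_num,
        show (-(623/10000):ℝ) = 1/10000 + -(624/10000) by norm_num,
        show (-(1561/10000):ℝ) = 1/10000 + -(1562/10000) by norm_num,
        Real.rpow_add hT0, Real.rpow_add hT0, Real.rpow_add hT0, hX]
      ring

lemma large_E : ∃ K : ℝ, 0 < K ∧ ∀ (T V s T0 : ℝ) (E : Set ℝ), 10 ≤ T → K * T ^ ((2495/10000):ℝ) ≤ V →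
    MeasurableSet E → E ⊆ Set.Icc T (2*T) → E ⊆ Set.Icc s (s + T0) → 0 < T0 →
    K * T ^ ((939/10000):ℝ) * T0 ^ ((1/4):ℝ) ≤ V →
    (∀ x ∈ E, V ≤ |R2 (T ^ ((1:ℝ)/4)) x|) → V ^ 2 * volume.real E ≤ K ^ 2 * T ^ ((10008/10000):ℝ) := by
  obtain ⟨C1, hC1, hS⟩ := dyadic_sum
  obtain ⟨C2, hC2, hP⟩ := R2_pw
  refine ⟨16 * C1 + 4 * C2, by positivity, fun T V s T0 E hT hV hE hET hEs hT0' hVT hEV => ?_⟩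
  obtain ⟨I, hI, hB⟩ := hS T hT
  have hT0 : 0 < T := by linarith
  have hT1 : 1 ≤ T := by linarith
  have le : ∀ a b : ℝ, a ≤ b → T ^ a ≤ T ^ b := fun a b h => Real.rpow_le_rpow_of_exponent_le hT1 h
  obtain ⟨f1, f2⟩ := H_facts (a := 249/1000) hT (by norm_num)
  set H := T ^ ((249/1000):ℝ) with hH
  have hH0 : 0 < H := by positivity
  set S : ℝ → ℝ := fun t => ∑ i ∈ Finset.range I, ‖ZZ (2 ^ i * T ^ ((1:ℝ)/4)) t‖ with hSd
  have hSc : Continuous S := continuous_finsetSum _ fun i _ => (continuous_ZZ _).norm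
  obtain ⟨w1, w2⟩ := window_swap S hSc E T (2*T) H hH0.le hET
  have hEfin : volume E ≠ ⊤ := ((measure_mono hET).trans_lt (by simp)).ne
  set m := volume.real E with hm
  have hm0 : 0 ≤ m := measureReal_nonneg
  have hK : 0 < 16 * C1 + 4 * C2 := by positivity
  have hV0 : 0 < V := lt_of_lt_of_le (by positivity) hV
  set B := C1 * (T ^ ((2504/10000):ℝ) * √m + T ^ (-(623/10000):ℝ) * m + T ^ (-(1561/10000):ℝ) * T0 ^ ((1/4):ℝ) * m) with hBd
  have hB0 : 0 ≤ B := by positivity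
  have b1 : ∀ τ ∈ Set.uIoc (-H) H, ‖∫ t in (fun t => t + (-τ)) ⁻¹' E, S t‖ ≤ B := by
    intro τ hτ
    rw [Set.uIoc_of_le (by linarith)] at hτ
    have hS0 : 0 ≤ ∫ t in (fun t => t + (-τ)) ⁻¹' E, S t :=
      integral_nonneg fun t => Finset.sum_nonneg fun _ _ => norm_nonneg _
    rw [Real.norm_eq_abs, abs_of_nonneg hS0]
    have := hB T0 (s + τ) ((fun t => t + (-τ)) ⁻¹' E) hT0' (hE.preimage (by fun_prop)) ?_ ?_
    · rwa [shift_volume] at this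
    · intro t ht
      have := hEs ht
      simp only [Set.mem_Icc] at this ⊢
      constructor <;> linarith [this.1, this.2]
    · intro t ht
      have := hET ht
      simp only [Set.mem_Icc] at this ⊢
      constructor <;> linarith [this.1, this.2, hτ.1, hτ.2]
  have b2 : ∫ x in E, (∫ t in (x - H)..(x + H), S t) ≤ B * (2 * H) := by
    rw [w2]
    refine (le_abs_self _).trans ?_
    have := intervalIntegral.norm_integral_le_of_norm_le_const b1
    rw [Real.norm_eq_abs, show H - -H = 2 * H by ring, abs_of_pos (by positivity : 0 < 2 * H)] at this
    exact this
  have b3 : V * m ≤ (2 * T ^ ((1/4):ℝ) / H) * (B * (2 * H)) + C2 * T ^ ((2495/10000):ℝ) * m := by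
    have hi1 : IntegrableOn (fun x => (2 * T ^ ((1/4):ℝ) / H) * (∫ t in (x - H)..(x + H), S t)) E := w1.const_mul _
    have hi2 : IntegrableOn (fun _ : ℝ => C2 * T ^ ((2495/10000):ℝ)) E := integrableOn_const hEfin
    have c1 : ∫ _ in E, V ≤ ∫ x in E, ((2 * T ^ ((1/4):ℝ) / H) * (∫ t in (x - H)..(x + H), S t) + C2 * T ^ ((2495/10000):ℝ)) := by
      refine setIntegral_mono_on (integrableOn_const hEfin) (hi1.add hi2) hE fun x hx => ?_
      exact (hEV x hx).trans (hP T x I hT (hET hx).1 (hET hx).2 hI)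
    rw [integral_add hi1 hi2, integral_const_mul, setIntegral_const, setIntegral_const, smul_eq_mul, smul_eq_mul, ← hm] at c1
    have c2 := mul_le_mul_of_nonneg_left b2 (show 0 ≤ 2 * T ^ ((1/4):ℝ) / H by positivity)
    linarith
  have b4 : (2 * T ^ ((1/4):ℝ) / H) * (B * (2 * H)) = 4 * (T ^ ((1/4):ℝ) * B) := by
    field_simp; ring
  have b5 : T ^ ((1/4):ℝ) * B = C1 * (T ^ ((5004/10000):ℝ) * √m + T ^ ((1877/10000):ℝ) * m + T ^ ((939/10000):ℝ) * T0 ^ ((1/4):ℝ) * m) := by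
    rw [hBd, show ((5004/10000):ℝ) = 1/4 + 2504/10000 by norm_num,
        show ((1877/10000):ℝ) = 1/4 + -(623/10000) by norm_num,
        show ((939/10000):ℝ) = 1/4 + -(1561/10000) by norm_num,
        Real.rpow_add hT0, Real.rpow_add hT0, Real.rpow_add hT0]
    ring
  have b6 : 16 * C1 * T ^ ((1877/10000):ℝ) + 4 * C2 * T ^ ((2495/10000):ℝ) ≤ V := by
    have := mul_le_mul_of_nonneg_left (le (1877/10000) (2495/10000) (by norm_num)) (show 0 ≤ 16 * C1 by positivity)
    linarith
  have b7 : 16 * C1 * (T ^ ((939/10000):ℝ) * T0 ^ ((1/4):ℝ)) ≤ V := by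
    have : 0 ≤ 4 * C2 * (T ^ ((939/10000):ℝ) * T0 ^ ((1/4):ℝ)) := by positivity
    linarith
  have d1 := mul_le_mul_of_nonneg_right b6 hm0
  have d2 := mul_le_mul_of_nonneg_right b7 hm0
  rw [b4, b5] at b3
  have b8 : V * m ≤ 8 * C1 * T ^ ((5004/10000):ℝ) * √m := by linarith
  have b9 : V * √m ≤ 8 * C1 * T ^ ((5004/10000):ℝ) := by
    rcases (Real.sqrt_nonneg m).eq_or_lt with h | h
    · rw [← h]; simp; positivity
    · refine le_of_mul_le_mul_right ?_ h
      calc V * √m * √m = V * (√m * √m) := by ring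
        _ = V * m := by rw [Real.mul_self_sqrt hm0]
        _ ≤ _ := b8
  calc V ^ 2 * m = (V * √m) ^ 2 := by rw [mul_pow, Real.sq_sqrt hm0]
    _ ≤ (8 * C1 * T ^ ((5004/10000):ℝ)) ^ 2 := by gcongr
    _ ≤ ((16 * C1 + 4 * C2) * T ^ ((5004/10000):ℝ)) ^ 2 := by gcongr; linarith
    _ = _ := by
      rw [mul_pow, ← Real.rpow_natCast (T ^ ((5004/10000):ℝ)), ← Real.rpow_mul hT0.le]; norm_num

end DivM

namespace DivM

/-- The set where the tail is large. -/
def SV (T V : ℝ) : Set ℝ := {x | x ∈ Set.Icc T (2*T) ∧ V ≤ |R2 (T ^ ((1:ℝ)/4)) x|}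

lemma measurableSet_SV (T V : ℝ) : MeasurableSet (SV T V) :=
  measurableSet_Icc.inter (measurableSet_le measurable_const (measurable_R2 _).abs)

lemma large_S : ∃ K C : ℝ, 0 < K ∧ 0 < C ∧ ∀ T V : ℝ, 10 ≤ T → K * T ^ ((2495/10000):ℝ) ≤ V →
    V ^ 7 * volume.real (SV T V) ≤ C * T ^ ((272/100):ℝ) := by
  obtain ⟨K, hK, hE⟩ := large_E
  obtain ⟨C, hC, hsup⟩ := R2_sup
  refine ⟨K, K ^ 2 * (C ^ 5 + K ^ 4 * C), hK, by positivity, fun T V hT hV => ?_⟩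
  have hT0 : 0 < T := by linarith
  have hT1 : 1 ≤ T := by linarith
  have le : ∀ a b : ℝ, a ≤ b → T ^ a ≤ T ^ b := fun a b h => Real.rpow_le_rpow_of_exponent_le hT1 h
  have hV0 : 0 < V := lt_of_lt_of_le (by positivity) hV
  by_cases hVC : V ≤ C * T ^ ((34/100):ℝ)
  swap
  · have : SV T V = ∅ := by
      ext x
      simp only [SV, Set.mem_ofPred_eq, Set.mem_empty_iff_false, iff_false, not_and]
      intro hx hVx
      exact hVC (hVx.trans (hsup T x hT hx.1 hx.2))
    rw [this]; simp; positivity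
  set W := V / (K * T ^ ((939/10000):ℝ)) with hW
  have hW0 : 0 < W := by positivity
  have hWV : K * T ^ ((939/10000):ℝ) * W = V := by rw [hW]; field_simp
  set T0 := W ^ 4 with hT0d
  have hTp : 0 < T0 := by positivity
  have hT04 : T0 ^ ((1/4):ℝ) = W := by
    rw [hT0d, ← Real.rpow_natCast, ← Real.rpow_mul hW0.le]; norm_num
  set N := ⌊T / T0⌋₊ + 1 with hN
  set P : ℕ → Set ℝ := fun k => SV T V ∩ Set.Icc (T + k * T0) (T + k * T0 + T0) with hP
  have hfin : ∀ k, volume (P k) ≠ ⊤ := fun k =>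
    ((measure_mono (Set.inter_subset_right)).trans_lt (by simp)).ne
  have hcov : SV T V ⊆ ⋃ k ∈ Finset.range N, P k := by
    intro x hx
    have hx1 := hx.1
    have h0 : 0 ≤ (x - T) / T0 := div_nonneg (by linarith [hx1.1]) hTp.le
    simp only [Set.mem_iUnion]
    refine ⟨⌊(x - T) / T0⌋₊, ?_, hx, ?_, ?_⟩
    · rw [Finset.mem_range, hN, Nat.lt_succ_iff]
      apply Nat.floor_le_floor
      gcongr; linarith [hx1.2]
    · have := Nat.floor_le h0
      rw [le_div_iff₀ hTp] at this
      linarith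
    · have := (Nat.lt_floor_add_one ((x - T) / T0)).le
      rw [div_le_iff₀ hTp] at this
      linarith
  have hk : ∀ k ∈ Finset.range N, V ^ 2 * volume.real (P k) ≤ K ^ 2 * T ^ ((10008/10000):ℝ) := fun k _ =>
    hE T V (T + k * T0) T0 (P k) hT hV ((measurableSet_SV T V).inter measurableSet_Icc) (fun x hx => hx.1.1)
      (fun x hx => hx.2) hTp (by rw [hT04, hWV]) (fun x hx => hx.1.2)
  have h1 : volume.real (SV T V) ≤ ∑ k ∈ Finset.range N, volume.real (P k) := by
    refine (measureReal_mono hcov ?_).trans (measureReal_biUnion_finset_le _ _)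
    exact ((measure_biUnion_finset_le _ _).trans_lt (ENNReal.sum_lt_top.mpr fun k _ => (hfin k).lt_top)).ne
  have h2 : V ^ 2 * volume.real (SV T V) ≤ (T / T0 + 1) * (K ^ 2 * T ^ ((10008/10000):ℝ)) := by
    calc _ ≤ V ^ 2 * ∑ k ∈ Finset.range N, volume.real (P k) := by gcongr
      _ = ∑ k ∈ Finset.range N, V ^ 2 * volume.real (P k) := by rw [Finset.mul_sum]
      _ ≤ ∑ k ∈ Finset.range N, K ^ 2 * T ^ ((10008/10000):ℝ) := Finset.sum_le_sum hk
      _ = N * (K ^ 2 * T ^ ((10008/10000):ℝ)) := by rw [Finset.sum_const, Finset.card_range, nsmul_eq_mul]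
      _ ≤ _ := by
        apply mul_le_mul_of_nonneg_right _ (by positivity)
        rw [hN]; push_cast
        linarith [Nat.floor_le (show 0 ≤ T / T0 by positivity)]
  have h3 : V ^ 5 * (T / T0 + 1) = V ^ 5 + T * (K ^ 4 * (T ^ ((939/10000):ℝ)) ^ 4 * V) := by
    rw [hT0d, hW]; field_simp; ring
  have h4 : V ^ 5 ≤ C ^ 5 * T ^ ((17/10):ℝ) := by
    calc V ^ 5 ≤ (C * T ^ ((34/100):ℝ)) ^ 5 := by gcongr
      _ = _ := by rw [mul_pow, ← Real.rpow_natCast (T ^ ((34/100):ℝ)), ← Real.rpow_mul hT0.le]; norm_num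
  have h5 : T * (K ^ 4 * (T ^ ((939/10000):ℝ)) ^ 4 * V) ≤ K ^ 4 * C * T ^ ((17156/10000):ℝ) := by
    calc _ ≤ T * (K ^ 4 * (T ^ ((939/10000):ℝ)) ^ 4 * (C * T ^ ((34/100):ℝ))) := by gcongr
      _ = K ^ 4 * C * (T ^ (1:ℝ) * (T ^ ((939/10000):ℝ)) ^ 4 * T ^ ((34/100):ℝ)) := by rw [Real.rpow_one]; ring
      _ = _ := by
        rw [← Real.rpow_natCast (T ^ ((939/10000):ℝ)), ← Real.rpow_mul hT0.le, ← Real.rpow_add hT0, ← Real.rpow_add hT0]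
        norm_num
  have h6 : V ^ 5 * (T / T0 + 1) ≤ (C ^ 5 + K ^ 4 * C) * T ^ ((17156/10000):ℝ) := by
    have := mul_le_mul_of_nonneg_left (le (17/10) (17156/10000) (by norm_num)) (show 0 ≤ C ^ 5 by positivity)
    rw [h3]; linarith
  calc V ^ 7 * volume.real (SV T V) = V ^ 5 * (V ^ 2 * volume.real (SV T V)) := by ring
    _ ≤ V ^ 5 * ((T / T0 + 1) * (K ^ 2 * T ^ ((10008/10000):ℝ))) := by gcongr
    _ = (V ^ 5 * (T / T0 + 1)) * (K ^ 2 * T ^ ((10008/10000):ℝ)) := by ring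
    _ ≤ ((C ^ 5 + K ^ 4 * C) * T ^ ((17156/10000):ℝ)) * (K ^ 2 * T ^ ((10008/10000):ℝ)) := by gcongr
    _ = K ^ 2 * (C ^ 5 + K ^ 4 * C) * (T ^ ((17156/10000):ℝ) * T ^ ((10008/10000):ℝ)) := by ring
    _ ≤ _ := by
      rw [← Real.rpow_add hT0]
      exact mul_le_mul_of_nonneg_left (le _ _ (by norm_num)) (by positivity)

lemma dyadic_pow (a V : ℝ) (ha : 0 ≤ a) (hV : 0 < V) (K : ℕ) (h : a ≤ 2 ^ K * V) :
    a ^ 7 ≤ V ^ 7 + ∑ i ∈ Finset.range K, (2 * (2 ^ i * V)) ^ 7 * (if 2 ^ i * V ≤ a then 1 else 0) := by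
  induction K with
  | zero => simp at h ⊢; gcongr
  | succ K ih =>
    rw [Finset.sum_range_succ]
    have hp : ∀ i : ℕ, 0 ≤ (2 * (2 ^ i * V)) ^ 7 * (if 2 ^ i * V ≤ a then (1:ℝ) else 0) := by
      intro i; split_ifs <;> positivity
    by_cases h2 : 2 ^ K * V ≤ a
    · have := Finset.sum_nonneg (s := Finset.range K) fun i _ => hp i
      have h3 : a ^ 7 ≤ (2 * (2 ^ K * V)) ^ 7 := by
        gcongr; rw [pow_succ] at h; linarith
      rw [if_pos h2, mul_one]
      have : 0 ≤ V ^ 7 := by positivity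
      linarith
    · have := ih (by linarith)
      linarith [hp K]

lemma final_bound : ∃ C : ℝ, 0 < C ∧ ∀ T : ℝ, 10 ≤ T →
    (∫ x in T..(2*T), |R2 (T ^ ((1:ℝ)/4)) x| ^ 7) ≤ C * T ^ ((27465/10000):ℝ) := by
  obtain ⟨K, C, hK, hC, hS⟩ := large_S
  obtain ⟨C1, hC1, hI⟩ := exists_I
  obtain ⟨C2, hC2, hsup⟩ := R2_sup
  refine ⟨(K + C2) ^ 7 + C1 * (128 * C), by positivity, fun T hT => ?_⟩
  obtain ⟨I, i1, -, i3⟩ := hI T hT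
  have hT0 : 0 < T := by linarith
  have hT1 : 1 ≤ T := by linarith
  have le : ∀ a b : ℝ, a ≤ b → T ^ a ≤ T ^ b := fun a b h => Real.rpow_le_rpow_of_exponent_le hT1 h
  set V := (K + C2) * T ^ ((2495/10000):ℝ) with hV
  have hV0 : 0 < V := by positivity
  have hKV : K * T ^ ((2495/10000):ℝ) ≤ V := by rw [hV]; gcongr; linarith
  have hVs : C2 * T ^ ((34/100):ℝ) ≤ 2 ^ I * V := by
    calc C2 * T ^ ((34/100):ℝ) ≤ (K + C2) * T ^ (2:ℝ) := by
          gcongr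
          · linarith
          · norm_num
      _ = (K + C2) * T ^ 2 := by norm_cast
      _ ≤ (K + C2) * 2 ^ I := by gcongr
      _ = 2 ^ I * ((K + C2) * 1) := by ring
      _ ≤ 2 ^ I * V := by
        rw [hV]; gcongr; exact Real.one_le_rpow hT1 (by norm_num)
  rw [intervalIntegral.integral_of_le (by linarith)]
  set g : ℝ → ℝ := fun x => V ^ 7 + ∑ i ∈ Finset.range I, (SV T (2 ^ i * V)).indicator (fun _ => (2 * (2 ^ i * V)) ^ 7) x with hg
  have hfin : IsFiniteMeasure (volume.restrict (Set.Ioc T (2*T))) := inferInstance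
  have hgi : ∀ i ∈ Finset.range I, Integrable ((SV T (2 ^ i * V)).indicator (fun _ => (2 * (2 ^ i * V)) ^ 7)) (volume.restrict (Set.Ioc T (2*T))) :=
    fun i _ => (integrable_const _).indicator (measurableSet_SV _ _)
  have hgs : Integrable (fun x => ∑ i ∈ Finset.range I, (SV T (2 ^ i * V)).indicator (fun _ => (2 * (2 ^ i * V)) ^ 7) x) (volume.restrict (Set.Ioc T (2*T))) :=
    integrable_finsetSum _ hgi
  have h1 : ∫ x in Set.Ioc T (2*T), |R2 (T ^ ((1:ℝ)/4)) x| ^ 7 ≤ ∫ x in Set.Ioc T (2*T), g x := by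
    refine integral_mono_of_nonneg (Filter.Eventually.of_forall fun x => by positivity) ((integrable_const _).add hgs) ?_
    filter_upwards [ae_restrict_mem measurableSet_Ioc] with x hx
    have hb := (hsup T x hT hx.1.le hx.2).trans hVs
    refine (dyadic_pow _ V (abs_nonneg _) hV0 I hb).trans (le_of_eq ?_)
    rw [hg]
    congr 1
    refine Finset.sum_congr rfl fun i _ => ?_
    by_cases h : 2 ^ i * V ≤ |R2 (T ^ ((1:ℝ)/4)) x|
    · rw [if_pos h, Set.indicator_of_mem (show x ∈ SV T (2 ^ i * V) from ⟨⟨hx.1.le, hx.2⟩, h⟩), mul_one]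
    · rw [if_neg h, Set.indicator_of_notMem (fun hh => h hh.2), mul_zero]
  have h2 : ∫ x in Set.Ioc T (2*T), g x = T * V ^ 7 + ∑ i ∈ Finset.range I, ∫ x in Set.Ioc T (2*T), (SV T (2 ^ i * V)).indicator (fun _ => (2 * (2 ^ i * V)) ^ 7) x := by
    rw [hg, integral_add (integrable_const _) hgs, integral_finsetSum _ hgi]
    congr 1
    rw [setIntegral_const, smul_eq_mul, Real.volume_real_Ioc_of_le (by linarith)]
    ring
  have h3 : ∀ i ∈ Finset.range I, ∫ x in Set.Ioc T (2*T), (SV T (2 ^ i * V)).indicator (fun _ => (2 * (2 ^ i * V)) ^ 7) x ≤ 128 * C * T ^ ((272/100):ℝ) := by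
    intro i _
    rw [integral_indicator (measurableSet_SV _ _), Measure.restrict_restrict (measurableSet_SV _ _), setIntegral_const, smul_eq_mul]
    have hle : volume.real (SV T (2 ^ i * V) ∩ Set.Ioc T (2*T)) ≤ volume.real (SV T (2 ^ i * V)) := by
      refine measureReal_mono Set.inter_subset_left ?_
      exact ((measure_mono (fun x hx => hx.1 : SV T (2 ^ i * V) ⊆ Set.Icc T (2*T))).trans_lt (by simp)).ne
    have hVi : K * T ^ ((2495/10000):ℝ) ≤ 2 ^ i * V := hKV.trans (le_mul_of_one_le_left hV0.le (one_le_pow₀ (by norm_num)))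
    have := hS T (2 ^ i * V) hT hVi
    calc _ ≤ volume.real (SV T (2 ^ i * V)) * (2 * (2 ^ i * V)) ^ 7 := by gcongr
      _ = 128 * ((2 ^ i * V) ^ 7 * volume.real (SV T (2 ^ i * V))) := by ring
      _ ≤ _ := by linarith
  refine h1.trans ?_
  rw [h2]
  have h4 : T * V ^ 7 = (K + C2) ^ 7 * T ^ ((27465/10000):ℝ) := by
    rw [hV, mul_pow, ← Real.rpow_natCast (T ^ ((2495/10000):ℝ)), ← Real.rpow_mul hT0.le,
      show ((27465/10000):ℝ) = 1 + (2495/10000) * ((7:ℕ):ℝ) by norm_num, Real.rpow_add hT0, Real.rpow_one]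
    ring
  have h5 : ∑ i ∈ Finset.range I, ∫ x in Set.Ioc T (2*T), (SV T (2 ^ i * V)).indicator (fun _ => (2 * (2 ^ i * V)) ^ 7) x ≤ C1 * (128 * C) * T ^ ((27465/10000):ℝ) := by
    calc _ ≤ ∑ i ∈ Finset.range I, 128 * C * T ^ ((272/100):ℝ) := Finset.sum_le_sum h3
      _ = I * (128 * C * T ^ ((272/100):ℝ)) := by rw [Finset.sum_const, Finset.card_range, nsmul_eq_mul]
      _ ≤ (C1 * T ^ ((1/10000):ℝ)) * (128 * C * T ^ ((272/100):ℝ)) := by gcongr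
      _ = C1 * (128 * C) * (T ^ ((1/10000):ℝ) * T ^ ((272/100):ℝ)) := by ring
      _ ≤ _ := by
        rw [← Real.rpow_add hT0]
        exact mul_le_mul_of_nonneg_left (le _ _ (by norm_num)) (by positivity)
  rw [h4]
  linarith

end DivM

theorem seventh_power_moment_R2 (ε : ℝ) (hε : 0 < ε) :
    ∃ C : ℝ, 0 < C ∧ ∀ T : ℝ, 10 ≤ T →
      (∫ x in T..(2 * T), |R2 (T ^ ((1 : ℝ) / 4)) x| ^ 7)
        ≤ C * T ^ ((11 : ℝ) / 4 - 1 / 336 + ε) := by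
  obtain ⟨C, hC, h⟩ := DivM.final_bound
  refine ⟨C, hC, fun T hT => (h T hT).trans ?_⟩
  refine mul_le_mul_of_nonneg_left (Real.rpow_le_rpow_of_exponent_le (by linarith) ?_) hC.le
  norm_num
  linarith
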